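/- Let r ≥ 9·binom(94,2) + 2 be an integer and let A ∈ ℤ^{r×n} be a matrix of rank r whose columns are nonzero and pairwise non-parallel and all of whose r×r submatrices have determinant of absolute value at most 3. Suppose there is a set X of binom(r+1,2) column indices of A and a bijection σ from X to the column index set of [I_r | D_r] such that, for every S ⊆ X, the columns of A indexed by S are linearly independent over ℚ if and only if the columns of [I_r | D_r] indexed by σ(S) are linearly independent (i.e., the vector matroid of A restricted to X is a spanning clique, isomorphic to M(K_{r+1})). Then n ≤ binom(r+1,2) + 2(r−1). -/

import Mathlib

/-- The index set for the columns of `D_r`: pairs `(i, j)` with `i < j`. -/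
abbrev PairIdx (r : ℕ) := {p : Fin r × Fin r // p.1 < p.2}

/-- The integer matrix `D_r` whose columns are `e_i - e_j` for `i < j`. -/
def Dmat (r : ℕ) : Matrix (Fin r) (PairIdx r) ℤ :=
  Matrix.of fun i p => if i = p.val.1 then 1 else if i = p.val.2 then -1 else 0

/-- The block matrix `[I_r | D_r]`. -/
def IDmat (r : ℕ) : Matrix (Fin r) (Fin r ⊕ PairIdx r) ℤ :=
  Matrix.of fun i => Sum.elim (fun j => if i = j then 1 else 0) (fun p => Dmat r i p)

/-- Two integer vectors are parallel if they are linearly dependent over `ℚ`. -/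
def IntParallel {r : ℕ} (u v : Fin r → ℤ) : Prop :=
  ¬ LinearIndependent ℚ ![(fun i => (u i : ℚ)), (fun i => (v i : ℚ))]

/-- The columns of `A` indexed by `S` are linearly independent over `ℚ`. -/
def ColsIndepQ {r : ℕ} {ι : Type} (A : Matrix (Fin r) ι ℤ) (S : Set ι) : Prop :=
  LinearIndependent ℚ (fun j : S => fun i => ((A i j.val : ℤ) : ℚ))

/-- A matrix with `r` rows is `Δ`-modular if every `r × r` submatrix has
determinant of absolute value at most `Δ`. -/
def DeltaModular {r n : ℕ} (A : Matrix (Fin r) (Fin n) ℤ) (Δ : ℤ) : Prop :=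
  ∀ f : Fin r → Fin n, Function.Injective f → |(A.submatrix id f).det| ≤ Δ

/-- The matrix whose columns are `u l` at the root of a coloured class, the unit vector at the root
of the uncoloured class, and multiples of `e_x - e_{root x}` elsewhere. -/
def forestMatrix {V κ R : Type*} [DecidableEq V] [CommRing R] (u : κ → V → R)
    (ρ : V → Option κ) (rep : Option κ → V) (c : V → R) : Matrix V V R :=
  Matrix.of fun y x => if rep (ρ x) = x then
      (match ρ x with
        | none => if y = x then 1 else 0
        | some l => u l y)
    else c x * ((if y = x then 1 else 0) - (if y = rep (ρ x) then 1 else 0))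

theorem det_forestMatrix {V κ R : Type*} [Fintype V] [DecidableEq V] [Fintype κ] [DecidableEq κ]
    [CommRing R] (u : κ → V → R) (ρ : V → Option κ) (rep : Option κ → V)
    (hrep : ∀ o, ρ (rep o) = o) (c : V → R) :
    (forestMatrix u ρ rep c).det =
      (∏ x with rep (ρ x) ≠ x, c x) * (Matrix.of fun i l => ∑ x with ρ x = some l, u i x).det := by
  classical
  set X := forestMatrix u ρ rep (fun _ => 1) with hX
  have h1 : forestMatrix u ρ rep c =
      Matrix.of fun y x => (if rep (ρ x) = x then 1 else c x) * X y x := by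
    ext y x
    simp only [forestMatrix, hX, Matrix.of_apply]
    split_ifs <;> simp
  have h2 : ∏ x, (if rep (ρ x) = x then 1 else c x) = ∏ x with rep (ρ x) ≠ x, c x := by
    rw [Finset.prod_filter]
    exact Finset.prod_congr rfl fun x _ => by by_cases h : rep (ρ x) = x <;> simp [h]
  rw [h1, Matrix.det_mul_row, h2]
  congr 1
  let U : Matrix V V R := Matrix.of fun y x =>
    if rep (ρ y) = y then (if ρ x = ρ y then 1 else 0) else (if x = y then 1 else 0)
  let p : V → Prop := fun x => rep (ρ x) = x
  let e : Option κ ≃ {x // p x} :=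
    { toFun := fun o => ⟨rep o, by simp [p, hrep]⟩
      invFun := fun x => ρ x.1
      left_inv := fun o => hrep o
      right_inv := fun x => Subtype.ext x.2 }
  have hU : U.det = 1 := by
    rw [Matrix.twoBlockTriangular_det U p]
    · have a1 : Matrix.toSquareBlockProp U p = 1 := by
        ext ⟨i, hi⟩ ⟨j, hj⟩
        have : ρ j = ρ i ↔ i = j :=
          ⟨fun h => by rw [← hi, ← hj, h], fun h => by rw [h]⟩
        simp only [Matrix.toSquareBlockProp, Matrix.toBlock_apply, U, Matrix.of_apply,
          Matrix.one_apply, Subtype.mk.injEq]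
        rw [if_pos hi]
        simp [this]
      have a2 : (Matrix.toSquareBlockProp U fun i => ¬ p i) = 1 := by
        ext ⟨i, hi⟩ ⟨j, hj⟩
        simp only [Matrix.toSquareBlockProp, Matrix.toBlock_apply, U, Matrix.of_apply,
          Matrix.one_apply, Subtype.mk.injEq]
        rw [if_neg hi]
        simp [eq_comm]
      rw [a1, a2]; simp
    · intro i hi j hj
      simp only [U, Matrix.of_apply]
      rw [if_neg hi, if_neg]
      rintro rfl
      exact hi hj
  have hUX : ∀ y x, (U * X) y x = if rep (ρ y) = y then
      (if rep (ρ x) = x then (match ρ x with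
        | none => if ρ y = none then 1 else 0
        | some l => ∑ z with ρ z = ρ y, u l z) else 0)
      else X y x := by
    intro y x
    rw [Matrix.mul_apply]
    by_cases hy : rep (ρ y) = y
    · simp only [U, Matrix.of_apply, hy, if_true, ite_mul, one_mul, zero_mul]
      by_cases hx : rep (ρ x) = x
      · simp only [X, forestMatrix, Matrix.of_apply, hx, if_true]
        rcases h : ρ x with _ | l
        · simp only [← ite_and]
          rw [Finset.sum_eq_single x]
          · simp [h, eq_comm]
          · intro b _ hb; simp [hb]
          · simp
        · simp [Finset.sum_filter]
      · simp only [X, forestMatrix, Matrix.of_apply, hx, if_false, one_mul]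
        rw [← Finset.sum_filter, Finset.sum_sub_distrib, Finset.sum_ite_eq', Finset.sum_ite_eq']
        simp [hrep]
    · simp [U, hy]
  have hdet : X.det = (U * X).det := by rw [Matrix.det_mul, hU, one_mul]
  rw [hdet, Matrix.twoBlockTriangular_det' (U * X) p]
  · have a2 : (Matrix.toSquareBlockProp (U * X) fun i => ¬ p i) = 1 := by
      ext ⟨i, hi⟩ ⟨j, hj⟩
      simp only [Matrix.toSquareBlockProp, Matrix.toBlock_apply, hUX, Matrix.one_apply,
        Subtype.mk.injEq]
      rw [if_neg hi]
      simp only [X, forestMatrix, Matrix.of_apply]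
      rw [if_neg hj, if_neg (c := i = rep (ρ j))]
      · simp
      · rintro rfl
        exact hi (by simp [p, hrep])
    have a1 : ((Matrix.toSquareBlockProp (U * X) p).submatrix e e).det =
        (Matrix.of fun i l => ∑ x with ρ x = some l, u i x).det := by
      obtain ⟨q, hq⟩ : ∃ q : Option κ → Prop, ∀ o, q o ↔ o = none := ⟨_, fun _ => Iff.rfl⟩
      rw [Matrix.twoBlockTriangular_det _ q]
      · let e' : κ ≃ {o : Option κ // ¬ q o} :=
          { toFun := fun l => ⟨some l, by simp [hq]⟩
            invFun := fun o => o.1.get (Option.isSome_iff_ne_none.2 fun h => o.2 ((hq _).2 h))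
            left_inv := fun l => rfl
            right_inv := fun o => Subtype.ext (by simp) }
        have b1 : (Matrix.toSquareBlockProp ((Matrix.toSquareBlockProp (U * X) p).submatrix e e) q)
            = 1 := by
          ext ⟨i, hi⟩ ⟨j, hj⟩
          have hi' : i = none := (hq _).1 hi
          have hj' : j = none := (hq _).1 hj
          subst hi' hj'
          simp [Matrix.toSquareBlockProp, e, hUX, hrep]
        rw [b1, Matrix.det_one, one_mul, ← Matrix.det_submatrix_equiv_self e', ← Matrix.det_transpose]
        congr 1
        ext l i
        simp [Matrix.toSquareBlockProp, e, e', hUX, hrep]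
      · intro i hi j hj
        have hj' : j = none := (hq _).1 hj
        subst hj'
        have hi' : i ≠ none := fun h => hi ((hq _).2 h)
        simp [Matrix.toSquareBlockProp, e, hUX, hrep, hi']
    rw [a2, Matrix.det_one, mul_one, ← a1, Matrix.det_submatrix_equiv_self]
  · intro i hi j hj
    rw [hUX, if_pos hi, if_neg hj]

/-- `x y` is a unit edge of the family `w` at scale `β` if some `w j` is `± β (e_x - e_y)`. -/
def IsUnitEdge {n r : ℕ} (β : ℤ) (w : Fin n → Fin (r + 1) → ℤ) (x y : Fin (r + 1)) : Prop :=
  ∃ j, w j = β • (Pi.single x 1 - Pi.single y 1) ∨ w j = -(β • (Pi.single x 1 - Pi.single y 1))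

/-- The columns of a `3`-modular matrix with a spanning clique, written (after scaling by `β`) in
terms of the vertices of the clique. -/
structure CliqueForm {n r : ℕ} (β : ℤ) (w : Fin n → Fin (r + 1) → ℤ) : Prop where
  sum_zero : ∀ j, ∑ x, w j x = 0
  nonpar : ∀ j j', j ≠ j' → ∀ p q : ℤ, p • w j = q • w j' → p = 0 ∧ q = 0
  edge : ∀ x y, x ≠ y → ∃ j c, c ≠ 0 ∧ |c| ≤ β ∧ w j = c • (Pi.single x 1 - Pi.single y 1)
  det : ∀ (k : ℕ) (u : Fin k → Fin n) (ρ : Fin (r + 1) → Option (Fin k))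
    (rep : Option (Fin k) → Fin (r + 1)), (∀ o, ρ (rep o) = o) →
    ∃ z, β * (Matrix.of fun i l => ∑ x with ρ x = some l, w (u i) x).det = β ^ k * z ∧
      ((∀ x, rep (ρ x) ≠ x → IsUnitEdge β w x (rep (ρ x))) → |z| ≤ 3)

/-- `u` is, up to sign, a member of the family `w`. -/
def IsSigned {n r : ℕ} (w : Fin n → Fin (r + 1) → ℤ) (u : Fin (r + 1) → ℤ) : Prop :=
  ∃ j, u = w j ∨ u = -w j

theorem IsSigned.neg {n r : ℕ} {w : Fin n → Fin (r + 1) → ℤ} {u : Fin (r + 1) → ℤ}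
    (h : IsSigned w u) : IsSigned w (-u) := by
  obtain ⟨j, h | h⟩ := h
  · exact ⟨j, Or.inr (by rw [h])⟩
  · exact ⟨j, Or.inl (by rw [h, neg_neg])⟩

theorem isSigned_self {n r : ℕ} (w : Fin n → Fin (r + 1) → ℤ) (j : Fin n) : IsSigned w (w j) :=
  ⟨j, Or.inl rfl⟩

namespace CliqueForm

variable {n r : ℕ} {β : ℤ} {w : Fin n → Fin (r + 1) → ℤ}

theorem sum_signed (h : CliqueForm β w) {u : Fin (r + 1) → ℤ} (hu : IsSigned w u) :
    ∑ x, u x = 0 := by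
  obtain ⟨j, rfl | rfl⟩ := hu
  · exact h.sum_zero j
  · simp [h.sum_zero j]

theorem det_signed (h : CliqueForm β w) {k : ℕ} (u : Fin k → Fin (r + 1) → ℤ)
    (hu : ∀ i, IsSigned w (u i)) (ρ : Fin (r + 1) → Option (Fin k))
    (rep : Option (Fin k) → Fin (r + 1)) (hrep : ∀ o, ρ (rep o) = o) :
    ∃ z, β * (Matrix.of fun i l => ∑ x with ρ x = some l, u i x).det = β ^ k * z ∧
      ((∀ x, rep (ρ x) ≠ x → IsUnitEdge β w x (rep (ρ x))) → |z| ≤ 3) := by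
  have hu' : ∀ i, ∃ j, ∃ s : ℤ, |s| = 1 ∧ u i = s • w j := by
    intro i
    obtain ⟨j, hj | hj⟩ := hu i
    · exact ⟨j, 1, by simp, by simpa using hj⟩
    · exact ⟨j, -1, by simp, by simpa using hj⟩
  choose j s hs hj using hu'
  obtain ⟨z, hz, hz'⟩ := h.det k j ρ rep hrep
  refine ⟨(∏ i, s i) * z, ?_, fun hE => ?_⟩
  · have : (Matrix.of fun i l => ∑ x with ρ x = some l, u i x) =
        Matrix.of fun i l => s i * (Matrix.of fun i l => ∑ x with ρ x = some l, w (j i) x) i l := by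
      ext i l
      simp [hj, Finset.mul_sum]
    rw [this, Matrix.det_mul_column, mul_left_comm, hz]
    ring
  · rw [abs_mul, Finset.abs_prod]
    simpa [hs] using hz' hE

theorem det_sets (h : CliqueForm β w) {k : ℕ} (u : Fin k → Fin (r + 1) → ℤ)
    (hu : ∀ i, IsSigned w (u i)) (S : Fin k → Finset (Fin (r + 1)))
    (hS : ∀ l l', l ≠ l' → Disjoint (S l) (S l')) (t : Fin k → Fin (r + 1)) (ht : ∀ l, t l ∈ S l)
    (t₀ : Fin (r + 1)) (ht₀ : ∀ l, t₀ ∉ S l) :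
    ∃ z, β * (Matrix.of fun i l => ∑ x ∈ S l, u i x).det = β ^ k * z ∧
      ((∀ x, (∀ l, x ∉ S l) → x ≠ t₀ → IsUnitEdge β w x t₀) →
        (∀ l, ∀ x ∈ S l, x ≠ t l → IsUnitEdge β w x (t l)) → |z| ≤ 3) := by
  classical
  let ρ : Fin (r + 1) → Option (Fin k) := fun x =>
    if hx : ∃ l, x ∈ S l then some hx.choose else none
  have h1 : ∀ x l, x ∈ S l → ρ x = some l := by
    intro x l hx
    have hex : ∃ l, x ∈ S l := ⟨l, hx⟩
    simp only [ρ, dif_pos hex, Option.some.injEq]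
    by_contra hne
    exact Finset.disjoint_left.1 (hS _ _ hne) hex.choose_spec hx
  have h2 : ∀ x, (∀ l, x ∉ S l) → ρ x = none := by
    intro x hx
    simp only [ρ]
    rw [dif_neg]
    rintro ⟨l, hl⟩
    exact hx l hl
  have h3 : ∀ x l, ρ x = some l ↔ x ∈ S l := by
    refine fun x l => ⟨fun hx => ?_, h1 x l⟩
    by_cases hex : ∃ l, x ∈ S l
    · obtain ⟨l', hl'⟩ := hex
      rw [h1 x l' hl', Option.some.injEq] at hx
      exact hx ▸ hl'
    · push Not at hex
      rw [h2 x hex] at hx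
      cases hx
  obtain ⟨z, hz, hz'⟩ := h.det_signed u hu ρ (fun o => o.elim t₀ t) (by
    rintro (_ | l)
    · exact h2 _ ht₀
    · exact h1 _ _ (ht l))
  refine ⟨z, ?_, fun hE hE' => hz' ?_⟩
  · rw [← hz]
    congr 3
    ext i l
    congr 1
    ext x
    simp [h3]
  · intro x hx
    by_cases hex : ∃ l, x ∈ S l
    · obtain ⟨l, hl⟩ := hex
      rw [h1 x l hl] at hx ⊢
      exact hE' l x hl hx.symm
    · push Not at hex
      rw [h2 x hex] at hx ⊢
      exact hE x hex hx.symm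

theorem det_sets_of_unit (h : CliqueForm β w) (hE : ∀ x y, x ≠ y → IsUnitEdge β w x y) {k : ℕ}
    (u : Fin k → Fin (r + 1) → ℤ)
    (hu : ∀ i, IsSigned w (u i)) (S : Fin k → Finset (Fin (r + 1)))
    (hS : ∀ l l', l ≠ l' → Disjoint (S l) (S l')) :
    ∃ z, |z| ≤ 3 ∧ β * (Matrix.of fun i l => ∑ x ∈ S l, u i x).det = β ^ k * z := by
  by_cases he : ∃ l, S l = ∅
  · obtain ⟨l, hl⟩ := he
    refine ⟨0, by simp, ?_⟩
    rw [Matrix.det_eq_zero_of_column_eq_zero l (fun i => by simp [hl])]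
    simp
  · push Not at he
    choose t ht using he
    by_cases h0 : ∃ t₀, ∀ l, t₀ ∉ S l
    · obtain ⟨t₀, ht₀⟩ := h0
      obtain ⟨z, hz, hz'⟩ := h.det_sets u hu S hS t ht t₀ ht₀
      exact ⟨z, hz' (fun x _ hx => hE _ _ hx) (fun l x _ hx => hE _ _ hx), hz⟩
    · push Not at h0
      refine ⟨0, by simp, ?_⟩
      have hM : (Matrix.of fun i l => ∑ x ∈ S l, u i x).det = 0 := by
        obtain ⟨l₀, -⟩ := h0 0
        refine Matrix.exists_mulVec_eq_zero_iff.1 ⟨fun _ => 1, ?_, ?_⟩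
        · intro h
          simpa using congrFun h l₀
        · ext i
          simp only [Matrix.mulVec, dotProduct, Matrix.of_apply, mul_one, Pi.zero_apply]
          rw [← h.sum_signed (hu i), ← Finset.sum_biUnion]
          · apply Finset.sum_congr _ fun _ _ => rfl
            ext x
            simpa using h0 x
          · intro l _ l' _ hne
            exact hS l l' hne
      rw [hM]; simp

theorem sum_le (h : CliqueForm β w) (hβ : β ≠ 0) (hE : ∀ x y, x ≠ y → IsUnitEdge β w x y)
    {u : Fin (r + 1) → ℤ} (hu : IsSigned w u) (S : Finset (Fin (r + 1))) :
    |∑ x ∈ S, u x| ≤ 3 := by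
  obtain ⟨z, hz, hz'⟩ := h.det_sets_of_unit hE ![u] (by simpa using hu) ![S] (fun l l' hl =>
    (hl (Subsingleton.elim _ _)).elim)
  simp only [Matrix.det_unique, Matrix.of_apply, pow_one] at hz'
  have := mul_left_cancel₀ hβ hz'
  simp at this
  rwa [this]

theorem det_two (h : CliqueForm β w) (hβ : β ≠ 0) (hE : ∀ x y, x ≠ y → IsUnitEdge β w x y)
    {u v : Fin (r + 1) → ℤ} (hu : IsSigned w u) (hv : IsSigned w v) {S T : Finset (Fin (r + 1))}
    (hST : Disjoint S T) :
    ∃ z, |z| ≤ 3 ∧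
      (∑ x ∈ S, u x) * (∑ x ∈ T, v x) - (∑ x ∈ T, u x) * (∑ x ∈ S, v x) = β * z := by
  obtain ⟨z, hz, hz'⟩ := h.det_sets_of_unit hE ![u, v] (by
    intro i; fin_cases i <;> assumption) ![S, T] (by
    intro l l' hl
    fin_cases l <;> fin_cases l' <;> simp at hl ⊢
    · exact hST
    · exact hST.symm)
  refine ⟨z, hz, mul_left_cancel₀ hβ ?_⟩
  rw [Matrix.det_fin_two] at hz'
  simp at hz'
  rw [hz']; ring

theorem det_three (h : CliqueForm β w) (hβ : β ≠ 0) (hE : ∀ x y, x ≠ y → IsUnitEdge β w x y)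
    {u v t : Fin (r + 1) → ℤ} (hu : IsSigned w u) (hv : IsSigned w v) (ht : IsSigned w t)
    {S T R : Finset (Fin (r + 1))}
    (hST : Disjoint S T) (hSR : Disjoint S R) (hTR : Disjoint T R) :
    ∃ z, |z| ≤ 3 ∧
      (∑ x ∈ S, u x) * ((∑ x ∈ T, v x) * (∑ x ∈ R, t x) - (∑ x ∈ R, v x) * (∑ x ∈ T, t x)) -
      (∑ x ∈ T, u x) * ((∑ x ∈ S, v x) * (∑ x ∈ R, t x) - (∑ x ∈ R, v x) * (∑ x ∈ S, t x)) +
      (∑ x ∈ R, u x) * ((∑ x ∈ S, v x) * (∑ x ∈ T, t x) - (∑ x ∈ T, v x) * (∑ x ∈ S, t x)) =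
      β ^ 2 * z := by
  obtain ⟨z, hz, hz'⟩ := h.det_sets_of_unit hE ![u, v, t] (by
    intro i; fin_cases i <;> assumption) ![S, T, R] (by
    intro l l' hl
    fin_cases l <;> fin_cases l' <;> simp at hl ⊢ <;>
    first | assumption | (apply Disjoint.symm; assumption))
  refine ⟨z, hz, mul_left_cancel₀ hβ ?_⟩
  rw [Matrix.det_fin_three] at hz'
  simp at hz'
  linear_combination hz'

end CliqueForm

theorem det_cyclic_gain {m : ℕ} (β : ℤ) (κ : Fin (m + 1) → ℤ) :
    |(Matrix.of fun i l : Fin (m + 1) =>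
      β * ((if i = l then 1 else 0) - (if i + 1 = l then 1 else 0)) +
        (if l = 0 then κ i else 0)).det| = |β| ^ m * |∑ i, κ i| := by
  set N : Matrix (Fin (m + 1)) (Fin (m + 1)) ℤ := Matrix.of fun i l =>
      β * ((if i = l then 1 else 0) - (if i + 1 = l then 1 else 0)) +
        (if l = 0 then κ i else 0) with hN
  have h1 : (N.updateCol 0 fun k => ∑ i, (1 : ℤ) • N k i).det = N.det := by
    have := Matrix.det_updateCol_sum N 0 (fun _ => (1 : ℤ))
    rwa [one_smul] at this
  have h2 : (fun k => ∑ i, (1 : ℤ) • N k i) = κ := by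
    ext k
    simp [hN, Finset.sum_add_distrib, ← Finset.mul_sum, Finset.sum_sub_distrib]
  rw [h2] at h1
  set N' := N.updateCol 0 κ with hN'
  have h3 : (N'.updateRow (Fin.last m) fun l => ∑ i, (1 : ℤ) • N' i l).det = N'.det := by
    have := Matrix.det_updateRow_sum N' (Fin.last m) (fun _ => (1 : ℤ))
    rw [one_smul] at this
    rw [← this]
    congr 2
    ext l
    simp only [one_smul]
    exact (Finset.sum_apply l _ _).symm
  have h4 : (fun l => ∑ i, (1 : ℤ) • N' i l) = Pi.single 0 (∑ i, κ i) := by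
    ext l
    by_cases hl : l = 0
    · subst hl; simp [hN']
    · have : ∀ i, N' i l = β * ((if i = l then 1 else 0) - (if i + 1 = l then 1 else 0)) := by
        intro i
        simp [hN', hN, hl]
      have h5 : ∑ i : Fin (m + 1), (if i + 1 = l then (1 : ℤ) else 0) = 1 := by
        rw [Finset.sum_eq_single (l - 1)]
        · simp
        · intro b _ hb
          rw [if_neg]
          rintro rfl
          simp at hb
        · simp
      simp only [this, one_smul, ← Finset.mul_sum, Finset.sum_sub_distrib, h5]
      simp [hl]
  rw [h4] at h3
  rw [← h1, ← h3, Matrix.det_succ_row _ (Fin.last m), Finset.sum_eq_single 0]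
  · have h6 : ((N'.updateRow (Fin.last m) (Pi.single 0 (∑ i, κ i))).submatrix
        (Fin.last m).succAbove (Fin.succAbove 0)).det = (-β) ^ m := by
      have h7 : ∀ i j : Fin m, (N'.updateRow (Fin.last m) (Pi.single 0 (∑ i, κ i))).submatrix
          (Fin.last m).succAbove (Fin.succAbove 0) i j =
          β * ((if (i : ℕ) = j + 1 then 1 else 0) - (if i = j then 1 else 0)) := by
        intro i j
        rw [Matrix.submatrix_apply, Matrix.updateRow_ne (Fin.succAbove_ne _ _), Fin.succAbove_last,
          Fin.succAbove_zero, hN', Matrix.updateCol_ne (Fin.succ_ne_zero j), hN, Matrix.of_apply,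
          Fin.coeSucc_eq_succ, if_neg (Fin.succ_ne_zero j), add_zero]
        congr 2
        · exact if_congr (by rw [Fin.ext_iff]; simp) rfl rfl
        · exact if_congr (Fin.succ_inj) rfl rfl
      rw [Matrix.det_of_isLowerTriangular]
      · rw [Finset.prod_congr rfl (g := fun _ => -β)]
        · simp
        · intro i _
          rw [h7]
          simp
      · intro i j hij
        have hij' : (i : ℕ) < j := hij
        rw [h7, if_neg (by omega), if_neg (by intro h; subst h; omega)]
        simp
    rw [h6]
    simp [abs_mul, mul_comm]
  · intro b _ hb
    simp [hb]
  · simp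

theorem sum_perm_offDiag {r : ℕ} (M : Fin r → Fin r → ℤ) {i j i' j' : Fin r} (h : i ≠ j)
    (h' : i' ≠ j') :
    ∑ σ : Equiv.Perm (Fin r), M (σ i) (σ j) = ∑ σ : Equiv.Perm (Fin r), M (σ i') (σ j') := by
  let τ : Equiv.Perm (Fin r) := (Equiv.swap i i').trans (Equiv.swap (Equiv.swap i i' j) j')
  have h1 : τ i = i' := by
    simp only [τ, Equiv.trans_apply, Equiv.swap_apply_left]
    apply Equiv.swap_apply_of_ne_of_ne _ h'
    intro e
    have : Equiv.swap i i' i = Equiv.swap i i' j := by rw [Equiv.swap_apply_left]; exact e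
    exact h (Equiv.injective _ this)
  have h2 : τ j = j' := by simp [τ]
  rw [← Equiv.sum_comp (Equiv.mulRight τ)]
  simp [h1, h2]

/-- If the sum of `M` along every Hamiltonian directed cycle is at most `3`, then the average of `M`
over the ordered pairs is at most `3 / r`. -/
theorem sum_offDiag_le {m : ℕ} (hm : 1 ≤ m) (M : Fin (m + 1) → Fin (m + 1) → ℤ)
    (hM : ∀ σ : Equiv.Perm (Fin (m + 1)), ∑ t, M (σ t) (σ (t + 1)) ≤ 3) :
    ∑ p ∈ Finset.offDiag (Finset.univ : Finset (Fin (m + 1))), M p.1 p.2 ≤ 3 * m := by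
  set T := ∑ p ∈ Finset.offDiag (Finset.univ : Finset (Fin (m + 1))), M p.1 p.2 with hT
  have h01 : (0 : Fin (m + 1)) ≠ 0 + 1 := by
    rw [zero_add]; intro h
    have := congrArg Fin.val h
    rw [Fin.val_one', Fin.val_zero, Nat.mod_eq_of_lt (by omega)] at this
    omega
  set F := ∑ σ : Equiv.Perm (Fin (m + 1)), M (σ 0) (σ (0 + 1)) with hF
  have hcard : (Finset.offDiag (Finset.univ : Finset (Fin (m + 1)))).card = (m + 1) * m := by
    rw [Finset.offDiag_card]
    simp
    rw [Nat.sub_eq_iff_eq_add (by nlinarith)]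
    ring
  have e1 : ∑ p ∈ Finset.offDiag (Finset.univ : Finset (Fin (m + 1))),
      ∑ σ : Equiv.Perm (Fin (m + 1)), M (σ p.1) (σ p.2) = (m + 1) * m * F := by
    rw [Finset.sum_congr rfl (g := fun _ => F)]
    · simp [hcard]
    · rintro ⟨i, j⟩ hp
      exact sum_perm_offDiag M (by simpa using hp) h01
  have e2 : ∑ p ∈ Finset.offDiag (Finset.univ : Finset (Fin (m + 1))),
      ∑ σ : Equiv.Perm (Fin (m + 1)), M (σ p.1) (σ p.2) = (Fintype.card (Equiv.Perm (Fin (m + 1))) : ℤ) * T := by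
    rw [Finset.sum_comm, Finset.sum_congr rfl (g := fun _ => T)]
    · simp
    · intro σ _
      refine Finset.sum_bij (fun p _ => (σ p.1, σ p.2)) ?_ ?_ ?_ ?_
      · simp
      · rintro ⟨a, b⟩ _ ⟨c, d⟩ _ h
        simpa using h
      · rintro ⟨a, b⟩ h
        exact ⟨(σ.symm a, σ.symm b), by simpa using h, by simp⟩
      · simp
  have e3 : (m + 1) * F ≤ 3 * (Fintype.card (Equiv.Perm (Fin (m + 1))) : ℤ) := by
    calc (m + 1) * F = ∑ t : Fin (m + 1), ∑ σ : Equiv.Perm (Fin (m + 1)), M (σ t) (σ (t + 1)) := by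
          rw [Finset.sum_congr rfl (g := fun _ => F)]
          · simp
          · intro t _
            apply sum_perm_offDiag M _ h01
            intro h
            apply h01
            have := congrArg (fun x => x - t) h
            simpa using this
      _ = ∑ σ : Equiv.Perm (Fin (m + 1)), ∑ t : Fin (m + 1), M (σ t) (σ (t + 1)) := Finset.sum_comm
      _ ≤ ∑ σ : Equiv.Perm (Fin (m + 1)), 3 := Finset.sum_le_sum fun σ _ => hM σ
      _ = _ := by simp [mul_comm]
  have hpos : 0 < (Fintype.card (Equiv.Perm (Fin (m + 1))) : ℤ) := by
    exact_mod_cast Fintype.card_pos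
  refine le_of_mul_le_mul_left ?_ hpos
  rw [← e2, e1]
  have hm0 : (0 : ℤ) ≤ m := by positivity
  nlinarith [mul_le_mul_of_nonneg_left e3 hm0]

namespace CliqueForm

variable {n r : ℕ} {β : ℤ} {w : Fin n → Fin (r + 1) → ℤ}

theorem eq_of_sum_eq_of_eq_off {V : Type*} [Fintype V] [DecidableEq V] (a : V) {f g : V → ℤ}
    (hs : ∑ x, f x = ∑ x, g x) (h : ∀ x, x ≠ a → f x = g x) : f = g := by
  ext x
  by_cases hx : x = a
  · subst hx
    rw [← Finset.add_sum_erase _ _ (Finset.mem_univ x),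
      ← Finset.add_sum_erase _ _ (Finset.mem_univ x),
      Finset.sum_congr rfl fun y hy => h y (Finset.ne_of_mem_erase hy)] at hs
    exact add_right_cancel hs
  · exact h x hx

theorem subset_sums_le_one {V : Type*} [DecidableEq V] (g : V → ℤ) (T : Finset V)
    (h : ∀ S ⊆ T, |∑ x ∈ S, g x| ≤ 1) :
    (∀ x ∈ T, g x = 0) ∨
    (∃ x ∈ T, ∃ ε : ℤ, (ε = 1 ∨ ε = -1) ∧ ∀ z ∈ T, g z = ε * (if z = x then 1 else 0)) ∨
    ∃ x ∈ T, ∃ y ∈ T, x ≠ y ∧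
      ∀ z ∈ T, g z = (if z = x then 1 else 0) - (if z = y then 1 else 0) := by
  have h1 : ∀ x ∈ T, g x = 0 ∨ g x = 1 ∨ g x = -1 := by
    intro x hx
    have := abs_le.1 (h {x} (by simpa using hx))
    simp only [Finset.sum_singleton] at this
    omega
  have h2 : ∀ x ∈ T, ∀ y ∈ T, x ≠ y → |g x + g y| ≤ 1 := by
    intro x hx y hy hxy
    have := h {x, y} (by intro z; simp; rintro (rfl | rfl) <;> assumption)
    rwa [Finset.sum_pair hxy] at this
  by_cases hp : ∃ x ∈ T, g x = 1
  · obtain ⟨x, hx, hgx⟩ := hp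
    right
    by_cases hn : ∃ y ∈ T, g y = -1
    · obtain ⟨y, hy, hgy⟩ := hn
      right
      have hxy : x ≠ y := by rintro rfl; omega
      refine ⟨x, hx, y, hy, hxy, fun z hz => ?_⟩
      by_cases hzx : z = x
      · subst hzx; simp [hxy, hgx]
      · by_cases hzy : z = y
        · subst hzy; simp [hzx, hgy]
        · have a1 := abs_le.1 (h2 x hx z hz (Ne.symm hzx))
          have a2 := abs_le.1 (h2 y hy z hz (Ne.symm hzy))
          simp only [hzx, hzy, if_false]
          have := h1 z hz
          omega
    · left
      push Not at hn
      refine ⟨x, hx, 1, Or.inl rfl, fun z hz => ?_⟩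
      by_cases hzx : z = x
      · subst hzx; simp [hgx]
      · have a1 := abs_le.1 (h2 x hx z hz (Ne.symm hzx))
        have := h1 z hz
        have := hn z hz
        simp only [hzx, if_false]
        omega
  · push Not at hp
    by_cases hn : ∃ y ∈ T, g y = -1
    · obtain ⟨y, hy, hgy⟩ := hn
      right; left
      refine ⟨y, hy, -1, Or.inr rfl, fun z hz => ?_⟩
      by_cases hzx : z = y
      · subst hzx; simp [hgy]
      · have a1 := abs_le.1 (h2 y hy z hz (Ne.symm hzx))
        have := h1 z hz
        have := hp z hz
        simp only [hzx, if_false]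
        omega
    · left
      push Not at hn
      intro z hz
      have := h1 z hz
      have := hp z hz
      have := hn z hz
      omega

/-- The vector `β (e_x - e_y) + κ (e_a - e_c)`. -/
def gainVec (β : ℤ) (a c x y : Fin (r + 1)) (κ : ℤ) : Fin (r + 1) → ℤ :=
  β • (Pi.single x 1 - Pi.single y 1) + κ • (Pi.single a 1 - Pi.single c 1)

theorem gainVec_neg (β : ℤ) (a c x y : Fin (r + 1)) (κ : ℤ) :
    gainVec β a c y x (-κ) = - gainVec β a c x y κ := by
  simp only [gainVec]; module

theorem sum_gainVec (β : ℤ) (a c x y : Fin (r + 1)) (κ : ℤ) :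
    ∑ z, gainVec β a c x y κ z = 0 := by
  simp [gainVec, Finset.sum_add_distrib, ← Finset.mul_sum, Finset.sum_sub_distrib]

theorem exists_gain (h : CliqueForm β w) (hβ : 0 < β) {a c : Fin (r + 1)} (hac : a ≠ c)
    (hdvd : ∀ j x, x ≠ a → x ≠ c → β ∣ w j x) {x y : Fin (r + 1)} (hxy : x ≠ y) (hx : x ≠ c)
    (hy : y ≠ c) : IsSigned w (gainVec β a c x y 0) := by
  obtain ⟨j, d, hd, hdβ, hj⟩ := h.edge x y hxy
  have hd' : β ∣ d := by
    by_cases hxa : x = a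
    · have := hdvd j y (by rintro rfl; exact hxy hxa) hy
      rw [hj] at this
      simpa [hxy] using this
    · have := hdvd j x hxa hx
      rw [hj] at this
      simpa [hxy] using this
  obtain ⟨e, rfl⟩ := hd'
  have he : |e| = 1 := by
    rw [abs_mul, abs_of_pos hβ] at hdβ
    have h1 : |e| ≤ 1 := by nlinarith
    have h2 : e ≠ 0 := by rintro rfl; simp at hd
    have := abs_pos.2 h2
    omega
  refine ⟨j, ?_⟩
  rcases eq_or_eq_neg_of_abs_eq he with rfl | rfl
  · left; rw [hj]; simp [gainVec]
  · right; rw [hj]; simp [gainVec]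

theorem exists_gainVec_eq (h : CliqueForm β w) (hβ : 0 < β) {a c : Fin (r + 1)} (hac : a ≠ c)
    (hdvd : ∀ j x, x ≠ a → x ≠ c → β ∣ w j x)
    (hsum : ∀ j (S : Finset (Fin (r + 1))), a ∉ S → c ∉ S → |∑ x ∈ S, w j x| ≤ β) (j : Fin n) :
    (∃ κ : ℤ, w j = κ • ((Pi.single a 1 - Pi.single c 1 : Fin (r + 1) → ℤ))) ∨
    ∃ x y κ, x ≠ y ∧ x ≠ c ∧ y ≠ c ∧ (w j = gainVec β a c x y κ) := by
  classical
  have hg : ∀ x, ∃ g, x ≠ a → x ≠ c → w j x = β * g := by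
    intro x
    by_cases hx : x ≠ a ∧ x ≠ c
    · obtain ⟨g, hg⟩ := hdvd j x hx.1 hx.2
      exact ⟨g, fun _ _ => hg⟩
    · exact ⟨0, fun h1 h2 => (hx ⟨h1, h2⟩).elim⟩
  choose g hg using hg
  have hT : ∀ x, x ∈ ({a, c}ᶜ : Finset (Fin (r + 1))) ↔ x ≠ a ∧ x ≠ c := by
    intro x; simp
  have hS : ∀ S ⊆ ({a, c}ᶜ : Finset (Fin (r + 1))), |∑ x ∈ S, g x| ≤ 1 := by
    intro S hS
    have h1 := hsum j S (fun h => ((hT _).1 (hS h)).1 rfl) (fun h => ((hT _).1 (hS h)).2 rfl)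
    rw [Finset.sum_congr rfl (fun x hx => hg x ((hT _).1 (hS hx)).1 ((hT _).1 (hS hx)).2),
      ← Finset.mul_sum, abs_mul, abs_of_pos hβ] at h1
    nlinarith
  have key : ∀ x y, x ≠ y → x ≠ c → y ≠ c →
      (∀ z, z ≠ a → z ≠ c → g z = (if z = x then 1 else 0) - (if z = y then 1 else 0)) →
      ∃ x y κ, x ≠ y ∧ x ≠ c ∧ y ≠ c ∧ (w j = gainVec β a c x y κ) := by
    intro x y hxy hx hy hz
    refine ⟨x, y, - w j c, hxy, hx, hy, ?_⟩
    apply eq_of_sum_eq_of_eq_off a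
    · rw [h.sum_zero, sum_gainVec]
    · intro z hza
      by_cases hzc : z = c
      · subst hzc
        simp [gainVec, hx.symm, hy.symm, hza]
      · rw [hg z hza hzc, hz z hza hzc]
        simp [gainVec, Pi.single_apply, hza, hzc]
  rcases subset_sums_le_one g _ hS with h0 | ⟨x, hx, ε, hε, hz⟩ | ⟨x, hx, y, hy, hxy, hz⟩
  · left
    refine ⟨- w j c, ?_⟩
    apply eq_of_sum_eq_of_eq_off a
    · rw [h.sum_zero]
      simp [← Finset.mul_sum, Finset.sum_sub_distrib]
    · intro z hza
      by_cases hzc : z = c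
      · subst hzc
        simp [hza]
      · rw [hg z hza hzc, h0 z (by simp [hza, hzc])]
        simp [hza, hzc]
  · right
    have hx' := (hT _).1 hx
    rcases hε with rfl | rfl
    · refine key x a hx'.1 hx'.2 hac fun z hza hzc => ?_
      rw [hz z (by simp [hza, hzc])]
      simp [hza]
    · refine key a x hx'.1.symm hac hx'.2 fun z hza hzc => ?_
      rw [hz z (by simp [hza, hzc])]
      rw [if_neg hza]
      ring
  · right
    refine key x y hxy ((hT _).1 hx).2 ((hT _).1 hy).2 fun z hza hzc => ?_
    rw [hz z (by simp [hza, hzc])]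

theorem sum_gain_le {m : ℕ} {w : Fin n → Fin (m + 1 + 1) → ℤ} (h : CliqueForm β w) (hβ : 0 < β)
    {a c : Fin (m + 1 + 1)} (hac : a ≠ c) (M : Fin (m + 1) → Fin (m + 1) → ℤ)
    (hm : 1 ≤ m)
    (hM : ∀ p q, p ≠ q → IsSigned w (gainVec β a c (c.succAbove p) (c.succAbove q) (M p q)))
    (σ : Equiv.Perm (Fin (m + 1))) : ∑ t, M (σ t) (σ (t + 1)) ≤ 3 := by
  classical
  obtain ⟨a', ha'⟩ := Fin.exists_succAbove_eq hac
  let τ : Equiv.Perm (Fin (m + 1)) := (Equiv.addRight (σ.symm a')).trans σ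
  have hτ0 : τ 0 = a' := by simp [τ]
  have hsum : ∑ t, M (σ t) (σ (t + 1)) = ∑ t, M (τ t) (τ (t + 1)) := by
    rw [← Equiv.sum_comp (Equiv.addRight (σ.symm a'))]
    apply Finset.sum_congr rfl
    intro t _
    simp [τ, add_right_comm]
  rw [hsum]
  have hne : ∀ t : Fin (m + 1), t ≠ t + 1 := by
    intro t ht
    have h0 : (1 : Fin (m + 1)) = 0 := by simpa using ht.symm
    have := congrArg Fin.val h0
    rw [Fin.val_one', Fin.val_zero, Nat.mod_eq_of_lt (by omega)] at this
    omega
  obtain ⟨z, hz, hz'⟩ := h.det_signed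
    (fun t => gainVec β a c (c.succAbove (τ t)) (c.succAbove (τ (t + 1))) (M (τ t) (τ (t + 1))))
    (fun t => hM _ _ fun e => hne t (τ.injective e))
    (fun x => (finSuccEquiv' c x).map τ.symm) (fun o => (finSuccEquiv' c).symm (o.map τ))
    (by intro o; simp)
  have hz3 := hz' (by
    intro x hx
    apply absurd _ hx
    rw [Equiv.symm_apply_eq]
    cases finSuccEquiv' c x <;> simp)
  have hfil : ∀ l, ({x | (finSuccEquiv' c x).map τ.symm = some l} : Finset (Fin (m + 1 + 1))) =
      {c.succAbove (τ l)} := by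
    intro l
    ext x
    simp only [Finset.mem_filter, Finset.mem_univ, true_and, Finset.mem_singleton]
    rw [← finSuccEquiv'_symm_some, Equiv.eq_symm_apply]
    cases finSuccEquiv' c x <;> simp [Equiv.symm_apply_eq]
  have hdet := det_cyclic_gain β (fun t => M (τ t) (τ (t + 1)))
  have hmat : (Matrix.of fun t l => ∑ x with (finSuccEquiv' c x).map τ.symm = some l,
      gainVec β a c (c.succAbove (τ t)) (c.succAbove (τ (t + 1))) (M (τ t) (τ (t + 1))) x) =
      (Matrix.of fun i l : Fin (m + 1) =>
      β * ((if i = l then 1 else 0) - (if i + 1 = l then 1 else 0)) +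
        (if l = 0 then M (τ i) (τ (i + 1)) else 0)) := by
    ext t l
    simp only [Matrix.of_apply, hfil, Finset.sum_singleton, gainVec, Pi.add_apply, Pi.smul_apply,
      Pi.sub_apply, Pi.single_apply, smul_eq_mul, Fin.succAbove_right_inj, τ.injective.eq_iff,
      Fin.succAbove_ne, if_false, ← ha', ← hτ0]
    simp [eq_comm]
  rw [hmat] at hz
  have h1 := congrArg abs hz
  rw [abs_mul, hdet, abs_mul, abs_pow, ← mul_assoc, ← pow_succ'] at h1
  have h2 := mul_left_cancel₀ (pow_ne_zero _ (abs_pos.2 hβ.ne').ne') h1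
  exact (le_abs_self _).trans (h2 ▸ hz3)

theorem card_le_of_gain (h : CliqueForm β w) (hβ : 0 < β) (hr : 2 ≤ r) {a c : Fin (r + 1)}
    (hac : a ≠ c) (hdvd : ∀ j x, x ≠ a → x ≠ c → β ∣ w j x)
    (hsum : ∀ j (S : Finset (Fin (r + 1))), a ∉ S → c ∉ S → |∑ x ∈ S, w j x| ≤ β) :
    n ≤ (r + 1).choose 2 + 2 * (r - 1) := by
  classical
  obtain ⟨m, rfl⟩ : ∃ m, r = m + 1 := ⟨r - 1, by omega⟩
  have hmax : ∀ p q : Fin (m + 1), ∃ M : ℤ, p ≠ q →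
      IsSigned w (gainVec β a c (c.succAbove p) (c.succAbove q) M) ∧
      ∀ κ, IsSigned w (gainVec β a c (c.succAbove p) (c.succAbove q) κ) → κ ≤ M := by
    intro p q
    by_cases hpq : p = q
    · exact ⟨0, fun h => (h hpq).elim⟩
    · obtain ⟨M, hM, hM'⟩ := Int.exists_greatest_of_bdd
        (P := fun κ => IsSigned w (gainVec β a c (c.succAbove p) (c.succAbove q) κ))
        ⟨∑ j, |w j c|, fun κ hκ => by
          obtain ⟨j, hj⟩ := hκ
          have h1 : |w j c| ≤ ∑ j, |w j c| :=
            Finset.single_le_sum (f := fun j => |w j c|) (fun _ _ => abs_nonneg _)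
              (Finset.mem_univ j)
          have h2 : gainVec β a c (c.succAbove p) (c.succAbove q) κ c = - κ := by
            simp [gainVec, hac.symm]
          refine le_trans ?_ h1
          have := neg_abs_le (w j c)
          have := le_abs_self (w j c)
          rcases hj with hj | hj
          · have := congrFun hj c; omega
          · have := congrFun hj c
            rw [Pi.neg_apply] at this; omega⟩
        ⟨0, h.exists_gain hβ hac hdvd (fun e => hpq (Fin.succAbove_right_injective e))
          (Fin.succAbove_ne _ _) (Fin.succAbove_ne _ _)⟩
      exact ⟨M, fun _ => ⟨hM, hM'⟩⟩
  choose M hM using hmax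
  have hT := sum_offDiag_le (by omega) M
    (h.sum_gain_le hβ hac M (by omega) fun p q hpq => (hM p q hpq).1)
  let J : Fin (m + 1) × Fin (m + 1) → Finset (Fin n) := fun p =>
    {j | ∃ κ, w j = gainVec β a c (c.succAbove p.1) (c.succAbove p.2) κ ∨
      w j = - gainVec β a c (c.succAbove p.1) (c.succAbove p.2) κ}
  let J₀ : Finset (Fin n) := {j | ∃ κ : ℤ, w j = κ • (Pi.single a 1 - Pi.single c 1)}
  have hJ₀ : J₀.card ≤ 1 := by
    rw [Finset.card_le_one]
    intro j hj j' hj'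
    simp only [J₀, Finset.mem_filter, Finset.mem_univ, true_and] at hj hj'
    obtain ⟨κ, hκ⟩ := hj
    obtain ⟨κ', hκ'⟩ := hj'
    by_contra hne
    have h1 := h.nonpar j j' hne κ' κ (by rw [hκ, hκ', smul_comm])
    have h2 := h.nonpar j j' hne 1 0 (by rw [hκ, h1.2]; simp)
    simp at h2
  have hJ : ∀ p : Fin (m + 1) × Fin (m + 1), p.1 ≠ p.2 →
      ((J p).card : ℤ) ≤ M p.1 p.2 + M p.2 p.1 + 1 := by
    rintro ⟨p, q⟩ hpq
    simp only at hpq ⊢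
    have hk : ∀ j, ∃ κ, j ∈ J (p, q) → w j = gainVec β a c (c.succAbove p) (c.succAbove q) κ ∨
      w j = - gainVec β a c (c.succAbove p) (c.succAbove q) κ := by
      intro j
      by_cases hj : j ∈ J (p, q)
      · have hj' := hj
        simp only [J, Finset.mem_filter, Finset.mem_univ, true_and] at hj'
        obtain ⟨κ, hκ⟩ := hj'
        exact ⟨κ, fun _ => hκ⟩
      · exact ⟨0, fun h => (hj h).elim⟩
    choose κ hκ using hk
    have hup := (hM p q hpq).2
    have hlow : ∀ κ, IsSigned w (gainVec β a c (c.succAbove p) (c.succAbove q) κ) →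
        - M q p ≤ κ := by
      intro κ hκ
      have := (hM q p hpq.symm).2 (-κ) (by rw [gainVec_neg]; exact hκ.neg)
      omega
    have hs : ∀ j ∈ J (p, q), IsSigned w (gainVec β a c (c.succAbove p) (c.succAbove q) (κ j)) := by
      intro j hj
      rcases hκ j hj with h1 | h1
      · exact ⟨j, Or.inl h1.symm⟩
      · exact ⟨j, Or.inr (by rw [h1, neg_neg])⟩
    have hcard : (J (p, q)).card ≤ (Finset.Icc (- M q p) (M p q)).card := by
      apply Finset.card_le_card_of_injOn κ
      · intro j hj
        simp only [Finset.coe_Icc, Set.mem_Icc]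
        exact ⟨hlow _ (hs j hj), hup _ (hs j hj)⟩
      · intro j hj j' hj' e
        by_contra hne
        have h1 := hκ j hj
        have h2 := hκ j' hj'
        rw [e] at h1
        rcases h1 with h1 | h1 <;> rcases h2 with h2 | h2
        · have := h.nonpar j j' hne 1 1 (by rw [h1, h2])
          simp at this
        · have := h.nonpar j j' hne 1 (-1) (by rw [h1, h2]; simp)
          simp at this
        · have := h.nonpar j j' hne (-1) 1 (by rw [h1, h2]; simp)
          simp at this
        · have := h.nonpar j j' hne 1 1 (by rw [h1, h2])
          simp at this
    have h0 := hup 0 (h.exists_gain hβ hac hdvd (fun e => hpq (Fin.succAbove_right_injective e))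
          (Fin.succAbove_ne _ _) (Fin.succAbove_ne _ _))
    have h0' := hlow 0 (h.exists_gain hβ hac hdvd (fun e => hpq (Fin.succAbove_right_injective e))
          (Fin.succAbove_ne _ _) (Fin.succAbove_ne _ _))
    rw [Int.card_Icc] at hcard
    omega
  let P : Finset (Fin (m + 1) × Fin (m + 1)) := {p | p.1 < p.2}
  have hcov : (Finset.univ : Finset (Fin n)) ⊆ J₀ ∪ P.biUnion J := by
    intro j _
    rw [Finset.mem_union, Finset.mem_biUnion]
    rcases h.exists_gainVec_eq hβ hac hdvd hsum j with hκ | ⟨x, y, κ, hxy, hx, hy, hj⟩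
    · left
      simpa [J₀] using hκ
    · right
      obtain ⟨p, rfl⟩ := Fin.exists_succAbove_eq hx
      obtain ⟨q, rfl⟩ := Fin.exists_succAbove_eq hy
      have hpq : p ≠ q := fun e => hxy (e ▸ rfl)
      rcases lt_or_gt_of_ne hpq with hlt | hlt
      · refine ⟨(p, q), by simpa [P] using hlt, ?_⟩
        simp only [J, Finset.mem_filter, Finset.mem_univ, true_and]
        exact ⟨κ, Or.inl hj⟩
      · refine ⟨(q, p), by simpa [P] using hlt, ?_⟩
        simp only [J, Finset.mem_filter, Finset.mem_univ, true_and]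
        exact ⟨-κ, Or.inr (by rw [gainVec_neg, neg_neg, hj])⟩
  have hswap : ∀ N : Fin (m + 1) → Fin (m + 1) → ℤ, ∑ p ∈ P, (N p.1 p.2 + N p.2 p.1) =
      ∑ p ∈ Finset.offDiag (Finset.univ : Finset (Fin (m + 1))), N p.1 p.2 := by
    intro N
    rw [← Finset.sum_filter_add_sum_filter_not (Finset.offDiag _) (fun p => p.1 < p.2),
      Finset.sum_add_distrib]
    congr 1
    · apply Finset.sum_congr _ fun _ _ => rfl
      ext ⟨p, q⟩
      simp only [P, Finset.mem_filter, Finset.mem_univ, true_and, Finset.mem_offDiag]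
      exact ⟨fun h => ⟨h.ne, h⟩, fun h => h.2⟩
    · refine Finset.sum_bij (fun p _ => (p.2, p.1)) ?_ ?_ ?_ ?_
      · rintro ⟨p, q⟩ hp
        simp only [P, Finset.mem_filter, Finset.mem_univ, true_and, Finset.mem_offDiag] at hp ⊢
        exact ⟨hp.ne', hp.le.not_gt⟩
      · rintro ⟨p, q⟩ _ ⟨p', q'⟩ _ h
        simp at h ⊢
        exact h.symm
      · rintro ⟨p, q⟩ hp
        simp only [Finset.mem_filter, Finset.mem_univ, true_and, Finset.mem_offDiag] at hp
        exact ⟨(q, p), by simpa [P] using lt_of_le_of_ne (not_lt.1 hp.2) (Ne.symm hp.1), rfl⟩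
      · simp
  have hcount : (n : ℤ) ≤ 1 + ∑ p ∈ P, (M p.1 p.2 + M p.2 p.1 + 1) := by
    have h1 := (Finset.card_le_card hcov).trans (Finset.card_union_le _ _)
    have h2 : ((P.biUnion J).card : ℤ) ≤ ∑ p ∈ P, (M p.1 p.2 + M p.2 p.1 + 1) := by
      calc ((P.biUnion J).card : ℤ) ≤ ∑ p ∈ P, ((J p).card : ℤ) := by
            exact_mod_cast Finset.card_biUnion_le
        _ ≤ _ := by
            apply Finset.sum_le_sum
            intro p hp
            apply hJ
            simp only [P, Finset.mem_filter, Finset.mem_univ, true_and] at hp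
            exact hp.ne
    rw [Finset.card_univ, Fintype.card_fin] at h1
    omega
  have h1 := hswap M
  have h2 := hswap (fun _ _ => 1)
  have hcard : (Finset.offDiag (Finset.univ : Finset (Fin (m + 1)))).card = (m + 1) * m := by
    rw [Finset.offDiag_card]
    simp
    rw [Nat.sub_eq_iff_eq_add (by nlinarith)]
    ring
  simp only [Finset.sum_const, hcard] at h2
  rw [Finset.sum_add_distrib, h1] at hcount
  simp only [Finset.sum_const] at hcount
  have hch2 : (m + 1 + 1).choose 2 * 2 = (m + 2) * (m + 1) := by
    rw [Nat.choose_two_right, Nat.div_mul_cancel (Nat.even_mul_pred_self _).two_dvd]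
    rfl
  simp at h2 hcount
  zify
  simp
  zify at hch2
  nlinarith

end CliqueForm

namespace CliqueForm

variable {n r : ℕ} {β : ℤ} {w : Fin n → Fin (r + 1) → ℤ}

theorem eq_of_signed (h : CliqueForm β w) {j j' : Fin n} {u : Fin (r + 1) → ℤ}
    (hj : u = w j ∨ u = - w j) (hj' : u = w j' ∨ u = - w j') : j = j' := by
  by_contra hne
  rcases hj with h1 | h1 <;> rcases hj' with h2 | h2
  · have := h.nonpar j j' hne 1 1 (by rw [← h1, ← h2])
    simp at this
  · have := h.nonpar j j' hne 1 (-1) (by rw [← h1, h2]; simp)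
    simp at this
  · have := h.nonpar j j' hne (-1) 1 (by rw [← h2, h1]; simp)
    simp at this
  · have := h.nonpar j j' hne 1 1 (by
      have := h1.symm.trans h2
      simpa using this)
    simp at this

theorem ne_zero (h : CliqueForm β w) (hr : 1 ≤ r) (j : Fin n) : w j ≠ 0 := by
  intro h0
  have h01 : (0 : Fin (r + 1)) ≠ Fin.last r := by
    intro e
    have := congrArg Fin.val e
    simp at this
    omega
  obtain ⟨j', d, hd, -, hj'⟩ := h.edge 0 (Fin.last r) h01
  have hne : j ≠ j' := by
    rintro rfl
    have := congrFun (hj'.symm.trans h0) 0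
    simp [h01] at this
    exact hd this
  have := h.nonpar j j' hne 1 0 (by simp [h0])
  simp at this

/-- The columns that are not multiples of an edge vector. -/
def nonEdges (β : ℤ) (w : Fin n → Fin (r + 1) → ℤ) : Set (Fin n) :=
  {j | ∀ x y, w j ≠ β • (Pi.single x 1 - Pi.single y 1)}

open Classical in
theorem card_le_nonEdges (h : CliqueForm β w) (hr : 1 ≤ r) :
    n ≤ (r + 1).choose 2 + ({j | j ∈ nonEdges β w} : Finset (Fin n)).card := by
  have h1 : ({j | j ∉ nonEdges β w} : Finset (Fin n)).card ≤ (r + 1).choose 2 := by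
    have hs : ∀ j, ∃ s : Sym2 (Fin (r + 1)), j ∉ nonEdges β w →
        ¬ s.IsDiag ∧ ∃ x y, s = s(x, y) ∧ w j = β • (Pi.single x 1 - Pi.single y 1) := by
      intro j
      by_cases hj : j ∈ nonEdges β w
      · exact ⟨s(0, 0), fun h => (h hj).elim⟩
      · have hj' := hj
        simp only [nonEdges, Set.mem_ofPred_eq, not_forall, not_not] at hj'
        obtain ⟨x, y, hxy⟩ := hj'
        refine ⟨s(x, y), fun _ => ⟨?_, x, y, rfl, hxy⟩⟩
        rw [Sym2.mk_isDiag_iff]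
        rintro rfl
        exact h.ne_zero hr j (by simp [hxy])
    choose s hs using hs
    have h2 : ({s : Sym2 (Fin (r + 1)) | ¬ s.IsDiag} : Finset _).card = (r + 1).choose 2 := by
      have := Sym2.card_subtype_not_diag (α := Fin (r + 1))
      rw [Fintype.card_subtype] at this
      simpa using this
    rw [← h2]
    apply Finset.card_le_card_of_injOn s
    · intro j hj
      have hj' : j ∉ nonEdges β w := by simpa using hj
      simpa using (hs j hj').1
    · intro j hj j' hj' e
      obtain ⟨-, x, y, hxy, hw⟩ := hs j (by simpa using hj)
      obtain ⟨-, x', y', hxy', hw'⟩ := hs j' (by simpa using hj')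
      rw [hxy, hxy', Sym2.eq_iff] at e
      apply h.eq_of_signed (Or.inl rfl)
      rcases e with ⟨rfl, rfl⟩ | ⟨rfl, rfl⟩
      · left; rw [hw, hw']
      · right; rw [hw, hw']; module
  have h3 := Finset.card_filter_add_card_filter_not (s := (Finset.univ : Finset (Fin n)))
    (fun j => j ∈ nonEdges β w)
  rw [Finset.card_univ, Fintype.card_fin] at h3
  omega

theorem dvd_minor (h : CliqueForm β w) (hβ : β ≠ 0) (hr : 2 ≤ r) (i j : Fin n)
    (x y : Fin (r + 1)) : β ∣ w i x * w j y - w i y * w j x := by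
  by_cases hxy : x = y
  · subst hxy; simp
  obtain ⟨t, ht⟩ : ∃ t, t ∉ ({x, y} : Finset (Fin (r + 1))) := by
    by_contra! hall
    have := Finset.card_le_card (fun t _ => hall t : (Finset.univ : Finset _) ⊆ {x, y})
    have := this.trans Finset.card_le_two
    simp at this
    omega
  simp only [Finset.mem_insert, Finset.mem_singleton, not_or] at ht
  obtain ⟨z, hz, -⟩ := h.det_sets ![w i, w j] (by
    intro i; fin_cases i <;> exact isSigned_self _ _) ![{x}, {y}] (by
    intro l l' hl
    fin_cases l <;> fin_cases l' <;> simp at hl ⊢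
    · exact hxy
    · exact Ne.symm hxy) ![x, y] (by
    intro l; fin_cases l <;> simp) t (by
    intro l; fin_cases l <;> simp [ht])
  refine ⟨z, mul_left_cancel₀ hβ ?_⟩
  rw [Matrix.det_fin_two] at hz
  simp at hz
  rw [hz]; ring

theorem isUnitEdge_of_dvd (h : CliqueForm β w) (hβ : 0 < β) {x y : Fin (r + 1)} (hxy : x ≠ y)
    (hd : (∀ j, β ∣ w j x) ∨ (∀ j, β ∣ w j y)) : IsUnitEdge β w x y := by
  obtain ⟨j, d, hd0, hdβ, hj⟩ := h.edge x y hxy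
  have hd' : β ∣ d := by
    rcases hd with hd | hd
    · have := hd j
      rw [hj] at this
      simpa [hxy] using this
    · have := hd j
      rw [hj] at this
      simpa [hxy] using this
  obtain ⟨e, rfl⟩ := hd'
  have he : |e| = 1 := by
    rw [abs_mul, abs_of_pos hβ] at hdβ
    have h1 : |e| ≤ 1 := by nlinarith
    have h2 : e ≠ 0 := by rintro rfl; simp at hd0
    have := abs_pos.2 h2
    omega
  refine ⟨j, ?_⟩
  rcases eq_or_eq_neg_of_abs_eq he with rfl | rfl
  · left; rw [hj]; simp
  · right; rw [hj]; simp

theorem card_le_of_dvd_off_pair (h : CliqueForm β w) (hβ : β = 2 ∨ β = 3) (hr : 5 ≤ r)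
    {a c : Fin (r + 1)} (hac : a ≠ c) (hdvd : ∀ j x, x ≠ a → x ≠ c → β ∣ w j x) :
    n ≤ (r + 1).choose 2 + 2 * (r - 1) := by
  classical
  have hβ0 : 0 < β := by omega
  have hE : ∀ x y, x ≠ y → y ≠ a → y ≠ c → IsUnitEdge β w x y := fun x y hxy hy hy' =>
    h.isUnitEdge_of_dvd hβ0 hxy (Or.inr fun j => hdvd j y hy hy')
  have key : ∀ j (S : Finset (Fin (r + 1))) (y : Fin (r + 1)), a ∉ S → c ∉ S → y ∉ S → y ≠ a →
      y ≠ c → |∑ x ∈ S, w j x| ≤ β := by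
    intro j S y ha hc hy hya hyc
    rcases S.eq_empty_or_nonempty with rfl | ⟨t, ht⟩
    · simpa using hβ0.le
    have hd : β ∣ ∑ x ∈ S, w j x := Finset.dvd_sum fun x hx =>
      hdvd j x (by rintro rfl; exact ha hx) (by rintro rfl; exact hc hx)
    obtain ⟨z, hz, hz'⟩ := h.det_sets ![w j] (by simpa using isSigned_self w j) ![S]
      (fun l l' hl => (hl (Subsingleton.elim _ _)).elim) ![t] (by simpa using ht) y (by simpa using hy)
    have hz3 := hz' (fun x _ hxy => hE x y hxy hya hyc) (by
      intro l x hx hxt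
      have hl : l = 0 := Subsingleton.elim _ _
      subst hl
      simp at hx hxt ⊢
      exact hE x t hxt (by rintro rfl; exact ha ht) (by rintro rfl; exact hc ht))
    simp only [Matrix.det_unique, Matrix.of_apply, pow_one] at hz
    have := mul_left_cancel₀ hβ0.ne' hz
    simp at this
    rw [this] at hd ⊢
    obtain ⟨e, rfl⟩ := hd
    rw [abs_le] at hz3 ⊢
    rcases hβ with rfl | rfl <;> omega
  refine h.card_le_of_gain hβ0 (by omega) hac hdvd fun j S ha hc => ?_
  by_cases hy : ∃ y, y ∉ S ∧ y ≠ a ∧ y ≠ c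
  · obtain ⟨y, hy, hya, hyc⟩ := hy
    exact key j S y ha hc hy hya hyc
  · push Not at hy
    have hd : β ∣ ∑ x ∈ S, w j x := Finset.dvd_sum fun x hx =>
      hdvd j x (by rintro rfl; exact ha hx) (by rintro rfl; exact hc hx)
    have hS : 3 ≤ S.card := by
      have h1 : (Finset.univ : Finset (Fin (r + 1))) ⊆ S ∪ {a, c} := by
        intro x _
        by_contra hx
        simp only [Finset.mem_union, Finset.mem_insert, Finset.mem_singleton, not_or] at hx
        exact hx.2.2 (hy x hx.1 hx.2.1)
      have h2 := (Finset.card_le_card h1).trans (Finset.card_union_le _ _)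
      have h3 := Finset.card_le_two (a := a) (b := c)
      simp at h2
      omega
    have h4 : ∀ x ∈ S, |∑ y ∈ S.erase x, w j y| ≤ β := fun x hx =>
      key j _ x (fun h => ha (Finset.mem_of_mem_erase h)) (fun h => hc (Finset.mem_of_mem_erase h))
        (Finset.notMem_erase _ _) (by rintro rfl; exact ha hx) (by rintro rfl; exact hc hx)
    obtain ⟨e, he⟩ := hd
    have h5 : ∀ x ∈ S, |β * e - w j x| ≤ β := by
      intro x hx
      have := h4 x hx
      rwa [Finset.sum_erase_eq_sub hx, he] at this
    rw [he]
    by_contra! hlt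
    obtain ⟨x, hx⟩ := Finset.card_pos.1 (by omega : 0 < S.card)
    have h6 := h4 x hx
    have hcard : 2 ≤ (S.erase x).card := by rw [Finset.card_erase_of_mem hx]; omega
    rcases lt_abs.1 hlt with hlt | hlt
    · have he2 : 2 ≤ e := by nlinarith
      have : (S.erase x).card • β ≤ ∑ y ∈ S.erase x, w j y := by
        apply Finset.card_nsmul_le_sum
        intro y hy
        have := (abs_le.1 (h5 y (Finset.mem_of_mem_erase hy))).2
        nlinarith
      have := this.trans ((le_abs_self _).trans h6)
      have h7 : (2 : ℤ) ≤ (S.erase x).card := by exact_mod_cast hcard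
      simp only [nsmul_eq_mul] at this
      nlinarith
    · have he2 : e ≤ -2 := by nlinarith
      have : ∑ y ∈ S.erase x, w j y ≤ (S.erase x).card • (-β) := by
        apply Finset.sum_le_card_nsmul
        intro y hy
        have := (abs_le.1 (h5 y (Finset.mem_of_mem_erase hy))).1
        nlinarith
      have h8 := (abs_le.1 h6).1
      have h7 : (2 : ℤ) ≤ (S.erase x).card := by exact_mod_cast hcard
      simp only [nsmul_eq_mul] at this
      nlinarith

theorem dvd_off_pair_of_not_isUnitEdge (h : CliqueForm β w) (hβ : β = 2 ∨ β = 3) (hr : 2 ≤ r)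
    {a c : Fin (r + 1)} (hac : a ≠ c) (hE : ¬ IsUnitEdge β w a c) (i : Fin n) (x : Fin (r + 1))
    (hxa : x ≠ a) (hxc : x ≠ c) : β ∣ w i x := by
  obtain ⟨j, d, hd0, hdβ, hj⟩ := h.edge a c hac
  have h1 := h.dvd_minor (by omega) hr j i a x
  rw [hj] at h1
  simp [hac, hxa, hxc] at h1
  have hd1 : d ≠ β := by
    rintro rfl; exact hE ⟨j, Or.inl hj⟩
  have hd2 : d ≠ -β := by
    rintro rfl; exact hE ⟨j, Or.inr (by rw [hj]; simp)⟩
  rw [abs_le] at hdβ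
  have hp : Prime β := by
    rcases hβ with rfl | rfl
    · exact Int.prime_two
    · exact Int.prime_three
  rcases hp.dvd_or_dvd h1 with h2 | h2
  · exfalso
    obtain ⟨e, rfl⟩ := h2
    rcases hβ with rfl | rfl <;> omega
  · exact h2

end CliqueForm

namespace CliqueForm

variable {n r : ℕ} {β : ℤ} {w : Fin n → Fin (r + 1) → ℤ}

theorem sum_abs_le (h : CliqueForm β w) (hβ : β ≠ 0) (hE : ∀ x y, x ≠ y → IsUnitEdge β w x y)
    {u : Fin (r + 1) → ℤ} (hu : IsSigned w u) : ∑ x, |u x| ≤ 6 := by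
  classical
  rw [← Finset.sum_filter_add_sum_filter_not _ (fun x => 0 ≤ u x)]
  have h1 := (abs_le.1 (h.sum_le hβ hE hu {x | 0 ≤ u x})).2
  have h2 := (abs_le.1 (h.sum_le hβ hE hu {x | ¬ 0 ≤ u x})).1
  have h3 : ∑ x with 0 ≤ u x, |u x| = ∑ x with 0 ≤ u x, u x :=
    Finset.sum_congr rfl fun x hx => abs_of_nonneg (by simpa using hx)
  have h4 : ∑ x with ¬ 0 ≤ u x, |u x| = - ∑ x with ¬ 0 ≤ u x, u x := by
    rw [← Finset.sum_neg_distrib]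
    refine Finset.sum_congr rfl fun x hx => abs_of_neg ?_
    simp only [Finset.mem_filter] at hx
    omega
  rw [h3, h4]
  omega

theorem exists_not_dvd_of_mem_nonEdges (h : CliqueForm β w) (hβ : β = 2 ∨ β = 3) (hr : 1 ≤ r)
    (hE : ∀ x y, x ≠ y → IsUnitEdge β w x y) {j : Fin n} (hj : j ∈ nonEdges β w) :
    ∃ x, ¬ β ∣ w j x := by
  by_contra! hd
  choose g hg using hd
  have hS : ∀ S ⊆ (Finset.univ : Finset (Fin (r + 1))), |∑ x ∈ S, g x| ≤ 1 := by
    intro S _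
    have := h.sum_le (by omega) hE (isSigned_self w j) S
    simp only [hg, ← Finset.mul_sum] at this
    rw [abs_le] at this ⊢
    rcases hβ with rfl | rfl <;> omega
  have hs : ∑ x, g x = 0 := by
    have := h.sum_zero j
    simp only [hg, ← Finset.mul_sum] at this
    rcases mul_eq_zero.1 this with h0 | h0
    · omega
    · exact h0
  rcases subset_sums_le_one g _ hS with h0 | ⟨x, hx, ε, hε, hz⟩ | ⟨x, hx, y, hy, hxy, hz⟩
  · exact h.ne_zero hr j (by ext x; simp [hg, h0 x])
  · rw [Finset.sum_congr rfl hz, ← Finset.mul_sum] at hs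
    simp at hs
    omega
  · refine hj x y ?_
    ext z
    rw [hg, hz z (Finset.mem_univ z)]
    simp [Pi.single_apply]

open Classical in
theorem card_le_of_eq_on (h : CliqueForm β w) (J : Finset (Fin n)) (U : Finset (Fin (r + 1)))
    (hU : U.card ≤ 6) (D : Finset ℤ) (hD : D.card ≤ 4) (u : Fin n → Fin (r + 1) → ℤ)
    (hu : ∀ j ∈ J, u j = w j ∨ u j = - w j) (huD : ∀ j ∈ J, ∀ x ∈ U, u j x ∈ D)
    (huU : ∀ j ∈ J, ∀ j' ∈ J, ∀ x ∉ U, u j x = u j' x) : J.card ≤ 4096 := by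
  have h1 : J.card ≤ (Fintype.piFinset fun _ : U => D).card := by
    apply Finset.card_le_card_of_injOn (fun j => fun x : U => u j x)
    · intro j hj
      simp only [Finset.mem_coe, Fintype.mem_piFinset]
      exact fun x => huD j hj x x.2
    · intro j hj j' hj' e
      apply h.eq_of_signed (hu j hj)
      have : u j = u j' := by
        ext x
        by_cases hx : x ∈ U
        · exact congrFun e ⟨x, hx⟩
        · exact huU j hj j' hj' x hx
      rw [this]
      exact hu j' hj'
  rw [Fintype.card_piFinset] at h1
  simp only [Finset.prod_const, Finset.card_univ, Fintype.card_coe] at h1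
  calc J.card ≤ D.card ^ U.card := h1
    _ ≤ 4 ^ U.card := Nat.pow_le_pow_left hD _
    _ ≤ 4 ^ 6 := Nat.pow_le_pow_right (by norm_num) hU
    _ = 4096 := by norm_num

theorem card_nonEdges_le_of_two_three (h : CliqueForm β w) (hβ : β = 2 ∨ β = 3) (hr : 2 ≤ r)
    (hE : ∀ x y, x ≠ y → IsUnitEdge β w x y) 
    (hC : ∀ a c, a ≠ c → ∃ j x, x ≠ a ∧ x ≠ c ∧ ¬ β ∣ w j x) (J : Finset (Fin n))
    (hJ : ∀ j ∈ J, j ∈ nonEdges β w) :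
    J.card ≤ 8192 + (r + 1) := by
  classical
  have hβ0 : 0 < β := by omega
  have hp : Prime β := by
    rcases hβ with rfl | rfl
    · exact Int.prime_two
    · exact Int.prime_three
  have h01 : (0 : Fin (r + 1)) ≠ Fin.last r := by
    intro e
    have := congrArg Fin.val e
    simp at this
    omega
  obtain ⟨j₀, x₀, -, -, hx₀⟩ := hC _ _ h01
  let U : Finset (Fin (r + 1)) := {x | ¬ β ∣ w j₀ x}
  have hx₀U : x₀ ∈ U := by simpa [U] using hx₀
  have hoff : ∀ j, ∀ x ∉ U, β ∣ w j x := by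
    intro j x hx
    have hx' : β ∣ w j₀ x := by simpa [U] using hx
    have := h.dvd_minor hβ0.ne' hr j₀ j x₀ x
    have h2 : β ∣ w j₀ x₀ * w j x := (dvd_sub_left (hx'.mul_right _)).1 this
    exact (hp.dvd_or_dvd h2).resolve_left hx₀
  have hon : ∀ j ∈ J, ∀ x ∈ U, ¬ β ∣ w j x := by
    intro j hj x hx hdx
    obtain ⟨y, hy⟩ := h.exists_not_dvd_of_mem_nonEdges hβ (by omega) hE (hJ j hj)
    have := h.dvd_minor hβ0.ne' hr j₀ j x y
    have h2 : β ∣ w j₀ x * w j y := (dvd_sub_left (hdx.mul_left _)).1 this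
    rcases hp.dvd_or_dvd h2 with h3 | h3
    · simp [U] at hx; exact hx h3
    · exact hy h3
  have hU6 : U.card ≤ 6 := by
    have h1 := h.sum_abs_le hβ0.ne' hE (isSigned_self w j₀)
    have h2 : ∑ x ∈ U, |w j₀ x| ≤ ∑ x, |w j₀ x| :=
      Finset.sum_le_sum_of_subset_of_nonneg (Finset.subset_univ _) fun _ _ _ => abs_nonneg _
    have h3 : U.card • (1 : ℤ) ≤ ∑ x ∈ U, |w j₀ x| := by
      apply Finset.card_nsmul_le_sum
      intro x hx
      refine Int.one_le_abs ?_
      intro h0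
      simp [U, h0] at hx
    simp at h3
    omega
  have hU3 : 3 ≤ U.card := by
    by_contra! hlt
    have : ∃ a c, a ≠ c ∧ U ⊆ {a, c} := by
      obtain ⟨T, hUT, hT⟩ := Finset.exists_superset_card_eq (s := U) (n := 2) (by omega)
        (by simp; omega)
      obtain ⟨a, c, hac, rfl⟩ := Finset.card_eq_two.1 hT
      exact ⟨a, c, hac, hUT⟩
    obtain ⟨a, c, hac, hU⟩ := this
    obtain ⟨j, x, hxa, hxc, hx⟩ := hC a c hac
    refine hx (hoff j x fun hxU => ?_)
    have := hU hxU
    simp [hxa, hxc] at this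
  have hU4 : 6 - β ≤ U.card := by
    rcases hβ with rfl | rfl
    · have : U.card ≠ 3 := by
        intro h3
        obtain ⟨a, b, c, hab, hac, hbc, hU⟩ := Finset.card_eq_three.1 h3
        have hd : ∀ x ∈ U, ¬ (2 : ℤ) ∣ w j₀ x := fun x hx => by simpa [U] using hx
        have h1 := h.sum_zero j₀
        rw [← Finset.sum_add_sum_compl U] at h1
        have h2 : (2 : ℤ) ∣ ∑ x ∈ Uᶜ, w j₀ x := Finset.dvd_sum fun x hx =>
          hoff j₀ x (by simpa using hx)
        have ha := hd a (by simp [hU])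
        have hb := hd b (by simp [hU])
        have hc := hd c (by simp [hU])
        have h3 : ∑ x ∈ U, w j₀ x = w j₀ a + w j₀ b + w j₀ c := by
          rw [hU, Finset.sum_insert (by simp [hab, hac]), Finset.sum_pair hbc, add_assoc]
        omega
      omega
    · omega
  let D : Finset ℤ := {v ∈ Finset.Icc (-3) 3 | ¬ β ∣ v}
  have hD : D.card ≤ 4 := by
    rcases hβ with rfl | rfl <;> decide
  have hD' : ∀ j ∈ J, ∀ x ∈ U, w j x ∈ D := by
    intro j hj x hx
    have h1 := h.sum_le hβ0.ne' hE (isSigned_self w j) {x}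
    simp only [Finset.sum_singleton] at h1
    rw [abs_le] at h1
    simp only [D, Finset.mem_filter, Finset.mem_Icc]
    exact ⟨h1, hon j hj x hx⟩
  have hDneg : ∀ v ∈ D, -v ∈ D := by
    intro v hv
    simp only [D, Finset.mem_filter, Finset.mem_Icc, dvd_neg] at hv ⊢
    exact ⟨by omega, hv.2⟩
  let J₁ := {j ∈ J | ∀ x ∉ U, w j x = 0}
  let J₂ := {j ∈ J | ¬ ∀ x ∉ U, w j x = 0}
  have hJ₁ : J₁.card ≤ 4096 := by
    refine h.card_le_of_eq_on J₁ U hU6 D hD w (fun _ _ => Or.inl rfl)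
      (fun j hj => hD' j (Finset.mem_filter.1 hj).1) (fun j hj j' hj' x hx => ?_)
    rw [(Finset.mem_filter.1 hj).2 x hx, (Finset.mem_filter.1 hj').2 x hx]
  have hstruct : ∀ j, ∃ u : Fin (r + 1) → ℤ, ∃ x, j ∈ J₂ → (u = w j ∨ u = - w j) ∧ x ∉ U ∧
      u x = β ∧ (∀ y ∈ U, |u y| = 1) ∧ (∀ y ∉ U, y ≠ x → u y = 0) := by
    intro j
    by_cases hj : j ∈ J₂
    swap
    · exact ⟨0, 0, fun h => (hj h).elim⟩
    simp only [J₂, Finset.mem_filter] at hj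
    obtain ⟨hjJ, hj⟩ := hj
    push Not at hj
    obtain ⟨x, hxU, hx⟩ := hj
    have hs : ∃ u : Fin (r + 1) → ℤ, (u = w j ∨ u = - w j) ∧ 0 < u x := by
      rcases lt_or_gt_of_ne hx with hx | hx
      · exact ⟨-w j, Or.inr rfl, by simpa using hx⟩
      · exact ⟨w j, Or.inl rfl, hx⟩
    obtain ⟨u, hu, hux⟩ := hs
    have huS : IsSigned w u := ⟨j, hu⟩
    have hdvd : ∀ y, β ∣ u y ↔ β ∣ w j y := by
      intro y
      rcases hu with rfl | rfl <;> simp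
    have hux' : β ≤ u x := Int.le_of_dvd hux ((hdvd x).2 (hoff j x hxU))
    have habs := h.sum_abs_le hβ0.ne' hE huS
    have hle : ∀ y ∈ U, 1 ≤ |u y| := fun y hy =>
      Int.one_le_abs fun h0 => hon j hjJ y hy ((hdvd y).1 (by simp [h0]))
    have hsplit : ∑ y, |u y| = ∑ y ∈ U, (|u y| - 1) + U.card + (|u x| +
        ∑ y ∈ Uᶜ.erase x, |u y|) := by
      rw [← Finset.sum_add_sum_compl U, ← Finset.add_sum_erase Uᶜ _ (by simpa using hxU)]
      simp
    rw [hsplit, abs_of_pos hux] at habs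
    have n1 : 0 ≤ ∑ y ∈ U, (|u y| - 1) := Finset.sum_nonneg fun y hy => by
      have := hle y hy; omega
    have n2 : 0 ≤ ∑ y ∈ Uᶜ.erase x, |u y| := Finset.sum_nonneg fun y _ => abs_nonneg _
    refine ⟨u, x, fun _ => ⟨hu, hxU, by omega, ?_, ?_⟩⟩
    · have h0 : ∑ y ∈ U, (|u y| - 1) = 0 := by omega
      rw [Finset.sum_eq_zero_iff_of_nonneg (fun y hy => by have := hle y hy; omega)] at h0
      intro y hy
      have := h0 y hy
      omega
    · have h0 : ∑ y ∈ Uᶜ.erase x, |u y| = 0 := by omega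
      rw [Finset.sum_eq_zero_iff_of_nonneg (fun y _ => abs_nonneg _)] at h0
      intro y hy hyx
      simpa using h0 y (by simp [hy, hyx])
  choose u x hux using hstruct
  have hsame : ∀ j ∈ J₂, ∀ j' ∈ J₂, x j ≠ x j' → ∀ y ∈ U, u j y = u j' y := by
    have hle : ∀ j ∈ J₂, ∀ j' ∈ J₂, x j ≠ x j' → ∀ y ∈ U, u j y ≤ u j' y := by
      intro j hj j' hj' hne y hy
      by_contra! hlt
      obtain ⟨hu, hxU, hx, hU, hoffU⟩ := hux j hj
      obtain ⟨hu', hxU', hx', hU', hoffU'⟩ := hux j' hj'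
      have hs : ∀ j ∈ J₂, ∑ z ∈ U, u j z = -β := by
        intro j hj
        obtain ⟨hu, hxU, hx, hU, hoffU⟩ := hux j hj
        have h1 := h.sum_signed ⟨j, hu⟩
        rw [← Finset.sum_add_sum_compl U, Finset.sum_eq_single_of_mem (s := Uᶜ) (x j)
          (by simpa using hxU) (fun y hy hyx => hoffU y (by simpa using hy) hyx), hx] at h1
        omega
      obtain ⟨y', hy', hlt'⟩ : ∃ y' ∈ U, u j y' < u j' y' := by
        by_contra! hge
        have := Finset.sum_lt_sum hge ⟨y, hy, hlt⟩
        rw [hs j hj, hs j' hj'] at this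
        omega
      have hyy : y ≠ y' := by rintro rfl; omega
      have hxy : ∀ z ∈ U, ∀ i ∈ J₂, x i ≠ z := by
        rintro z hz i hi rfl
        exact (hux i hi).2.1 hz
      obtain ⟨z, hz, hz'⟩ := h.det_two hβ0.ne' hE ⟨j, hu⟩ ⟨j', hu'⟩
        (S := {x j, y}) (T := {x j', y'}) (by
          rw [Finset.disjoint_left]
          intro t ht ht'
          simp only [Finset.mem_insert, Finset.mem_singleton] at ht ht'
          rcases ht with rfl | rfl <;> rcases ht' with ht' | ht'
          · exact hne ht'
          · exact hxy _ hy' _ hj ht'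
          · exact hxy _ hy _ hj' ht'.symm
          · exact hyy ht')
      rw [Finset.sum_pair (hxy y hy j hj), Finset.sum_pair (hxy y' hy' j' hj'),
        Finset.sum_pair (hxy y hy j hj), Finset.sum_pair (hxy y' hy' j' hj'), hx, hx',
        hoffU (x j') hxU' hne.symm, hoffU' (x j) hxU hne] at hz'
      have a1 := eq_or_eq_neg_of_abs_eq (hU y hy)
      have a2 := eq_or_eq_neg_of_abs_eq (hU' y hy)
      have a3 := eq_or_eq_neg_of_abs_eq (hU y' hy')
      have a4 := eq_or_eq_neg_of_abs_eq (hU' y' hy')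
      have b1 : u j y = 1 := by omega
      have b2 : u j' y = -1 := by omega
      have b3 : u j y' = -1 := by omega
      have b4 : u j' y' = 1 := by omega
      rw [b1, b2, b3, b4] at hz'
      rw [abs_le] at hz
      rcases hβ with rfl | rfl <;> omega
    intro j hj j' hj' hne y hy
    exact le_antisymm (hle j hj j' hj' hne y hy) (hle j' hj' j hj hne.symm y hy)
  have hJ₂ : J₂.card ≤ 4096 + (r + 1) := by
    rcases J₂.eq_empty_or_nonempty with he | ⟨i, hi⟩
    · rw [he]; simp
    rw [← Finset.card_filter_add_card_filter_not (s := J₂) (fun j => x j = x i)]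
    apply add_le_add
    · refine h.card_le_of_eq_on _ U hU6 D hD u (fun j hj => (hux j (Finset.mem_filter.1 hj).1).1)
        (fun j hj y hy => ?_) (fun j hj j' hj' y hy => ?_)
      · have hj' := (Finset.mem_filter.1 hj).1
        have := hD' j (Finset.mem_filter.1 hj').1 y hy
        rcases (hux j hj').1 with h1 | h1
        · rwa [h1]
        · rw [h1]; exact hDneg _ this
      · obtain ⟨hj, hx⟩ := Finset.mem_filter.1 hj
        obtain ⟨hj', hx'⟩ := Finset.mem_filter.1 hj'
        obtain ⟨-, -, h1, -, h2⟩ := hux j hj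
        obtain ⟨-, -, h1', -, h2'⟩ := hux j' hj'
        by_cases hy' : y = x i
        · rw [hy', ← hx, h1, hx, ← hx', h1']
        · rw [h2 y hy (by rwa [hx]), h2' y hy (by rwa [hx'])]
    · calc _ ≤ (Finset.univ : Finset (Fin (r + 1))).card := by
            apply Finset.card_le_card_of_injOn x
            · simp
            · intro j hj j' hj' e
              obtain ⟨hj, hx⟩ := Finset.mem_filter.1 hj
              obtain ⟨hj', hx'⟩ := Finset.mem_filter.1 hj'
              obtain ⟨hu, -, h1, -, h2⟩ := hux j hj
              obtain ⟨hu', -, h1', -, h2'⟩ := hux j' hj'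
              apply h.eq_of_signed hu
              have : u j = u j' := by
                ext y
                by_cases hy : y ∈ U
                · rw [hsame j hj i hi hx y hy, hsame j' hj' i hi hx' y hy]
                · by_cases hyx : y = x j
                  · rw [hyx, h1]; rw [e, h1']
                  · rw [h2 y hy hyx, h2' y hy (by rw [← e]; exact hyx)]
              rw [this]; exact hu'
        _ = r + 1 := by simp
  have hsplit := Finset.card_filter_add_card_filter_not (s := J) (fun j => ∀ x ∉ U, w j x = 0)
  change J₁.card + J₂.card = J.card at hsplit
  omega

theorem card_le_of_two_three (h : CliqueForm β w) (hβ : β = 2 ∨ β = 3) (hr : 8195 ≤ r) :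
    n ≤ (r + 1).choose 2 + 2 * (r - 1) := by
  classical
  by_cases hC : ∃ a c, a ≠ c ∧ ∀ j x, x ≠ a → x ≠ c → β ∣ w j x
  · obtain ⟨a, c, hac, hd⟩ := hC
    exact h.card_le_of_dvd_off_pair hβ (by omega) hac hd
  push Not at hC
  have hE : ∀ x y, x ≠ y → IsUnitEdge β w x y := by
    intro x y hxy
    by_contra hno
    obtain ⟨j, z, hz, hz', hd⟩ := hC x y hxy
    exact hd (h.dvd_off_pair_of_not_isUnitEdge hβ (by omega) hxy hno j z hz hz')
  have h1 := h.card_nonEdges_le_of_two_three hβ (by omega) hE hC {j | j ∈ nonEdges β w}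
    (fun j hj => by simpa using hj)
  have h2 := h.card_le_nonEdges (by omega)
  omega

end CliqueForm

section TwoPoint

variable {V : Type*}

/-- All `2 × 2` minors formed by sums over disjoint vertex sets are bounded by `3`. -/
def MinorsLe (u u' : V → ℤ) : Prop :=
  ∀ S T : Finset V, Disjoint S T →
    |(∑ y ∈ S, u y) * (∑ y ∈ T, u' y) - (∑ y ∈ T, u y) * (∑ y ∈ S, u' y)| ≤ 3

/-- `MinorsLe` for `h - e_x` and `h' - e_{x'}`, where `x` and `x'` are two further vertices. -/
def MinorsLeExt (h h' : V → ℤ) : Prop :=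
  ∀ S T : Finset V, Disjoint S T → ∀ p q p' q' : Bool, (p && q) = false → (p' && q') = false →
    |((∑ y ∈ S, h y) - cond p 1 0) * ((∑ y ∈ T, h' y) - cond q' 1 0) -
      ((∑ y ∈ T, h y) - cond q 1 0) * ((∑ y ∈ S, h' y) - cond p' 1 0)| ≤ 3

theorem MinorsLeExt.symm {u u' : V → ℤ} (h : MinorsLeExt u u') : MinorsLeExt u' u := by
  intro S T hST p q p' q' h1 h2
  have := h T S hST.symm q' p' q p (by rwa [Bool.and_comm]) (by rwa [Bool.and_comm])
  rw [mul_comm, mul_comm ((∑ y ∈ S, u y) - _)] at this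
  exact this

theorem sum_sdiff_pair [DecidableEq V] {x x' : V} (S : Finset V) {h : V → ℤ} (hx : h x = 0)
    (hx' : h x' = 0) :
    ∑ y ∈ S \ {x, x'}, h y = ∑ y ∈ S, h y := by
  apply Finset.sum_subset Finset.sdiff_subset
  intro y hy hy'
  have : y = x ∨ y = x' := by
    by_contra hne
    exact hy' (by simpa [hy] using hne)
  rcases this with rfl | rfl <;> assumption

theorem sum_pos_add_sum_neg [Fintype V] (h : V → ℤ) :
    (∑ x with 0 < h x, h x) + ∑ x with h x < 0, h x = ∑ x, h x := by
  rw [← Finset.sum_filter_add_sum_filter_not Finset.univ (fun x => 0 < h x) h]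
  congr 1
  apply Finset.sum_subset
  · intro x hx
    simp only [Finset.mem_filter, Finset.mem_univ, true_and] at hx ⊢
    omega
  · intro x hx hx'
    simp only [Finset.mem_filter, Finset.mem_univ, true_and] at hx hx'
    omega

theorem MinorsLeExt.sum_zero_set [Fintype V] {h h' : V → ℤ} (D : MinorsLeExt h h')
    (hP : ∑ x with 0 < h x, h x = 3) {Y : Finset V} (hY : ∀ y ∈ Y, h y = 0) :
    ∑ y ∈ Y, h' y = 0 ∨ ∑ y ∈ Y, h' y = 1 := by
  have d : Disjoint (Finset.univ.filter fun x => 0 < h x) Y := by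
    rw [Finset.disjoint_left]
    intro y hy hy'
    have := hY y hy'
    simp [this] at hy
  have h1 := abs_le.1 (D _ _ d false false false false rfl rfl)
  have h2 := abs_le.1 (D _ _ d false false false true rfl rfl)
  simp only [cond_true, cond_false, sub_zero, Finset.sum_eq_zero hY, hP, zero_mul] at h1 h2
  omega

theorem sum_extend [DecidableEq V] {x x' : V} (hxx : x ≠ x') {S : Finset V} (hx : x ∉ S)
    (hx' : x' ∉ S) (b b' : Bool) {h h' : V → ℤ} (gx : h' x = 0) (hx0 : h x = 0) (hxx0 : h x' = 0)
    (gx' : h' x' = 0) :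
    ∑ y ∈ S ∪ ((if b then {x} else ∅) ∪ (if b' then {x'} else ∅)),
        (h - Pi.single x 1 : V → ℤ) y = (∑ y ∈ S, h y) - cond b 1 0 ∧
    ∑ y ∈ S ∪ ((if b then {x} else ∅) ∪ (if b' then {x'} else ∅)),
        (h' - Pi.single x' 1 : V → ℤ) y = (∑ y ∈ S, h' y) - cond b' 1 0 := by
  have e1 : ∀ y ∈ S, (h - Pi.single x 1 : V → ℤ) y = h y := by
    intro y hy
    have : y ≠ x := by rintro rfl; exact hx hy
    simp [this]
  have e2 : ∀ y ∈ S, (h' - Pi.single x' 1 : V → ℤ) y = h' y := by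
    intro y hy
    have : y ≠ x' := by rintro rfl; exact hx' hy
    simp [this]
  have d : Disjoint S ((if b then {x} else ∅) ∪ (if b' then {x'} else ∅)) := by
    cases b <;> cases b' <;> simp [hx, hx']
  rw [Finset.sum_union d, Finset.sum_union d, Finset.sum_congr rfl e1, Finset.sum_congr rfl e2]
  have n1 := hxx.symm
  cases b <;> cases b' <;> simp [hxx, n1, gx, hx0, hxx0, gx'] <;>
    ring_nf <;> simp

theorem MinorsLe.extend [DecidableEq V] {x x' : V} (hxx : x ≠ x') {h h' : V → ℤ} (hx : h x = 0)
    (hx' : h x' = 0) (gx : h' x = 0) (gx' : h' x' = 0)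
    (hD : MinorsLe (h - Pi.single x 1) (h' - Pi.single x' 1)) :
    MinorsLeExt h h' := by
  intro S T hST p q p' q' hpq hpq'
  have h1 := sum_extend hxx (S := S \ {x, x'}) (by simp) (by simp) p p' gx hx hx' gx'
  have h2 := sum_extend hxx (S := T \ {x, x'}) (by simp) (by simp) q q' gx hx hx' gx'
  rw [sum_sdiff_pair S hx hx', sum_sdiff_pair S gx gx'] at h1
  rw [sum_sdiff_pair T hx hx', sum_sdiff_pair T gx gx'] at h2
  rw [← h1.1, ← h1.2, ← h2.1, ← h2.2]
  apply hD
  rw [Finset.disjoint_left] at hST ⊢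
  intro y hy hy'
  simp only [Finset.mem_union, Finset.mem_sdiff, Finset.mem_insert, Finset.mem_singleton,
    not_or] at hy hy'
  revert hpq hpq'
  cases p <;> cases q <;> cases p' <;> cases q' <;> simp at hy hy' ⊢ <;> grind

variable [Fintype V] [DecidableEq V]

theorem eq_single_of_nonneg {f : V → ℤ} (hf : ∀ x, 0 ≤ f x) (hs : ∑ x, f x = 1) :
    ∃ v, f = Pi.single v 1 := by
  obtain ⟨v, hv⟩ : ∃ v, f v ≠ 0 := by
    by_contra! h
    simp [h] at hs
  refine ⟨v, ?_⟩
  have h1 := Finset.add_sum_erase Finset.univ f (Finset.mem_univ v)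
  have h2 : 0 ≤ ∑ x ∈ Finset.univ.erase v, f x := Finset.sum_nonneg fun x _ => hf x
  have h3 := hf v
  have h4 : f v = 1 := by omega
  have h5 : ∑ x ∈ Finset.univ.erase v, f x = 0 := by omega
  rw [Finset.sum_eq_zero_iff_of_nonneg fun x _ => hf x] at h5
  ext x
  by_cases hx : x = v
  · subst hx; simpa using h4
  · simpa [hx] using h5 x (by simp [hx])

theorem two_le_sum_pos {h : V → ℤ} (hs : ∑ x, h x = 1) (hu : ∀ v, h ≠ Pi.single v 1) :
    2 ≤ ∑ x with 0 < h x, h x := by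
  have h1 := Finset.sum_filter_add_sum_filter_not Finset.univ (fun x => 0 < h x) h
  have h2 : ∑ x with ¬ 0 < h x, h x ≤ 0 := Finset.sum_nonpos fun x hx => by
    simpa using (Finset.mem_filter.1 hx).2
  by_contra! hlt
  have h3 : ∑ x with ¬ 0 < h x, h x = 0 := by omega
  rw [Finset.sum_eq_zero_iff_of_nonpos fun x hx => by
    simpa using (Finset.mem_filter.1 hx).2] at h3
  obtain ⟨v, hv⟩ := eq_single_of_nonneg (f := h) (fun x => by
    by_cases hx : 0 < h x
    · exact hx.le
    · exact (h3 x (by simpa using hx)).ge) hs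
  exact hu v hv

theorem MinorsLeExt.eq_zero_of_sum_pos {h h' : V → ℤ} (D : MinorsLeExt h h') (hs : ∑ x, h x = 1)
    (hs' : ∑ x, h' x = 1) (hu' : ∀ v, h' ≠ Pi.single v 1) (hP : ∑ x with 0 < h x, h x = 3)
    {v : V} (hv : h v = 0) : h' v = 0 := by
  have hN : ∑ x with h x < 0, h x = -2 := by
    have := sum_pos_add_sum_neg h
    omega
  rcases D.sum_zero_set hP (Y := {v}) (by simpa using hv) with h0 | h1
  · simpa using h0
  exfalso
  rw [Finset.sum_singleton] at h1
  have hO : ∀ y, h y = 0 → y ≠ v → h' y = 0 := by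
    intro y hy hyv
    have a1 := D.sum_zero_set hP (Y := {y}) (by simpa using hy)
    have a2 := D.sum_zero_set hP (Y := {y, v}) (by simp [hy, hv])
    rw [Finset.sum_pair hyv] at a2
    rw [Finset.sum_singleton] at a1
    omega
  set P := Finset.univ.filter fun x => 0 < h x with hPd
  set N := Finset.univ.filter fun x => h x < 0 with hNd
  have mP : ∀ x, x ∈ P ↔ 0 < h x := by simp [P]
  have mN : ∀ x, x ∈ N ↔ h x < 0 := by simp [N]
  have vN : v ∉ N := by rw [mN]; omega
  have vP : v ∉ P := by rw [mP]; omega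
  have dPN : Disjoint P N := by
    rw [Finset.disjoint_left]; intro x; rw [mP, mN]; omega
  have dPN' : Disjoint P (insert v N) := by
    rw [Finset.disjoint_insert_right]; exact ⟨vP, dPN⟩
  have tot : ∑ x ∈ P, h' x + ∑ x ∈ N, h' x + 1 = 1 := by
    have e : ∑ x ∈ insert v (P ∪ N), h' x = 1 + (∑ x ∈ P, h' x + ∑ x ∈ N, h' x) := by
      rw [Finset.sum_insert (by simp [vP, vN]), h1, Finset.sum_union dPN]
    rw [add_comm, ← e, ← hs']
    apply Finset.sum_subset (Finset.subset_univ _)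
    intro y _ hy
    simp only [Finset.mem_insert, Finset.mem_union, mP, mN, not_or] at hy
    exact hO y (by omega) hy.1
  have b1 := abs_le.1 (D _ _ dPN false false false true rfl rfl)
  have b2 := abs_le.1 (D _ _ dPN' false false false false rfl rfl)
  rw [Finset.sum_insert vN, Finset.sum_insert vN] at b2
  simp only [cond_true, cond_false, sub_zero, hP, hN, h1, hv] at b1 b2
  have pz : ∑ x ∈ P, h' x = 0 := by omega
  have nz : ∑ x ∈ N, h' x = 0 := by omega
  have qN : ∀ y ∈ N, h' y ≤ 0 := by
    intro y hy
    have hyv : y ≠ v := by rintro rfl; exact vN hy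
    have d : Disjoint P {y, v} := by
      rw [Finset.disjoint_left]; intro x hx; simp only [Finset.mem_insert, Finset.mem_singleton]
      rintro (rfl | rfl)
      · exact Finset.disjoint_left.1 dPN hx hy
      · exact vP hx
    have := abs_le.1 (D _ _ d false false false false rfl rfl)
    rw [Finset.sum_pair hyv, Finset.sum_pair hyv] at this
    simp only [cond_false, sub_zero, hP, pz, h1, mul_zero] at this
    omega
  have qP : ∀ y ∈ P, h' y ≤ 0 := by
    intro y hy
    have hyv : y ≠ v := by rintro rfl; exact vP hy
    have d : Disjoint N {y, v} := by
      rw [Finset.disjoint_left]; intro x hx; simp only [Finset.mem_insert, Finset.mem_singleton]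
      rintro (rfl | rfl)
      · exact Finset.disjoint_left.1 dPN hy hx
      · exact vN hx
    have := abs_le.1 (D _ _ d true false false false rfl rfl)
    rw [Finset.sum_pair hyv, Finset.sum_pair hyv] at this
    simp only [cond_false, cond_true, sub_zero, hN, nz, h1, mul_zero] at this
    omega
  rw [Finset.sum_eq_zero_iff_of_nonpos qN] at nz
  rw [Finset.sum_eq_zero_iff_of_nonpos qP] at pz
  obtain ⟨v', hv'⟩ := eq_single_of_nonneg (f := h') (fun x => by
    rcases lt_trichotomy (h x) 0 with hx | hx | hx
    · exact (nz x ((mN x).2 hx)).ge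
    · by_cases hxv : x = v
      · rw [hxv, h1]; norm_num
      · exact (hO x hx hxv).ge
    · exact (pz x ((mP x).2 hx)).ge) hs'
  exact hu' v' hv'

theorem exists_eq_single_add {h : V → ℤ} (hs : ∑ x, h x = 1) {a c : V} (k : ℤ)
    (hk : ∀ x, 0 ≤ h x - k * ((Pi.single a 1 - Pi.single c 1 : V → ℤ) x)) :
    ∃ v, h = Pi.single v 1 + k • (Pi.single a 1 - Pi.single c 1 : V → ℤ) := by
  obtain ⟨v, hv⟩ := eq_single_of_nonneg
    (f := h - k • (Pi.single a 1 - Pi.single c 1 : V → ℤ)) (fun x => by simpa using hk x) (by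
      simp [Finset.sum_sub_distrib, ← Finset.mul_sum, hs])
  exact ⟨v, by rw [← hv]; simp⟩

theorem MinorsLeExt.two_point_of_sum_pos {h h' : V → ℤ} (D : MinorsLeExt h h')
    (hs : ∑ x, h x = 1) (hs' : ∑ x, h' x = 1) (hu' : ∀ v, h' ≠ Pi.single v 1) (hne : h ≠ h')
    (hP : ∑ x with 0 < h x, h x = 3) :
    ∃ a c v v', a ≠ c ∧ h = Pi.single v 1 + (2 : ℤ) • (Pi.single a 1 - Pi.single c 1 : V → ℤ) ∧
      h' = Pi.single v' 1 + (1 : ℤ) • (Pi.single a 1 - Pi.single c 1 : V → ℤ) := by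
  have hN : ∑ x with h x < 0, h x = -2 := by
    have := sum_pos_add_sum_neg h
    omega
  have hO : ∀ y, h y = 0 → h' y = 0 := fun y hy => D.eq_zero_of_sum_pos hs hs' hu' hP hy
  set P := Finset.univ.filter fun x => 0 < h x with hPd
  set N := Finset.univ.filter fun x => h x < 0 with hNd
  have mP : ∀ x, x ∈ P ↔ 0 < h x := by simp [P]
  have mN : ∀ x, x ∈ N ↔ h x < 0 := by simp [N]
  have dPN : Disjoint P N := by
    rw [Finset.disjoint_left]; intro x; rw [mP, mN]; omega
  have tot : ∑ x ∈ P, h' x + ∑ x ∈ N, h' x = 1 := by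
    rw [← hs', ← Finset.sum_union dPN]
    apply Finset.sum_subset (Finset.subset_univ _)
    intro y _ hy
    simp only [Finset.mem_union, mP, mN, not_or] at hy
    exact hO y (by omega)
  obtain ⟨ν, hν⟩ : ∃ ν, ν = -∑ x ∈ N, h' x := ⟨_, rfl⟩
  have hN' : ∑ x ∈ N, h' x = -ν := by omega
  have hP' : ∑ x ∈ P, h' x = 1 + ν := by omega
  have bP : ∀ y ∈ P, h y ≤ 3 := fun y hy => by
    rw [← hP]
    exact Finset.single_le_sum (f := h) (fun x hx => ((mP x).1 hx).le) hy
  have bN : ∀ y ∈ N, -2 ≤ h y := fun y hy => by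
    rw [← hN]
    have := Finset.single_le_sum (f := -h) (s := N)
      (fun x hx => by have := (mN x).1 hx; simp; omega) hy
    simpa using this
  have iP : ∀ y ∈ P, |ν * h y - 3 * h' y| ≤ 3 ∧ |(ν + 1) * h y - 3 * h' y| ≤ 3 ∧
      ν * h y ≤ 3 * h' y := by
    intro y hy
    have d : Disjoint N {y} := by
      rw [Finset.disjoint_singleton_right]; exact Finset.disjoint_left.1 dPN hy
    have c1 := D _ _ d true false false false rfl rfl
    have c2 := D _ _ d true false true false rfl rfl
    have c3 := D _ _ d true false false true rfl rfl
    simp only [cond_false, cond_true, sub_zero, hN, hN', Finset.sum_singleton] at c1 c2 c3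
    refine ⟨?_, ?_, ?_⟩
    · convert c1 using 2; ring
    · convert c2 using 2; ring
    · linarith [(abs_le.1 c3).2]
  have iN : ∀ Z ⊆ N, |3 * (∑ z ∈ Z, h' z) - (1 + ν) * ∑ z ∈ Z, h z| ≤ 3 ∧
      0 ≤ 3 * (∑ z ∈ Z, h' z) - (1 + ν) * ∑ z ∈ Z, h z ∧
      3 * (∑ z ∈ Z, h' z) - (1 + ν) * ((∑ z ∈ Z, h z) - 1) ≤ 3 := by
    intro Z hZ
    have d : Disjoint P Z := dPN.mono_right hZ
    have c1 := D _ _ d false false false false rfl rfl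
    have c2 := D _ _ d false false false true rfl rfl
    have c3 := D _ _ d false true false false rfl rfl
    simp only [cond_false, cond_true, sub_zero, hP, hP'] at c1 c2 c3
    refine ⟨?_, ?_, ?_⟩
    · convert c1 using 2; ring
    · linarith [(abs_le.1 c2).1]
    · linarith [(abs_le.1 c3).2]
  have iN1 : ∀ z ∈ N, |3 * h' z - (1 + ν) * h z| ≤ 3 ∧ 0 ≤ 3 * h' z - (1 + ν) * h z ∧
      3 * h' z - (1 + ν) * (h z - 1) ≤ 3 := by
    intro z hz
    simpa using iN {z} (by simpa using hz)
  have νr : -1 ≤ ν ∧ ν ≤ 2 := by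
    have := iN N subset_rfl
    rw [hN, hN', abs_le] at this
    omega
  have unit : (∀ y ∈ P, 0 ≤ h' y) → (∀ y ∈ N, 0 ≤ h' y) → False := by
    intro h1 h2
    obtain ⟨v', hv'⟩ := eq_single_of_nonneg (f := h') (fun x => by
      rcases lt_trichotomy (h x) 0 with hx | hx | hx
      · exact h2 x ((mN x).2 hx)
      · exact (hO x hx).ge
      · exact h1 x ((mP x).2 hx)) hs'
    exact hu' v' hv'
  obtain rfl | rfl | rfl | rfl : ν = -1 ∨ ν = 0 ∨ ν = 1 ∨ ν = 2 := by omega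
  · exfalso
    have q : ∀ y ∈ P, h' y ≤ 0 := by
      intro y hy
      have := (iP y hy).1
      have := (mP y).1 hy
      rw [abs_le] at *
      omega
    have z : ∑ y ∈ P, h' y = 0 := by omega
    rw [Finset.sum_eq_zero_iff_of_nonpos q] at z
    refine unit (fun y hy => (z y hy).ge) (fun y hy => ?_)
    have := (iN1 y hy).2.1
    omega
  · exfalso
    refine unit (fun y hy => ?_) (fun y hy => ?_)
    · have := (iP y hy).2.2
      omega
    · have := (iN1 y hy).2.1
      have := bN y hy
      omega
  · have hz : ∀ z ∈ N, h z = -2 ∧ h' z = -1 := by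
      intro z hz
      have h1 := (iN1 z hz).2
      have h2 := bN z hz
      have h3 := (mN z).1 hz
      omega
    obtain ⟨d, hd⟩ : N.Nonempty := by
      rw [Finset.nonempty_iff_ne_empty]
      intro h0
      rw [h0] at hN
      simp at hN
    have hNd' : ∀ z ∈ N, z = d := by
      intro z hzN
      by_contra hzd
      have h1 := Finset.sum_le_sum_of_subset_of_nonneg (s := {z, d}) (t := N) (f := -h)
        (by intro x; simp only [Finset.mem_insert, Finset.mem_singleton]; rintro (rfl | rfl) <;>
            assumption)
        (fun x hx _ => by have := (mN x).1 hx; simp; omega)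
      rw [Finset.sum_pair hzd] at h1
      have h2 := hz z hzN
      have h3 := hz d hd
      simp [hN] at h1
      omega
    obtain ⟨a, haP, ha⟩ : ∃ a ∈ P, 2 ≤ h a := by
      by_contra! hcon
      have : ∑ y ∈ P, h' y = ∑ y ∈ P, h y := by
        apply Finset.sum_congr rfl
        intro y hy
        have h1 := hcon y hy
        have h2 := (mP y).1 hy
        have h3 := iP y hy
        rw [abs_le, abs_le] at h3
        omega
      omega
    have hdneg := (mN d).1 hd
    have had : a ≠ d := by rintro rfl; omega
    have hda := had.symm
    obtain ⟨v, hv⟩ := exists_eq_single_add (a := a) (c := d) hs 2 (fun x => by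
      by_cases hxa : x = a
      · subst hxa; simp [had]; omega
      · by_cases hxd : x = d
        · subst hxd; simp [hxa]; have := (hz x hd).1; omega
        · simp [hxa, hxd]
          by_contra hlt
          exact hxd (hNd' x ((mN x).2 (by omega))))
    obtain ⟨v', hv'⟩ := exists_eq_single_add (a := a) (c := d) hs' 1 (fun x => by
      by_cases hxa : x = a
      · subst hxa; simp [had]; have := (iP x haP).2.2; omega
      · by_cases hxd : x = d
        · subst hxd; simp [hxa]; have := (hz x hd).2; omega
        · simp [hxa, hxd]
          rcases lt_trichotomy (h x) 0 with hx | hx | hx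
          · exact absurd (hNd' x ((mN x).2 hx)) hxd
          · exact (hO x hx).ge
          · have := (iP x ((mP x).2 hx)).2.2
            omega)
    exact ⟨a, d, v, v', had, hv, hv'⟩
  · exfalso
    have h1 : ∀ y ∈ P, h' y ≤ h y := by
      intro y hy
      have h2 := iP y hy
      have h3 := bP y hy
      have h4 := (mP y).1 hy
      rw [abs_le, abs_le] at h2
      omega
    have h2 : ∀ y ∈ N, h y ≤ h' y := by
      intro y hy
      have h2 := (iN1 y hy).2.1
      omega
    have e1 := (Finset.sum_eq_sum_iff_of_le h1).1 (by omega)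
    have e2 := (Finset.sum_eq_sum_iff_of_le h2).1 (by omega)
    apply hne
    ext x
    rcases lt_trichotomy (h x) 0 with hx | hx | hx
    · exact e2 x ((mN x).2 hx)
    · rw [hx, hO x hx]
    · exact (e1 x ((mP x).2 hx)).symm

theorem exists_neg_of_sum_pos {h : V → ℤ} (hs : ∑ x, h x = 1)
    (hP : ∑ x with 0 < h x, h x = 2) : ∃ c, h c = -1 ∧ ∀ x, x ≠ c → 0 ≤ h x := by
  have hN : ∑ x with h x < 0, h x = -1 := by
    have := sum_pos_add_sum_neg h
    omega
  obtain ⟨c, hc⟩ : (Finset.univ.filter fun x => h x < 0).Nonempty := by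
    rw [Finset.nonempty_iff_ne_empty]
    intro h0
    rw [h0] at hN
    simp at hN
  have h1 := Finset.add_sum_erase _ h hc
  have h2 : ∑ x ∈ (Finset.univ.filter fun x => h x < 0).erase c, h x ≤ 0 :=
    Finset.sum_nonpos fun x hx => by simp at hx; omega
  have h3 : h c < 0 := by simpa using hc
  have h4 : ∑ x ∈ (Finset.univ.filter fun x => h x < 0).erase c, h x = 0 := by omega
  rw [Finset.sum_eq_zero_iff_of_nonpos fun x hx => by simp at hx; omega] at h4
  refine ⟨c, by omega, fun x hx => ?_⟩
  by_contra hlt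
  have := h4 x (by simp [hx]; omega)
  omega

theorem MinorsLeExt.two_point {h h' : V → ℤ} (D : MinorsLeExt h h')
    (hs : ∑ x, h x = 1) (hs' : ∑ x, h' x = 1) (hu : ∀ v, h ≠ Pi.single v 1)
    (hu' : ∀ v, h' ≠ Pi.single v 1) (hne : h ≠ h')
    (hP : ∑ x with 0 < h x, h x ≤ 3) (hP' : ∑ x with 0 < h' x, h' x ≤ 3) :
    ∃ a c v v' k k', a ≠ c ∧ k ≠ 0 ∧ k' ≠ 0 ∧
      h = Pi.single v 1 + (k : ℤ) • (Pi.single a 1 - Pi.single c 1 : V → ℤ) ∧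
      h' = Pi.single v' 1 + (k' : ℤ) • (Pi.single a 1 - Pi.single c 1 : V → ℤ) := by
  have g := two_le_sum_pos hs hu
  have g' := two_le_sum_pos hs' hu'
  by_cases h3 : ∑ x with 0 < h x, h x = 3
  · obtain ⟨a, c, v, v', hac, e, e'⟩ := D.two_point_of_sum_pos hs hs' hu' hne h3
    exact ⟨a, c, v, v', 2, 1, hac, by norm_num, by norm_num, e, e'⟩
  by_cases h3' : ∑ x with 0 < h' x, h' x = 3
  · obtain ⟨a, c, v, v', hac, e, e'⟩ := D.symm.two_point_of_sum_pos hs' hs hu hne.symm h3'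
    exact ⟨a, c, v', v, 1, 2, hac, by norm_num, by norm_num, e', e⟩
  have p2 : ∑ x with 0 < h x, h x = 2 := by omega
  have p2' : ∑ x with 0 < h' x, h' x = 2 := by omega
  obtain ⟨c, hc, hcn⟩ := exists_neg_of_sum_pos hs p2
  obtain ⟨c', hc', hcn'⟩ := exists_neg_of_sum_pos hs' p2'
  have q1 : h' c ≠ 0 := by
    intro h0
    have d : Disjoint {c} (Finset.univ.filter fun x => 0 < h' x) := by
      simp [h0]
    have := abs_le.1 (D _ _ d true false false false rfl rfl)
    simp only [cond_true, cond_false, sub_zero, Finset.sum_singleton, p2', hc, h0] at this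
    omega
  have q2 : h c' ≠ 0 := by
    intro h0
    have d : Disjoint (Finset.univ.filter fun x => 0 < h x) {c'} := by
      simp [h0]
    have := abs_le.1 (D _ _ d false false false true rfl rfl)
    simp only [cond_true, cond_false, sub_zero, Finset.sum_singleton, p2, hc', h0] at this
    omega
  by_cases hcc : c = c'
  · subst hcc
    obtain ⟨a, ha, ha'⟩ : ∃ a, 0 < h a ∧ 0 < h' a := by
      by_contra! hcon
      have d : Disjoint (Finset.univ.filter fun x => 0 < h x)
          (Finset.univ.filter fun x => 0 < h' x) := by
        rw [Finset.disjoint_left]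
        intro x hx hx'
        simp only [Finset.mem_filter, Finset.mem_univ, true_and] at hx hx'
        have := hcon x hx
        omega
      have z : ∑ x with 0 < h' x, h x = 0 := by
        apply Finset.sum_eq_zero
        intro x hx
        simp only [Finset.mem_filter, Finset.mem_univ, true_and] at hx
        have h1 := hcon x
        have h2 := hcn x (by rintro rfl; omega)
        omega
      have := abs_le.1 (D _ _ d false false false false rfl rfl)
      simp only [cond_false, sub_zero, p2, p2', z] at this
      omega
    have hac : a ≠ c := by rintro rfl; omega
    have hca := hac.symm
    have aux : ∀ f : V → ℤ, 0 < f a → f c = -1 → (∀ x, x ≠ c → 0 ≤ f x) →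
        ∀ x, 0 ≤ f x - 1 * ((Pi.single a 1 - Pi.single c 1 : V → ℤ) x) := by
      intro f hfa hfc hfn x
      by_cases hxa : x = a
      · subst hxa; simp [hac]; omega
      · by_cases hxc : x = c
        · subst hxc; simp [hxa]; omega
        · simpa [hxa, hxc] using hfn x hxc
    obtain ⟨v, hv⟩ := exists_eq_single_add hs 1 (aux h ha hc hcn)
    obtain ⟨v', hv'⟩ := exists_eq_single_add hs' 1 (aux h' ha' hc' hcn')
    exact ⟨a, c, v, v', 1, 1, hac, by norm_num, by norm_num, hv, hv'⟩
  · have hcc' : c' ≠ c := fun h => hcc h.symm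
    have r1 := hcn c' hcc'
    have r2 := hcn' c hcc
    obtain ⟨v, hv⟩ := exists_eq_single_add (a := c') (c := c) hs 1 (fun x => by
      by_cases hxa : x = c'
      · subst hxa; simp [hcc']; omega
      · by_cases hxc : x = c
        · subst hxc; simp [hxa]; omega
        · simpa [hxa, hxc] using hcn x hxc)
    obtain ⟨v', hv'⟩ := exists_eq_single_add (a := c') (c := c) hs' (-1) (fun x => by
      by_cases hxa : x = c'
      · subst hxa; simp [hcc']; omega
      · by_cases hxc : x = c
        · subst hxc; simp [hxa]; omega
        · simpa [hxa, hxc] using hcn' x hxa)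
    exact ⟨c', c, v, v', 1, -1, hcc', by norm_num, by norm_num, hv, hv'⟩

end TwoPoint

namespace CliqueForm

variable {n r : ℕ} {w : Fin n → Fin (r + 1) → ℤ}

theorem card_support_le (h : CliqueForm 1 w) (hE : ∀ x y, x ≠ y → IsUnitEdge 1 w x y)
    {u : Fin (r + 1) → ℤ} (hu : IsSigned w u) :
    (Finset.univ.filter fun x => u x ≠ 0).card ≤ 6 := by
  have h1 := h.sum_abs_le one_ne_zero hE hu
  have h2 : ∑ x with u x ≠ 0, (1 : ℤ) ≤ ∑ x, |u x| := by
    refine (Finset.sum_le_sum fun x hx => ?_).trans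
      (Finset.sum_le_sum_of_subset_of_nonneg (Finset.subset_univ _) fun x _ _ => abs_nonneg _)
    exact Int.one_le_abs (by simpa using hx)
  simp only [Finset.sum_const, nsmul_eq_mul, mul_one] at h2
  exact_mod_cast h2.trans h1

open Classical in
/-- The vertices `x` outside the support of `f` for which `f - e_x` is a signed member of `w`. -/
noncomputable def tails (w : Fin n → Fin (r + 1) → ℤ) (f : Fin (r + 1) → ℤ) :
    Finset (Fin (r + 1)) :=
  Finset.univ.filter fun x => f x = 0 ∧ IsSigned w (f - Pi.single x 1)

theorem mem_tails {f : Fin (r + 1) → ℤ} {x : Fin (r + 1)} :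
    x ∈ tails w f ↔ f x = 0 ∧ IsSigned w (f - Pi.single x 1) := by
  simp [tails]

theorem sum_sub_single_of_notMem {f : Fin (r + 1) → ℤ} {x : Fin (r + 1)}
    {S : Finset (Fin (r + 1))} (hx : x ∉ S) :
    ∑ y ∈ S, (f - Pi.single x 1 : Fin (r + 1) → ℤ) y = ∑ y ∈ S, f y := by
  apply Finset.sum_congr rfl
  intro y hy
  have : y ≠ x := by rintro rfl; exact hx hy
  simp [this]

theorem card_support_le_of_tails (h : CliqueForm 1 w) (hE : ∀ x y, x ≠ y → IsUnitEdge 1 w x y)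
    {f : Fin (r + 1) → ℤ} {x : Fin (r + 1)} (hx : x ∈ tails w f) :
    (Finset.univ.filter fun y => f y ≠ 0).card ≤ 5 := by
  obtain ⟨h0, hs⟩ := mem_tails.1 hx
  have h1 := h.card_support_le hE hs
  have h2 : insert x (Finset.univ.filter fun y => f y ≠ 0) ⊆
      Finset.univ.filter fun y => (f - Pi.single x 1 : Fin (r + 1) → ℤ) y ≠ 0 := by
    intro y
    simp only [Finset.mem_insert, Finset.mem_filter, Finset.mem_univ, true_and]
    rintro (rfl | hy)
    · simp [h0]
    · have : y ≠ x := by rintro rfl; exact hy h0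
      simpa [this] using hy
  have h3 := Finset.card_le_card h2
  rw [Finset.card_insert_of_notMem (by simpa using h0)] at h3
  omega

theorem sum_pos_le_of_tails (h : CliqueForm 1 w) (hE : ∀ x y, x ≠ y → IsUnitEdge 1 w x y)
    {f : Fin (r + 1) → ℤ} {x : Fin (r + 1)} (hx : x ∈ tails w f) : ∑ y with 0 < f y, f y ≤ 3 := by
  obtain ⟨h0, hs⟩ := mem_tails.1 hx
  rw [← sum_sub_single_of_notMem (x := x) (by simp [h0])]
  exact (abs_le.1 (h.sum_le one_ne_zero hE hs _)).2

theorem minorsLe (h : CliqueForm 1 w) (hE : ∀ x y, x ≠ y → IsUnitEdge 1 w x y)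
    {u v : Fin (r + 1) → ℤ} (hu : IsSigned w u) (hv : IsSigned w v) : MinorsLe u v := by
  intro S T hST
  obtain ⟨z, hz, e⟩ := h.det_two one_ne_zero hE hu hv hST
  rwa [e, one_mul]

theorem exists_two_point (h : CliqueForm 1 w) (hE : ∀ x y, x ≠ y → IsUnitEdge 1 w x y)
    {f f' : Fin (r + 1) → ℤ} (hs : ∑ x, f x = 1) (hs' : ∑ x, f' x = 1)
    (hu : ∀ v, f ≠ Pi.single v 1) (hu' : ∀ v, f' ≠ Pi.single v 1) (hne : f ≠ f')
    (hX : 7 ≤ (tails w f).card) (hX' : 7 ≤ (tails w f').card) :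
    ∃ a c v v' k k', a ≠ c ∧ k ≠ 0 ∧ k' ≠ 0 ∧
      f = Pi.single v 1 + (k : ℤ) • (Pi.single a 1 - Pi.single c 1 : Fin (r + 1) → ℤ) ∧
      f' = Pi.single v' 1 + (k' : ℤ) • (Pi.single a 1 - Pi.single c 1 : Fin (r + 1) → ℤ) := by
  obtain ⟨x₀, hx₀⟩ := Finset.card_pos.1 (by omega : 0 < (tails w f).card)
  obtain ⟨x₀', hx₀'⟩ := Finset.card_pos.1 (by omega : 0 < (tails w f').card)
  have c1 := h.card_support_le_of_tails hE hx₀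
  have c2 := h.card_support_le_of_tails hE hx₀'
  obtain ⟨x, hx, hxf⟩ := Finset.exists_mem_notMem_of_card_lt_card (lt_of_le_of_lt c2
    (by omega : 5 < (tails w f).card))
  have c3 := Finset.card_insert_le x (Finset.univ.filter fun y => f y ≠ 0)
  obtain ⟨x', hz, hxf'⟩ := Finset.exists_mem_notMem_of_card_lt_card
    (by omega : (insert x (Finset.univ.filter fun y => f y ≠ 0)).card < (tails w f').card)
  simp only [Finset.mem_insert, Finset.mem_filter, Finset.mem_univ, true_and, not_or,
    not_not] at hxf hxf'
  exact ((h.minorsLe hE (mem_tails.1 hx).2 (mem_tails.1 hz).2).extend (Ne.symm hxf'.1)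
    (mem_tails.1 hx).1 hxf'.2 hxf (mem_tails.1 hz).1).two_point hs hs' hu hu' hne
    (h.sum_pos_le_of_tails hE hx) (h.sum_pos_le_of_tails hE hz)

/-- The vertex of a two-point head is in every heavy set avoiding the two points. -/
theorem mem_of_two_le_sum (h : CliqueForm 1 w) (hE : ∀ x y, x ≠ y → IsUnitEdge 1 w x y)
    {a c v : Fin (r + 1)} {k : ℤ} {f u : Fin (r + 1) → ℤ}
    (hf : f = Pi.single v 1 + k • (Pi.single a 1 - Pi.single c 1 : Fin (r + 1) → ℤ))
    (hs : ∑ x, f x = 1) (hn : ∀ v, f ≠ Pi.single v 1)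
    (hX : 7 ≤ (tails w f).card) (hu : IsSigned w u) {S : Finset (Fin (r + 1))}
    (haS : a ∉ S) (hcS : c ∉ S) (hS3 : S.card ≤ 6) (hS : 2 ≤ ∑ x ∈ S, u x) : v ∈ S := by
  by_contra hv
  have h0 : ∀ x ∈ S, f x = 0 := by
    intro x hx
    have h1 : x ≠ a := by rintro rfl; exact haS hx
    have h2 : x ≠ c := by rintro rfl; exact hcS hx
    have h3 : x ≠ v := by rintro rfl; exact hv hx
    simp [hf, h1, h2, h3]
  obtain ⟨x, hx, hxS⟩ := Finset.exists_mem_notMem_of_card_lt_card (lt_of_le_of_lt hS3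
    (by omega : 6 < (tails w f).card))
  have g := two_le_sum_pos hs hn
  have d : Disjoint S (Finset.univ.filter fun x => 0 < f x) := by
    rw [Finset.disjoint_left]
    intro y hy
    simp [h0 y hy]
  have := abs_le.1 (h.minorsLe hE hu (mem_tails.1 hx).2 _ _ d)
  rw [sum_sub_single_of_notMem hxS, sum_sub_single_of_notMem (by simp [(mem_tails.1 hx).1]),
    Finset.sum_eq_zero h0] at this
  nlinarith

theorem not_two_le_sum (h : CliqueForm 1 w) (hE : ∀ x y, x ≠ y → IsUnitEdge 1 w x y)
    {a c v v' : Fin (r + 1)} {k k' : ℤ} {f f' u : Fin (r + 1) → ℤ} (hac : a ≠ c)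
    (hk : k ≠ 0) (hk' : k' ≠ 0)
    (hf : f = Pi.single v 1 + k • (Pi.single a 1 - Pi.single c 1 : Fin (r + 1) → ℤ))
    (hf' : f' = Pi.single v' 1 + k' • (Pi.single a 1 - Pi.single c 1 : Fin (r + 1) → ℤ))
    (hn : ∀ v, f ≠ Pi.single v 1) (hn' : ∀ v, f' ≠ Pi.single v 1) (hne : f ≠ f')
    (hX : 7 ≤ (tails w f).card) (hX' : 7 ≤ (tails w f').card)
    (hu : IsSigned w u) {S : Finset (Fin (r + 1))}
    (haS : a ∉ S) (hcS : c ∉ S) (hSu : ∀ x ∈ S, u x ≠ 0) : ∑ x ∈ S, u x < 2 := by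
  by_contra! hS
  have c0 := h.card_support_le hE hu
  have c1 : S.card ≤ 6 := (Finset.card_le_card fun x hx => by simpa using hSu x hx).trans c0
  have s1 : ∀ (v : Fin (r + 1)) (k : ℤ), ∑ x, (Pi.single v 1 + k •
      (Pi.single a 1 - Pi.single c 1) : Fin (r + 1) → ℤ) x = 1 := by
    intro v k
    simp [Finset.sum_add_distrib, Finset.sum_sub_distrib, ← Finset.mul_sum]
  have hv := h.mem_of_two_le_sum hE hf (hf ▸ s1 v k) hn hX hu haS hcS c1 hS
  have hv' := h.mem_of_two_le_sum hE hf' (hf' ▸ s1 v' k') hn' hX' hu haS hcS c1 hS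
  have hva : v ≠ a := by rintro rfl; exact haS hv
  have hvc : v ≠ c := by rintro rfl; exact hcS hv
  have hva' : v' ≠ a := by rintro rfl; exact haS hv'
  have hvc' : v' ≠ c := by rintro rfl; exact hcS hv'
  have pick : ∀ (g : Fin (r + 1) → ℤ) (v z : Fin (r + 1)), g v ≠ 0 → v ∈ S →
      7 ≤ (tails w g).card → ∃ x ∈ tails w g, u x = 0 ∧ x ≠ z := by
    intro g v z hgv hvS hg
    have hsub : (tails w g).card ≤ (tails w g \ insert z
        ((Finset.univ.filter fun x => u x ≠ 0).erase v)).card + 6 := by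
      have e1 := Finset.card_insert_le z ((Finset.univ.filter fun x => u x ≠ 0).erase v)
      have e2 := Finset.card_erase_of_mem
        (show v ∈ Finset.univ.filter fun x => u x ≠ 0 by simpa using hSu v hvS)
      have e3 := Finset.le_card_sdiff (insert z
        ((Finset.univ.filter fun x => u x ≠ 0).erase v)) (tails w g)
      omega
    obtain ⟨x, hx⟩ := Finset.card_pos.1 (by omega : 0 < (tails w g \ insert z
        ((Finset.univ.filter fun x => u x ≠ 0).erase v)).card)
    simp only [Finset.mem_sdiff, Finset.mem_insert, Finset.mem_erase, Finset.mem_filter,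
      Finset.mem_univ, true_and, not_or, not_and, not_not] at hx
    refine ⟨x, hx.1, hx.2.2 ?_, hx.2.1⟩
    rintro rfl
    exact hgv (mem_tails.1 hx.1).1
  obtain ⟨x, hx, hux, -⟩ := pick f v v (by simp [hf, hva, hvc]) hv hX
  obtain ⟨x', hx', hux', hxx⟩ := pick f' v' x (by simp [hf', hva', hvc']) hv' hX'
  have hxS : x ∉ S := fun hc => hSu x hc hux
  have hxS' : x' ∉ S := fun hc => hSu x' hc hux'
  have hxv : x ≠ v := by rintro rfl; exact hxS hv
  have hxv' : x ≠ v' := by rintro rfl; exact hxS hv'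
  have hxv2 : x' ≠ v := by rintro rfl; exact hxS' hv
  have hxv2' : x' ≠ v' := by rintro rfl; exact hxS' hv'
  have hfx := (mem_tails.1 hx).1
  have hfx' := (mem_tails.1 hx').1
  have hxa : x ≠ a := by rintro rfl; simp [hf, hxv, hac, hk] at hfx
  have hxc : x ≠ c := by rintro rfl; simp [hf, hxv, hac.symm, hk] at hfx
  have hxa' : x' ≠ a := by rintro rfl; simp [hf', hxv2', hac, hk'] at hfx'
  have hxc' : x' ≠ c := by rintro rfl; simp [hf', hxv2', hac.symm, hk'] at hfx'
  have hfx2 : f x' = 0 := by simp [hf, hxv2, hxa', hxc']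
  have hfx2' : f' x = 0 := by simp [hf', hxv', hxa, hxc]
  have hfa : f a = k := by simp [hf, hva.symm, hac]
  have hfa' : f' a = k' := by simp [hf', hva'.symm, hac]
  have sing : ∀ (T : Finset (Fin (r + 1))) (p : Fin (r + 1)) (l : ℤ), a ∉ T → c ∉ T →
      ∑ x ∈ T, (Pi.single p 1 + l • (Pi.single a 1 - Pi.single c 1) : Fin (r + 1) → ℤ) x =
        if p ∈ T then 1 else 0 := by
    intro T p l ha hc
    simp [Finset.sum_add_distrib, Finset.sum_sub_distrib, ← Finset.mul_sum, ha, hc]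
  have hfS : ∑ y ∈ S, f y = 1 := by rw [hf, sing S v k haS hcS, if_pos hv]
  have hfS' : ∑ y ∈ S, f' y = 1 := by rw [hf', sing S v' k' haS hcS, if_pos hv']
  have gg : ∀ (x z : Fin (r + 1)) (f : Fin (r + 1) → ℤ),
      (f - Pi.single x 1 : Fin (r + 1) → ℤ) z = f z - if z = x then 1 else 0 := by
    intro x z f
    by_cases hz : z = x <;> simp [hz]
  have k1 : ∀ (g : Fin (r + 1) → ℤ) (y : Fin (r + 1)) (l : ℤ), y ∈ tails w g → u y = 0 → y ∉ S →
      y ≠ a → ∑ z ∈ S, g z = 1 → g a = l → l = 1 ∨ l = -1 ∨ l = 0 := by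
    intro g y l hy huy hyS hya hgS hga
    have d : Disjoint (insert y S) {a} := by
      simp [haS, hya.symm]
    have := abs_le.1 (h.minorsLe hE hu (mem_tails.1 hy).2 _ _ d)
    rw [Finset.sum_insert hyS, Finset.sum_insert hyS, sum_sub_single_of_notMem hyS, huy, gg,
      (mem_tails.1 hy).1, hgS, Finset.sum_singleton, Finset.sum_singleton, gg, hga] at this
    simp [hya.symm] at this
    by_contra! hl
    obtain hl | hl : 2 ≤ l ∨ l ≤ -2 := by omega
    · nlinarith
    · nlinarith
  have kk := k1 f x k hx hux hxS hxa hfS hfa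
  have kk' := k1 f' x' k' hx' hux' hxS' hxa' hfS' hfa'
  by_cases hkk : k = k'
  · have hvv : v ≠ v' := by
      rintro rfl
      exact hne (by rw [hf, hf', hkk])
    have hxE : x' ∉ S.erase v' := fun hc => hxS' (Finset.mem_of_mem_erase hc)
    have hxE' : x ∉ S.erase v' := fun hc => hxS (Finset.mem_of_mem_erase hc)
    have d1 : Disjoint (insert x' (S.erase v')) {v', x} := by
      simp [hxS, hxx.symm, hxv2'.symm]
    have d2 : Disjoint (insert x' (S.erase v')) {a} := by
      simp [haS, hxa'.symm]
    have d3 : Disjoint ({v', x} : Finset (Fin (r + 1))) {a} := by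
      simp [hva'.symm, hxa.symm]
    obtain ⟨z, hz, e⟩ := h.det_three one_ne_zero hE hu (mem_tails.1 hx).2 (mem_tails.1 hx').2
      d1 d2 d3
    have hus : ∑ y ∈ S.erase v', u y = ∑ y ∈ S, u y - u v' := by
      rw [← Finset.add_sum_erase _ _ hv']; ring
    have hfs : ∑ y ∈ S.erase v', f y = 1 := by
      rw [hf, sing _ v k (fun hc => haS (Finset.mem_of_mem_erase hc))
        (fun hc => hcS (Finset.mem_of_mem_erase hc)), if_pos (by simp [hvv, hv])]
    have hfs' : ∑ y ∈ S.erase v', f' y = 0 := by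
      rw [hf', sing _ v' k' (fun hc => haS (Finset.mem_of_mem_erase hc))
        (fun hc => hcS (Finset.mem_of_mem_erase hc)), if_neg (by simp)]
    have hfv : f v' = 0 := by simp [hf, hvv.symm, hva', hvc']
    have hfv' : f' v' = 1 := by simp [hf', hva', hvc']
    simp only [Finset.sum_insert hxE, Finset.sum_pair hxv'.symm, Finset.sum_singleton,
      sum_sub_single_of_notMem hxE, sum_sub_single_of_notMem hxE', hus, hfs, hfs'] at e
    simp only [gg, hfv, hfv', hux, hux', hfx, hfx', hfx2, hfx2', hfa, hfa', if_true, if_neg hxx, if_neg hxx.symm,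
      if_neg hxa.symm, if_neg hxa'.symm, if_neg hxv'.symm, if_neg hxv2'.symm] at e
    have e' : -(2 * k * ∑ y ∈ S, u y) = z := by
      subst hkk
      linear_combination e
    rw [abs_le] at hz
    rcases kk with rfl | rfl | rfl <;> omega
  · have d1 : Disjoint S {x, x'} := by
      simp [hxS, hxS']
    have d2 : Disjoint S {a} := by
      simp [haS]
    have d3 : Disjoint ({x, x'} : Finset (Fin (r + 1))) {a} := by
      simp [hxa'.symm, hxa.symm]
    obtain ⟨z, hz, e⟩ := h.det_three one_ne_zero hE hu (mem_tails.1 hx).2 (mem_tails.1 hx').2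
      d1 d2 d3
    simp only [Finset.sum_pair hxx.symm, Finset.sum_singleton,
      sum_sub_single_of_notMem hxS, sum_sub_single_of_notMem hxS', hfS, hfS'] at e
    simp only [gg, hux, hux', hfx, hfx', hfx2, hfx2', hfa, hfa', if_true, if_neg hxx, if_neg hxx.symm,
      if_neg hxa.symm, if_neg hxa'.symm] at e
    have e' : (k - k') * ∑ y ∈ S, u y = z := by
      linear_combination e
    rw [abs_le] at hz
    rcases kk with rfl | rfl | rfl <;> rcases kk' with rfl | rfl | rfl <;> omega

theorem card_le_of_two_heads (h : CliqueForm 1 w) (hr : 2 ≤ r)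
    (hE : ∀ x y, x ≠ y → IsUnitEdge 1 w x y)
    {f f' : Fin (r + 1) → ℤ} (hs : ∑ x, f x = 1) (hs' : ∑ x, f' x = 1)
    (hu : ∀ v, f ≠ Pi.single v 1) (hu' : ∀ v, f' ≠ Pi.single v 1) (hne : f ≠ f')
    (hX : 7 ≤ (tails w f).card) (hX' : 7 ≤ (tails w f').card) :
    n ≤ (r + 1).choose 2 + 2 * (r - 1) := by
  obtain ⟨a, c, v, v', k, k', hac, hk, hk', hf, hf'⟩ :=
    h.exists_two_point hE hs hs' hu hu' hne hX hX'
  have key : ∀ u, IsSigned w u → ∀ S : Finset (Fin (r + 1)), a ∉ S → c ∉ S →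
      ∑ x ∈ S, u x ≤ 1 := by
    intro u hsu S ha hc
    have h1 : ∑ x ∈ S, u x ≤ ∑ x ∈ S with 0 < u x, u x := by
      rw [← Finset.sum_filter_add_sum_filter_not S (fun x => 0 < u x) u]
      have : ∑ x ∈ S with ¬ 0 < u x, u x ≤ 0 := Finset.sum_nonpos fun x hx => by
        simpa using (Finset.mem_filter.1 hx).2
      omega
    have h2 := h.not_two_le_sum hE hac hk hk' hf hf' hu hu' hne hX hX' hsu
      (S := S.filter fun x => 0 < u x) (by simp [ha]) (by simp [hc]) (fun x hx => by
        have := (Finset.mem_filter.1 hx).2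
        omega)
    omega
  refine h.card_le_of_gain one_pos hr hac (fun j x _ _ => one_dvd _) fun j S ha hc => ?_
  have h1 := key _ (isSigned_self w j) S ha hc
  have h2 := key _ (isSigned_self w j).neg S ha hc
  simp only [Pi.neg_apply, Finset.sum_neg_distrib] at h2
  rw [abs_le]
  omega

end CliqueForm

section IntFns

variable {V : Type*} [DecidableEq V]

/-- Differences of two nonnegative functions supported on `U`, with sums `k` and `l`. -/
noncomputable def intFns (U : Finset V) (k l : ℕ) : Finset (V → ℤ) :=
  open Classical in
  (Finset.finsuppAntidiag U k ×ˢ Finset.finsuppAntidiag U l).image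
    fun p x => (p.1 x : ℤ) - p.2 x

theorem card_intFns_le (U : Finset V) (k l : ℕ) :
    (intFns U k l).card ≤ U.card.multichoose k * U.card.multichoose l := by
  classical
  refine Finset.card_image_le.trans ?_
  rw [Finset.card_product, Finset.card_finsuppAntidiag_nat_eq_multichoose,
    Finset.card_finsuppAntidiag_nat_eq_multichoose]

theorem mem_intFns_iff {U : Finset V} {k l : ℕ} {f : V → ℤ} : f ∈ intFns U k l ↔
    ∃ p ∈ Finset.finsuppAntidiag U k ×ˢ Finset.finsuppAntidiag U l,
      (fun x => (p.1 x : ℤ) - p.2 x) = f := by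
  classical
  exact Finset.mem_image

theorem mem_intFns [Fintype V] {U : Finset V} {k l : ℕ} {f : V → ℤ} (hU : ∀ x, x ∉ U → f x = 0)
    (hk : ∑ x with 0 < f x, f x = k) (hl : ∑ x, f x = k - l) : f ∈ intFns U k l := by
  classical
  have aux : ∀ (g : V → ℤ) (m : ℕ), (∀ x, x ∉ U → g x = 0) → ∑ x with 0 < g x, g x = m →
      ∑ x ∈ U, (g x).toNat = m := by
    intro g m hg hm
    have e : ∑ x ∈ U, (((g x).toNat : ℕ) : ℤ) = ∑ x with 0 < g x, g x := by
      rw [Finset.sum_filter, ← Finset.sum_subset (Finset.subset_univ U)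
        (f := fun x => if 0 < g x then g x else 0)]
      · apply Finset.sum_congr rfl
        intro x _
        split_ifs <;> omega
      · intro x _ hx
        simp [hg x hx]
    rw [hm] at e
    exact_mod_cast e
  have hn : ∑ x with 0 < (-f) x, (-f) x = l := by
    have h1 := sum_pos_add_sum_neg f
    have h2 : ∑ x with 0 < (-f) x, (-f) x = -∑ x with f x < 0, f x := by
      rw [← Finset.sum_neg_distrib]
      apply Finset.sum_congr _ fun _ _ => rfl
      ext x; simp
    omega
  have h1 := aux f k hU hk
  have h2 := aux (-f) l (fun x hx => by simp [hU x hx]) hn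
  have g1 : ∀ x, (f x).toNat ≠ 0 → x ∈ U := fun x hx => by
    by_contra hc
    exact hx (by simp [hU x hc])
  have g2 : ∀ x, ((-f) x).toNat ≠ 0 → x ∈ U := fun x hx => by
    by_contra hc
    exact hx (by simp [hU x hc])
  refine mem_intFns_iff.2 ⟨(Finsupp.onFinset U (fun x => (f x).toNat) g1,
    Finsupp.onFinset U (fun x => ((-f) x).toNat) g2), ?_, ?_⟩
  · rw [Finset.mem_product, Finset.mem_finsuppAntidiag, Finset.mem_finsuppAntidiag]
    exact ⟨⟨h1, Finsupp.support_onFinset_subset (hf := g1)⟩,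
      ⟨h2, Finsupp.support_onFinset_subset (hf := g2)⟩⟩
  · ext x
    simp only [Finsupp.onFinset_apply, Pi.neg_apply]
    omega

theorem exists_cover {V : Type*} [DecidableEq V] (R : V → V → Prop)
    (hR : ∀ x₁ y₁ x₂ y₂ x₃ y₃, R x₁ y₁ → R x₂ y₂ → R x₃ y₃ → x₂ ∉ ({x₁, y₁} : Finset V) →
      y₂ ∉ ({x₁, y₁} : Finset V) → x₃ ∉ ({x₁, y₁, x₂, y₂} : Finset V) →
      y₃ ∉ ({x₁, y₁, x₂, y₂} : Finset V) → False) :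
    ∃ Y : Finset V, Y.card ≤ 4 ∧ ∀ x y, R x y → x ∈ Y ∨ y ∈ Y := by
  by_cases h1 : ∃ x₁ y₁, R x₁ y₁
  · obtain ⟨x₁, y₁, h1⟩ := h1
    by_cases h2 : ∃ x₂ y₂, R x₂ y₂ ∧ x₂ ∉ ({x₁, y₁} : Finset V) ∧ y₂ ∉ ({x₁, y₁} : Finset V)
    · obtain ⟨x₂, y₂, h2, hx₂, hy₂⟩ := h2
      refine ⟨{x₁, y₁, x₂, y₂}, Finset.card_le_four, fun x y h3 => ?_⟩
      by_contra! hc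
      exact hR _ _ _ _ _ _ h1 h2 h3 hx₂ hy₂ hc.1 hc.2
    · refine ⟨{x₁, y₁}, Finset.card_le_two.trans (by norm_num), fun x y h => ?_⟩
      by_contra! hc
      exact h2 ⟨x, y, h, hc.1, hc.2⟩
  · exact ⟨∅, by simp, fun x y h => (h1 ⟨x, y, h⟩).elim⟩

end IntFns

namespace CliqueForm

variable {n r : ℕ} {w : Fin n → Fin (r + 1) → ℤ}

theorem two_le_sum_pos_of_mem_nonEdges (h : CliqueForm 1 w) (hr : 1 ≤ r) {j : Fin n}
    (hj : j ∈ nonEdges 1 w) : 2 ≤ ∑ x with 0 < w j x, w j x := by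
  have h0 := h.ne_zero hr j
  have hs := h.sum_zero j
  obtain ⟨y, hy⟩ : ∃ y, w j y < 0 := by
    by_contra! hc
    rw [Finset.sum_eq_zero_iff_of_nonneg fun x _ => hc x] at hs
    exact h0 (funext fun x => hs x (Finset.mem_univ x))
  have h1 := two_le_sum_pos (h := w j + Pi.single y 1) (by simp [Finset.sum_add_distrib, hs])
    (fun v hv => hj v y (by rw [one_smul, ← hv]; simp))
  refine h1.trans_eq ?_
  have e : ∀ x, x ≠ y → (w j + Pi.single y 1 : Fin (r + 1) → ℤ) x = w j x := fun x hx => by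
    simp [hx]
  have e' : (w j + Pi.single y 1 : Fin (r + 1) → ℤ) y = w j y + 1 := by simp
  refine Finset.sum_congr ?_ ?_
  · ext x
    simp only [Finset.mem_filter, Finset.mem_univ, true_and]
    by_cases hx : x = y
    · subst hx; rw [e']; omega
    · rw [e x hx]
  · intro x hx
    refine e x ?_
    rintro rfl
    simp only [Finset.mem_filter, Finset.mem_univ, true_and] at hx
    omega

theorem sum_add_single_sub_single (f : Fin (r + 1) → ℤ) (x y : Fin (r + 1))
    (S : Finset (Fin (r + 1))) :
    ∑ z ∈ S, (f + Pi.single x 1 - Pi.single y 1 : Fin (r + 1) → ℤ) z =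
      (∑ z ∈ S, f z) + (if x ∈ S then 1 else 0) - (if y ∈ S then 1 else 0) := by
  simp [Finset.sum_add_distrib, Finset.sum_sub_distrib]

theorem exists_cover_arcs (h : CliqueForm 1 w) (hE : ∀ x y, x ≠ y → IsUnitEdge 1 w x y)
    {f : Fin (r + 1) → ℤ} (hs : ∑ x, f x = 0) (h0 : f ≠ 0) :
    ∃ Y : Finset (Fin (r + 1)), Y.card ≤ 4 ∧ ∀ x y, x ≠ y → f x = 0 → f y = 0 →
      IsSigned w (f + Pi.single x 1 - Pi.single y 1) → x ∈ Y ∨ y ∈ Y := by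
  obtain ⟨Y, hY, hY'⟩ := exists_cover (fun x y => x ≠ y ∧ f x = 0 ∧ f y = 0 ∧
      IsSigned w (f + Pi.single x 1 - Pi.single y 1)) (by
    rintro x₁ y₁ x₂ y₂ x₃ y₃ ⟨n1, fx1, fy1, s1⟩ ⟨n2, fx2, fy2, s2⟩ ⟨n3, fx3, fy3, s3⟩ m1 m2 m3 m4
    simp only [Finset.mem_insert, Finset.mem_singleton, not_or] at m1 m2 m3 m4
    obtain ⟨m11, m12⟩ := m1
    obtain ⟨m21, m22⟩ := m2
    obtain ⟨m31, m32, m33, m34⟩ := m3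
    obtain ⟨m41, m42, m43, m44⟩ := m4
    have hpos : 1 ≤ ∑ x with 0 < f x, f x := by
      obtain ⟨v, hv⟩ : ∃ v, 0 < f v := by
        by_contra! hc
        rw [Finset.sum_eq_zero_iff_of_nonpos fun x _ => hc x] at hs
        exact h0 (funext fun x => hs x (Finset.mem_univ x))
      have := Finset.single_le_sum (f := f) (s := Finset.univ.filter fun x => 0 < f x)
        (fun x hx => by have := (Finset.mem_filter.1 hx).2; omega) (a := v) (by simpa using hv)
      omega
    obtain ⟨P, hPd⟩ : ∃ P, P = Finset.univ.filter fun x => 0 < f x := ⟨_, rfl⟩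
    have hP : ∀ x, f x = 0 → x ∉ P := by
      intro x hx; simp [hPd, hx]
    rw [← hPd] at hpos
    have p1 := hP _ fx1
    have p2 := hP _ fx2
    have p3 := hP _ fx3
    have q1 := hP _ fy1
    have q2 := hP _ fy2
    have q3 := hP _ fy3
    obtain ⟨z, hz, e⟩ := h.det_three one_ne_zero hE s1 s2 s3
      (S := insert x₁ P) (T := {y₁, x₂}) (R := {y₂, x₃})
      (by simp [p2, q1, Ne.symm n1, m11])
      (by simp [p3, q2, m21, m31])
      (by simp [m22, Ne.symm n2, m32, m33])
    have g1 : ∑ x ∈ insert x₁ P, f x = ∑ x ∈ P, f x := by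
      rw [Finset.sum_insert p1, fx1, zero_add]
    have g2 : ∑ x ∈ ({y₁, x₂} : Finset _), f x = 0 := by
      rw [Finset.sum_pair (Ne.symm m12), fy1, fx2, zero_add]
    have g3 : ∑ x ∈ ({y₂, x₃} : Finset _), f x = 0 := by
      rw [Finset.sum_pair (Ne.symm m34), fy2, fx3, zero_add]
    simp only [sum_add_single_sub_single, g1, g2, g3, Finset.mem_insert, Finset.mem_singleton, p1,
      p2, p3, q1, q2, q3, n1, n2, m11, m12, m21, m22, m31, m32, m33, m34, m41, m42, m43, m44,
      Ne.symm n1, Ne.symm n2, Ne.symm n3, Ne.symm m11, Ne.symm m12, Ne.symm m21, Ne.symm m22,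
      Ne.symm m31, Ne.symm m32, Ne.symm m33, Ne.symm m34, or_false, or_true,
      if_true, if_false] at e
    rw [abs_le] at hz
    linarith)
  exact ⟨Y, hY, fun x y hxy hx hy hs => hY' x y ⟨hxy, hx, hy, hs⟩⟩

/-- If every head in `F`, except possibly one, has few tails, then the members of `w` which lie in
`G` or have a head in `F` are few. -/
theorem card_filter_le (h : CliqueForm 1 w) (G F : Finset (Fin (r + 1) → ℤ)) (N : Finset (Fin n))
    (hF : ∀ f ∈ F, ∀ f' ∈ F, f ≠ f' → 7 ≤ (tails w f).card → (tails w f').card ≤ 6)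
    (hN : ∀ j ∈ N, w j ∈ G ∨ ∃ f ∈ F, ∃ x ∈ tails w f,
      w j = f - Pi.single x 1 ∨ w j = -(f - Pi.single x 1)) :
    N.card ≤ G.card + (6 * F.card + (r + 1)) := by
  classical
  have hsub : N ⊆ (N.filter fun j => w j ∈ G) ∪ F.biUnion fun f => (tails w f).biUnion fun x =>
      N.filter fun j => w j = f - Pi.single x 1 ∨ w j = -(f - Pi.single x 1) := by
    intro j hj
    rcases hN j hj with h1 | ⟨f, hf, x, hx, h1⟩
    · exact Finset.mem_union_left _ (Finset.mem_filter.2 ⟨hj, h1⟩)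
    · exact Finset.mem_union_right _ (Finset.mem_biUnion.2 ⟨f, hf, Finset.mem_biUnion.2
        ⟨x, hx, Finset.mem_filter.2 ⟨hj, h1⟩⟩⟩)
  have hG : (N.filter fun j => w j ∈ G).card ≤ G.card := by
    apply Finset.card_le_card_of_injOn w
    · intro j hj
      exact (Finset.mem_filter.1 hj).2
    · intro j _ j' _ hjj
      exact h.eq_of_signed (Or.inl rfl) (Or.inl hjj)
  have hone : ∀ (f : Fin (r + 1) → ℤ) (x : Fin (r + 1)), (N.filter fun j =>
      w j = f - Pi.single x 1 ∨ w j = -(f - Pi.single x 1)).card ≤ 1 := by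
    intro f x
    rw [Finset.card_le_one]
    intro j hj j' hj'
    have h1 := (Finset.mem_filter.1 hj).2
    have h2 := (Finset.mem_filter.1 hj').2
    refine h.eq_of_signed (u := f - Pi.single x 1) ?_ ?_
    · exact h1.imp Eq.symm fun e => by rw [e, neg_neg]
    · exact h2.imp Eq.symm fun e => by rw [e, neg_neg]
  have hb : (F.biUnion fun f => (tails w f).biUnion fun x => N.filter fun j =>
      w j = f - Pi.single x 1 ∨ w j = -(f - Pi.single x 1)).card ≤ ∑ f ∈ F, (tails w f).card := by
    refine Finset.card_biUnion_le.trans (Finset.sum_le_sum fun f _ => ?_)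
    exact (Finset.card_biUnion_le_card_mul _ _ 1 fun x _ => hone f x).trans_eq (mul_one _)
  have hsum : ∑ f ∈ F, (tails w f).card ≤ 6 * F.card + (r + 1) := by
    by_cases hex : ∃ f₀ ∈ F, 7 ≤ (tails w f₀).card
    · obtain ⟨f₀, hf₀, h7⟩ := hex
      rw [← Finset.add_sum_erase _ _ hf₀]
      have h1 : ∑ f ∈ F.erase f₀, (tails w f).card ≤ (F.erase f₀).card * 6 :=
        Finset.sum_le_card_nsmul _ _ _ fun f hf =>
          hF f₀ hf₀ f (Finset.mem_of_mem_erase hf) (Finset.ne_of_mem_erase hf).symm h7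
      have h2 := Finset.card_erase_le (s := F) (a := f₀)
      have h3 := Finset.card_le_univ (tails w f₀)
      rw [Fintype.card_fin] at h3
      omega
    · push Not at hex
      have h1 : ∑ f ∈ F, (tails w f).card ≤ F.card * 6 :=
        Finset.sum_le_card_nsmul _ _ _ fun f hf => by have := hex f hf; omega
      omega
  have h1 := (Finset.card_le_card hsub).trans (Finset.card_union_le _ _)
  omega

end CliqueForm

theorem multichoose_bounds {c : ℕ} (hc : c ≤ 6) :
    c.multichoose 1 ≤ 6 ∧ c.multichoose 2 ≤ 21 ∧ c.multichoose 3 ≤ 56 := by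
  interval_cases c <;> simp [Nat.multichoose]

namespace CliqueForm

variable {n r : ℕ} {w : Fin n → Fin (r + 1) → ℤ}

/-- A head of a column which is not a clique edge is not a single vertex. -/
theorem head_ne_single {j : Fin n} (hj : j ∈ nonEdges 1 w) {f : Fin (r + 1) → ℤ} {x : Fin (r + 1)}
    (hf : w j = f - Pi.single x 1 ∨ w j = -(f - Pi.single x 1)) (v : Fin (r + 1)) :
    f ≠ Pi.single v 1 := by
  rintro rfl
  rcases hf with hf | hf
  · exact hj v x (by rw [hf, one_smul])
  · exact hj x v (by rw [hf, one_smul, neg_sub])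

theorem isSigned_head {j : Fin n} {f : Fin (r + 1) → ℤ} {x : Fin (r + 1)}
    (hf : w j = f - Pi.single x 1 ∨ w j = -(f - Pi.single x 1)) :
    IsSigned w (f - Pi.single x 1) :=
  ⟨j, hf.imp Eq.symm fun e => by rw [e, neg_neg]⟩

theorem sum_head (h : CliqueForm 1 w) {j : Fin n} {f : Fin (r + 1) → ℤ} {x : Fin (r + 1)}
    (hf : w j = f - Pi.single x 1 ∨ w j = -(f - Pi.single x 1)) : ∑ y, f y = 1 := by
  have := h.sum_signed (isSigned_head hf)
  simp only [Pi.sub_apply, Finset.sum_sub_distrib, Finset.sum_pi_single', Finset.mem_univ,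
    if_true] at this
  omega

theorem card_le_of_one (h : CliqueForm 1 w) (hr : 34288 ≤ r) :
    n ≤ (r + 1).choose 2 + 2 * (r - 1) := by
  classical
  have hE : ∀ x y, x ≠ y → IsUnitEdge 1 w x y := fun x y hxy =>
    h.isUnitEdge_of_dvd one_pos hxy (Or.inl fun j => one_dvd _)
  by_contra hn
  have hcard := h.card_le_nonEdges (by omega)
  obtain ⟨j₀, hj₀⟩ : ∃ j, j ∈ nonEdges 1 w := by
    by_contra! hc
    simp [hc] at hcard
    omega
  obtain ⟨U, hUd⟩ : ∃ U, U = Finset.univ.filter fun x => w j₀ x ≠ 0 := ⟨_, rfl⟩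
  have hU6 : U.card ≤ 6 := hUd ▸ h.card_support_le hE (isSigned_self w j₀)
  have htri : ∀ j, (∀ x ∈ Uᶜ, w j x = 0) ∨
      (∃ x ∈ Uᶜ, ∃ ε : ℤ, (ε = 1 ∨ ε = -1) ∧ ∀ z ∈ Uᶜ, w j z = ε * (if z = x then 1 else 0)) ∨
      ∃ x ∈ Uᶜ, ∃ y ∈ Uᶜ, x ≠ y ∧
        ∀ z ∈ Uᶜ, w j z = (if z = x then 1 else 0) - (if z = y then 1 else 0) := by
    intro j
    refine subset_sums_le_one _ _ fun S hS => ?_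
    have h0 : ∀ x ∈ S, w j₀ x = 0 := fun x hx => by
      have := hS hx
      simpa [hUd] using this
    have hd : Disjoint (Finset.univ.filter fun x => 0 < w j₀ x) S := by
      rw [Finset.disjoint_left]
      intro x hx hxS
      have := h0 x hxS
      simp [this] at hx
    have h1 := h.minorsLe hE (isSigned_self w j₀) (isSigned_self w j) _ _ hd
    rw [Finset.sum_eq_zero h0, zero_mul, sub_zero] at h1
    have h2 := h.two_le_sum_pos_of_mem_nonEdges (by omega) hj₀
    rw [abs_le] at h1 ⊢
    constructor <;> nlinarith
  have hY : ∀ f : Fin (r + 1) → ℤ, ∃ Y : Finset (Fin (r + 1)), Y.card ≤ 4 ∧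
      (∑ x, f x = 0 → f ≠ 0 → ∀ x y, x ≠ y → f x = 0 → f y = 0 →
        IsSigned w (f + Pi.single x 1 - Pi.single y 1) → x ∈ Y ∨ y ∈ Y) := by
    intro f
    by_cases hf : ∑ x, f x = 0 ∧ f ≠ 0
    · obtain ⟨Y, hY, hY'⟩ := h.exists_cover_arcs hE hf.1 hf.2
      exact ⟨Y, hY, fun _ _ => hY'⟩
    · exact ⟨∅, by simp, fun h1 h2 => (hf ⟨h1, h2⟩).elim⟩
  choose Y hY4 hYc using hY
  obtain ⟨H, hH⟩ : ∃ H, H = intFns U 1 1 ∪ intFns U 2 2 := ⟨_, rfl⟩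
  obtain ⟨G, hG⟩ : ∃ G, G = intFns U 2 2 ∪ intFns U 3 3 := ⟨_, rfl⟩
  obtain ⟨F₁, hF₁⟩ : ∃ F₁, F₁ = intFns U 2 1 ∪ intFns U 3 2 := ⟨_, rfl⟩
  obtain ⟨F₂, hF₂⟩ : ∃ F₂ : Finset (Fin (r + 1) → ℤ), F₂ = H.biUnion fun f =>
    (Y f).image (fun z => f + Pi.single z 1) ∪ (Y f).image (fun z => -f + Pi.single z 1) :=
    ⟨_, rfl⟩
  obtain ⟨F, hF⟩ : ∃ F : Finset (Fin (r + 1) → ℤ), F = (F₁ ∪ F₂).filter fun f =>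
    ∑ x, f x = 1 ∧ ∀ v, f ≠ Pi.single v 1 := ⟨_, rfl⟩
  have hc : ∀ k l, (intFns U k l).card ≤ U.card.multichoose k * U.card.multichoose l :=
    card_intFns_le U
  obtain ⟨m1, m2, m3⟩ := multichoose_bounds hU6
  have c11 := (hc 1 1).trans (Nat.mul_le_mul m1 m1)
  have c22 := (hc 2 2).trans (Nat.mul_le_mul m2 m2)
  have c33 := (hc 3 3).trans (Nat.mul_le_mul m3 m3)
  have c21 := (hc 2 1).trans (Nat.mul_le_mul m2 m1)
  have c32 := (hc 3 2).trans (Nat.mul_le_mul m3 m2)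
  have cH : H.card ≤ 477 := by
    rw [hH]; exact (Finset.card_union_le _ _).trans (by omega)
  have cG : G.card ≤ 3577 := by
    rw [hG]; exact (Finset.card_union_le _ _).trans (by omega)
  have cF₁ : F₁.card ≤ 1302 := by
    rw [hF₁]; exact (Finset.card_union_le _ _).trans (by omega)
  have cF₂ : F₂.card ≤ 3816 := by
    rw [hF₂]
    refine (Finset.card_biUnion_le_card_mul _ _ 8 fun f _ => ?_).trans (by omega)
    refine (Finset.card_union_le _ _).trans ?_
    have h1 := Finset.card_image_le (s := Y f) (f := fun z => f + Pi.single z 1)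
    have h2 := Finset.card_image_le (s := Y f) (f := fun z => -f + Pi.single z 1)
    have h3 := hY4 f
    omega
  have cF : F.card ≤ 5118 := by
    rw [hF]
    exact (Finset.card_filter_le _ _).trans ((Finset.card_union_le _ _).trans (by omega))
  have hmain := h.card_filter_le G F (Finset.univ.filter fun j => j ∈ nonEdges 1 w) ?_ ?_
  · omega
  · intro f hf f' hf' hne h7
    rw [hF] at hf hf'
    have hf := (Finset.mem_filter.1 hf).2
    have hf' := (Finset.mem_filter.1 hf').2
    by_contra hlt
    exact hn (h.card_le_of_two_heads (by omega) hE hf.1 hf'.1 hf.2 hf'.2 hne h7 (by omega))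
  · intro j hj
    have hj : j ∈ nonEdges 1 w := (Finset.mem_filter.1 hj).2
    have hcompl : ∀ {x}, x ∉ U → x ∈ Uᶜ := fun hx => Finset.mem_compl.2 hx
    have key : ∀ (f : Fin (r + 1) → ℤ) (x : Fin (r + 1)), f ∈ F₁ ∪ F₂ → f x = 0 →
        (w j = f - Pi.single x 1 ∨ w j = -(f - Pi.single x 1)) → w j ∈ G ∨ ∃ f ∈ F,
          ∃ x ∈ tails w f, w j = f - Pi.single x 1 ∨ w j = -(f - Pi.single x 1) := by
      intro f x hf hx hfx
      refine Or.inr ⟨f, ?_, x, mem_tails.2 ⟨hx, isSigned_head hfx⟩, hfx⟩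
      rw [hF]
      exact Finset.mem_filter.2 ⟨hf, h.sum_head hfx, head_ne_single hj hfx⟩
    rcases htri j with h0 | ⟨x, hx, ε, hε, hz⟩ | ⟨x, hx, y, hy, hxy, hz⟩
    · left
      have h1 := h.two_le_sum_pos_of_mem_nonEdges (by omega) hj
      have h2 := (abs_le.1 (h.sum_le one_ne_zero hE (isSigned_self w j)
        (Finset.univ.filter fun x => 0 < w j x))).2
      rw [hG, Finset.mem_union]
      rcases (by omega : ∑ x with 0 < w j x, w j x = (2 : ℕ) ∨
        ∑ x with 0 < w j x, w j x = (3 : ℕ)) with h3 | h3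
      · exact Or.inl (mem_intFns (fun x hx => h0 x (hcompl hx)) h3 (by rw [h.sum_zero]; simp))
      · exact Or.inr (mem_intFns (fun x hx => h0 x (hcompl hx)) h3 (by rw [h.sum_zero]; simp))
    · have hfx : w j = (-ε • w j + Pi.single x 1) - Pi.single x 1 ∨
          w j = -((-ε • w j + Pi.single x 1) - Pi.single x 1) := by
        rcases hε with rfl | rfl
        · right; simp
        · left; simp
      obtain ⟨f, hf⟩ : ∃ f, f = -ε • w j + Pi.single x 1 := ⟨_, rfl⟩
      rw [← hf] at hfx
      have hf0 : ∀ z, z ∉ U → f z = 0 := by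
        intro z hzU
        have := hz z (hcompl hzU)
        rw [hf]
        by_cases hzx : z = x
        · subst hzx
          rcases hε with rfl | rfl <;> simp [this]
        · simp [this, hzx]
      have hx0 := hf0 x (Finset.mem_compl.1 hx)
      refine key f x ?_ hx0 hfx
      have h1 := two_le_sum_pos (h.sum_head hfx) (head_ne_single hj hfx)
      have h2 := h.sum_pos_le_of_tails hE (mem_tails.2 ⟨hx0, isSigned_head hfx⟩)
      rw [Finset.mem_union, hF₁, Finset.mem_union]
      left
      rcases (by omega : ∑ x with 0 < f x, f x = (2 : ℕ) ∨
        ∑ x with 0 < f x, f x = (3 : ℕ)) with h3 | h3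
      · exact Or.inl (mem_intFns hf0 h3 (by rw [h.sum_head hfx]; simp))
      · exact Or.inr (mem_intFns hf0 h3 (by rw [h.sum_head hfx]; simp))
    · obtain ⟨f, hf⟩ : ∃ f, f = w j - Pi.single x 1 + Pi.single y 1 := ⟨_, rfl⟩
      have hw : w j = f + Pi.single x 1 - Pi.single y 1 := by rw [hf]; abel
      have hf0 : ∀ z, z ∉ U → f z = 0 := by
        intro z hzU
        have := hz z (hcompl hzU)
        rw [hf]
        simp only [Pi.add_apply, Pi.sub_apply, Pi.single_apply, this]
        ring
      have hs : ∑ z, f z = 0 := by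
        rw [hf]
        simp [Finset.sum_add_distrib, Finset.sum_sub_distrib, h.sum_zero]
      have hne : f ≠ 0 := by
        rintro h0
        exact hj x y (by rw [hw, h0, one_smul, zero_add])
      have fx := hf0 x (Finset.mem_compl.1 hx)
      have fy := hf0 y (Finset.mem_compl.1 hy)
      have hfH : f ∈ H := by
        have h1 : 1 ≤ ∑ x with 0 < f x, f x := by
          obtain ⟨v, hv⟩ : ∃ v, 0 < f v := by
            by_contra! hc
            rw [Finset.sum_eq_zero_iff_of_nonpos fun x _ => hc x] at hs
            exact hne (funext fun x => hs x (Finset.mem_univ x))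
          have := Finset.single_le_sum (f := f) (s := Finset.univ.filter fun x => 0 < f x)
            (fun x hx => by have := (Finset.mem_filter.1 hx).2; omega) (a := v) (by simpa using hv)
          omega
        have h2 := (abs_le.1 (h.sum_le one_ne_zero hE (isSigned_self w j)
          (insert x (Finset.univ.filter fun x => 0 < f x)))).2
        rw [hw, sum_add_single_sub_single, Finset.sum_insert (by simp [fx]), fx] at h2
        simp only [Finset.mem_insert_self, if_true, Finset.mem_insert, Ne.symm hxy, false_or,
          Finset.mem_filter, Finset.mem_univ, true_and, fy, lt_irrefl, if_false] at h2
        rw [hH, Finset.mem_union]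
        rcases (by omega : ∑ x with 0 < f x, f x = (1 : ℕ) ∨
          ∑ x with 0 < f x, f x = (2 : ℕ)) with h3 | h3
        · exact Or.inl (mem_intFns hf0 h3 (by rw [hs]; simp))
        · exact Or.inr (mem_intFns hf0 h3 (by rw [hs]; simp))
      rcases hYc f hs hne x y hxy fx fy (hw ▸ isSigned_self w j) with hxY | hyY
      · refine key (f + Pi.single x 1) y ?_ ?_ (Or.inl hw)
        · rw [Finset.mem_union, hF₂]
          exact Or.inr (Finset.mem_biUnion.2 ⟨f, hfH, Finset.mem_union_left _
            (Finset.mem_image.2 ⟨x, hxY, rfl⟩)⟩)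
        · simp [fy, Ne.symm hxy]
      · refine key (-f + Pi.single y 1) x ?_ ?_ (Or.inr ?_)
        · rw [Finset.mem_union, hF₂]
          exact Or.inr (Finset.mem_biUnion.2 ⟨f, hfH, Finset.mem_union_right _
            (Finset.mem_image.2 ⟨y, hyY, rfl⟩)⟩)
        · simp [fx, hxy]
        · rw [hw]; abel

end CliqueForm

section VertexMatrix

variable {r : ℕ}

/-- The matrix whose columns are the points `b x`, with a coordinate `1` put on top. -/
def vertexMatrix (b : Fin (r + 1) → Fin r → ℚ) : Matrix (Fin (r + 1)) (Fin (r + 1)) ℚ :=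
  Matrix.of fun i x => (Fin.cons 1 (b x) : Fin (r + 1) → ℚ) i

@[simp]
theorem vertexMatrix_zero (b : Fin (r + 1) → Fin r → ℚ) (x : Fin (r + 1)) :
    vertexMatrix b 0 x = 1 := rfl

@[simp]
theorem vertexMatrix_succ (b : Fin (r + 1) → Fin r → ℚ) (i : Fin r) (x : Fin (r + 1)) :
    vertexMatrix b i.succ x = b x i := rfl

theorem abs_det_vertexMatrix_mul (b : Fin (r + 1) → Fin r → ℚ)
    (X : Matrix (Fin (r + 1)) (Fin (r + 1)) ℚ) (v : Fin (r + 1)) (hv : ∑ y, X y v = 1)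
    (hX : ∀ x, x ≠ v → ∑ y, X y x = 0) :
    |(vertexMatrix b).det * X.det| =
      |(Matrix.of fun i l => ∑ y, X y (v.succAbove l) * b y i).det| := by
  have h0 : ∀ x, (vertexMatrix b * X) 0 x = if x = v then 1 else 0 := by
    intro x
    rw [Matrix.mul_apply]
    simp only [vertexMatrix_zero, one_mul]
    split_ifs with h
    · rw [h, hv]
    · exact hX x h
  rw [← Matrix.det_mul, Matrix.det_succ_row_zero, Finset.sum_eq_single v]
  · rw [h0, if_pos rfl, mul_one, abs_mul, abs_pow, abs_neg, abs_one, one_pow, one_mul]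
    congr 2
    ext i l
    rw [Matrix.submatrix_apply, Matrix.mul_apply]
    simp [mul_comm]
  · intro x _ hx
    rw [h0, if_neg hx, mul_zero, zero_mul]
  · simp

theorem abs_det_vertexMatrix_mul_forest (b : Fin (r + 1) → Fin r → ℚ) {k : ℕ}
    (u : Fin k → Fin (r + 1) → ℚ) (hu : ∀ l, ∑ x, u l x = 0) (ρ : Fin (r + 1) → Option (Fin k))
    (rep : Option (Fin k) → Fin (r + 1)) (hrep : ∀ o, ρ (rep o) = o) (c : Fin (r + 1) → ℚ)
    (N : Fin (r + 1) → Fin r → ℚ)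
    (hroot : ∀ l i, N (rep (some l)) i = ∑ y, u l y * b y i)
    (hleaf : ∀ x, rep (ρ x) ≠ x → ∀ i, N x i = c x * (b x i - b (rep (ρ x)) i)) :
    |(vertexMatrix b).det * ((∏ x with rep (ρ x) ≠ x, c x) *
        (Matrix.of fun i l => ∑ x with ρ x = some l, u i x).det)| =
      |(Matrix.of fun i l => N ((rep none).succAbove l) i).det| := by
  rw [← det_forestMatrix u ρ rep hrep c, abs_det_vertexMatrix_mul b _ (rep none)]
  · congr 2
    ext i l
    simp only [Matrix.of_apply]
    have hne : (rep none).succAbove l ≠ rep none := Fin.succAbove_ne _ _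
    generalize (rep none).succAbove l = x at hne
    by_cases hx : rep (ρ x) = x
    · rcases ho : ρ x with _ | m
      · rw [ho] at hx
        exact (hne hx.symm).elim
      · have : x = rep (some m) := by rw [← ho, hx]
        rw [this, hroot]
        simp [forestMatrix, hrep]
    · rw [hleaf x hx]
      simp [forestMatrix, hx, mul_assoc, sub_mul, ← Finset.mul_sum, Finset.sum_sub_distrib]
  · simp [forestMatrix, hrep]
  · intro x hne
    by_cases hx : rep (ρ x) = x
    · rcases ho : ρ x with _ | m
      · rw [ho] at hx
        exact (hne hx.symm).elim
      · rw [ho] at hx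
        simp [forestMatrix, ho, hx, hu]
    · simp [forestMatrix, hx, ← Finset.mul_sum, Finset.sum_sub_distrib]

end VertexMatrix

theorem DeltaModular.abs_det_le {r n : ℕ} {A : Matrix (Fin r) (Fin n) ℤ} {Δ : ℤ} (hΔ : 0 ≤ Δ)
    (h : DeltaModular A Δ) (g : Fin r → Fin n) : |(A.submatrix id g).det| ≤ Δ := by
  by_cases hg : Function.Injective g
  · exact h g hg
  · simp only [Function.Injective, not_forall] at hg
    obtain ⟨i, j, hij, hne⟩ := hg
    rw [Matrix.det_zero_of_column_eq hne fun k => by simp [hij], abs_zero]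
    exact hΔ

section Weights

variable {r n : ℕ} {A : Matrix (Fin r) (Fin n) ℤ} {b : Fin (r + 1) → Fin r → ℚ}
  {J : Fin (r + 1) → Fin (r + 1) → Fin n} {T : Fin (r + 1) → Fin (r + 1) → ℚ}

theorem exists_weight_prod (hmod : DeltaModular A 3) (hD : (vertexMatrix b).det ≠ 0)
    (hJ : ∀ x y, x ≠ y → ∀ i, (A i (J x y) : ℚ) = T x y * (b x i - b y i))
    (hT : ∀ x y, x ≠ y → T x y ≠ 0) {k : ℕ} {y : Fin k → Fin (r + 1)}
    (hy : Function.Injective y) {v : Fin (r + 1)} (hv : ∀ l, y l ≠ v) :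
    ∃ K : ℚ, 0 < K ∧ ∀ z : Fin k → Fin (r + 1), (∀ l m, y l ≠ z m) →
      ∃ m : ℤ, m ≤ 3 ∧ K * ∏ l, |T (y l) (z l)| = m := by
  classical
  obtain ⟨ρ, hρ⟩ : ∃ ρ : Fin (r + 1) → Option (Fin k), ∀ l x, ρ x = some l ↔ y l = x :=
    ⟨_, hy.isPartialInv⟩
  obtain ⟨rep, hrep0, hrep1⟩ : ∃ rep : Option (Fin k) → Fin (r + 1), rep none = v ∧
      ∀ l, rep (some l) = y l := ⟨fun o => o.elim v y, rfl, fun _ => rfl⟩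
  have hρv : ρ v = none := by
    rcases h : ρ v with _ | l
    · rfl
    · exact (hv l ((hρ _ _).1 h)).elim
  have hrep : ∀ o, ρ (rep o) = o := by
    rintro (_ | l)
    · rw [hrep0, hρv]
    · rw [hrep1]; exact (hρ _ _).2 rfl
  refine ⟨|(vertexMatrix b).det * ∏ x with rep (ρ x) ≠ x, T x v|, ?_, fun z hz => ?_⟩
  · rw [abs_pos]
    refine mul_ne_zero hD (Finset.prod_ne_zero_iff.2 fun x hx => hT _ _ ?_)
    rintro rfl
    exact (Finset.mem_filter.1 hx).2 (by rw [hρv, hrep0])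
  · obtain ⟨g, hg⟩ : ∃ g : Fin (r + 1) → Fin n, ∀ x, g x = match ρ x with
        | none => J x v
        | some l => J (y l) (z l) := ⟨_, fun _ => rfl⟩
    have h := abs_det_vertexMatrix_mul_forest b
      (fun l => T (y l) (z l) • (Pi.single (y l) 1 - Pi.single (z l) 1))
      (fun l => by simp [← Finset.mul_sum, Finset.sum_sub_distrib]) ρ rep hrep (fun x => T x v)
      (fun x i => (A i (g x) : ℚ)) ?_ ?_
    · have hdiag : (Matrix.of fun i l => ∑ x with ρ x = some l,
          (T (y i) (z i) • (Pi.single (y i) 1 - Pi.single (z i) 1) : Fin (r + 1) → ℚ) x) =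
          Matrix.diagonal fun l => T (y l) (z l) := by
        ext i l
        have : (Finset.univ.filter fun x => ρ x = some l) = {y l} := by
          ext x
          simp [hρ, eq_comm]
        rw [Matrix.of_apply, this, Finset.sum_singleton, Matrix.diagonal_apply]
        by_cases hil : i = l
        · subst hil
          simp [hz i i]
        · have : y l ≠ y i := fun e => hil (hy e).symm
          simp [hil, hz l i, this]
      rw [hdiag, Matrix.det_diagonal, ← mul_assoc, abs_mul, Finset.abs_prod] at h
      refine ⟨|(A.submatrix id fun l => g ((rep none).succAbove l)).det|,
        hmod.abs_det_le (by norm_num) _, h.trans ?_⟩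
      rw [Int.cast_abs, Int.cast_det]
      rfl
    · intro l i
      have : ρ (y l) = some l := (hρ _ _).2 rfl
      simp only [hrep1, hg, this]
      rw [hJ _ _ (hz l l)]
      simp [Pi.single_apply, mul_assoc, sub_mul, ← Finset.mul_sum, Finset.sum_sub_distrib]
    · intro x hx i
      rcases ho : ρ x with _ | l
      · rw [ho, hrep0] at hx
        simp only [hg, ho, hrep0]
        exact hJ _ _ (Ne.symm hx) i
      · rw [ho, hrep1] at hx
        exact (hx ((hρ _ _).1 ho)).elim

theorem not_three_uneven (hmod : DeltaModular A 3) (hD : (vertexMatrix b).det ≠ 0)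
    (hJ : ∀ x y, x ≠ y → ∀ i, (A i (J x y) : ℚ) = T x y * (b x i - b y i))
    (hT : ∀ x y, x ≠ y → T x y ≠ 0) {y p q : Fin 3 → Fin (r + 1)}
    (hy : Function.Injective y) (hp : ∀ l m, y l ≠ p m) (hq : ∀ l m, y l ≠ q m)
    (hne : ∀ l, |T (y l) (p l)| ≠ |T (y l) (q l)|) : False := by
  obtain ⟨K, hK, h⟩ := exists_weight_prod hmod hD hJ hT hy (v := p 0) fun l => hp l 0
  have hs : ∀ l, ∃ s t, (s = p l ∨ s = q l) ∧ (t = p l ∨ t = q l) ∧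
      |T (y l) s| < |T (y l) t| := by
    intro l
    rcases lt_or_gt_of_ne (hne l) with h1 | h1
    · exact ⟨_, _, Or.inl rfl, Or.inr rfl, h1⟩
    · exact ⟨_, _, Or.inr rfl, Or.inl rfl, h1⟩
  choose s t hs ht hst using hs
  have hs' : ∀ l m, y l ≠ s m := fun l m => by rcases hs m with e | e <;> rw [e] <;> simp [hp, hq]
  have ht' : ∀ l m, y l ≠ t m := fun l m => by rcases ht m with e | e <;> rw [e] <;> simp [hp, hq]
  have hpos : ∀ l, 0 < |T (y l) (s l)| := fun l => abs_pos.2 (hT _ _ (hs' l l))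
  have h0 := h ![s 0, s 1, s 2] (by intro l m; fin_cases m <;> simp [hs'])
  have h1 := h ![t 0, s 1, s 2] (by intro l m; fin_cases m <;> simp [hs', ht'])
  have h2 := h ![t 0, t 1, s 2] (by intro l m; fin_cases m <;> simp [hs', ht'])
  have h3 := h ![t 0, t 1, t 2] (by intro l m; fin_cases m <;> simp [ht'])
  simp only [Fin.prod_univ_three, Matrix.cons_val_zero, Matrix.cons_val_one,
    Matrix.cons_val] at h0 h1 h2 h3
  obtain ⟨m0, -, e0⟩ := h0
  obtain ⟨m1, -, e1⟩ := h1
  obtain ⟨m2, -, e2⟩ := h2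
  obtain ⟨m3, hm3, e3⟩ := h3
  have a0 := hpos 0
  have a1 := hpos 1
  have a2 := hpos 2
  have b0 := hst 0
  have b1 := hst 1
  have b2 := hst 2
  have c0 : (0 : ℚ) < m0 := by rw [← e0]; positivity
  have c1 : (m0 : ℚ) < m1 := by rw [← e0, ← e1]; gcongr
  have c2 : (m1 : ℚ) < m2 := by
    rw [← e1, ← e2]
    have := a0.trans b0
    gcongr
  have c3 : (m2 : ℚ) < m3 := by
    rw [← e2, ← e3]
    have := a0.trans b0
    have := a1.trans b1
    gcongr
  norm_cast at c0 c1 c2 c3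
  omega

end Weights

theorem injective_cons_three {V : Type*} {x y z : V} (hxy : x ≠ y) (hxz : x ≠ z) (hyz : y ≠ z) :
    Function.Injective ![x, y, z] := by
  intro l m h
  fin_cases l <;> fin_cases m <;> simp_all

theorem exists_const_center {V : Type*} [Fintype V] [DecidableEq V] (δ : V → V → ℚ)
    (hs : ∀ x y, δ x y = δ y x)
    (h3 : ∀ y p q : Fin 3 → V, Function.Injective y → (∀ l m, y l ≠ p m) → (∀ l m, y l ≠ q m) →
      (∀ l, δ (y l) (p l) ≠ δ (y l) (q l)) → False) (hV : 18 ≤ Fintype.card V) :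
    ∃ x₀ c, ∀ y, y ≠ x₀ → δ y x₀ = c := by
  obtain ⟨o⟩ : Nonempty V := Fintype.card_pos_iff.1 (by omega)
  obtain ⟨Z, hZ, hZc⟩ := exists_cover
    (fun x y => x ≠ y ∧ x ≠ o ∧ y ≠ o ∧ δ y x ≠ δ y o) (by
      rintro x₁ y₁ x₂ y₂ x₃ y₃ ⟨n1, xo1, yo1, s1⟩ ⟨n2, xo2, yo2, s2⟩ ⟨n3, xo3, yo3, s3⟩ m1 m2 m3 m4
      simp only [Finset.mem_insert, Finset.mem_singleton, not_or] at m1 m2 m3 m4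
      refine h3 ![y₁, y₂, y₃] ![x₁, x₂, x₃] (fun _ => o) (injective_cons_three (Ne.symm m2.2)
        (Ne.symm m4.2.1) (Ne.symm m4.2.2.2)) ?_ ?_ ?_
      · intro l m
        fin_cases l <;> fin_cases m
        exacts [Ne.symm n1, Ne.symm m1.2, Ne.symm m3.2.1, m2.1, Ne.symm n2, Ne.symm m3.2.2.2,
          m4.1, m4.2.2.1, Ne.symm n3]
      · intro l m
        fin_cases l
        exacts [yo1, yo2, yo3]
      · intro l
        fin_cases l
        exacts [s1, s2, s3])
  obtain ⟨W, hW⟩ : ∃ W, W = (insert o Z)ᶜ := ⟨_, rfl⟩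
  have hmem : ∀ {x}, x ∈ W ↔ x ≠ o ∧ x ∉ Z := by
    intro x
    simp [hW]
  have hWc : 13 ≤ W.card := by
    rw [hW, Finset.card_compl]
    have := Finset.card_insert_le o Z
    omega
  have hR : ∀ x ∈ W, ∀ y ∈ W, x ≠ y → δ y x = δ y o := by
    intro x hx y hy hxy
    by_contra hne
    rcases hZc x y ⟨hxy, (hmem.1 hx).1, (hmem.1 hy).1, hne⟩ with h | h
    · exact (hmem.1 hx).2 h
    · exact (hmem.1 hy).2 h
  obtain ⟨v₀, hv₀⟩ : W.Nonempty := Finset.card_pos.1 (by omega)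
  obtain ⟨c, hc⟩ : ∃ c, c = δ v₀ o := ⟨_, rfl⟩
  have hWo : ∀ x ∈ W, δ x o = c := by
    intro x hx
    by_cases hxv : x = v₀
    · rw [hxv, hc]
    · rw [hc, ← hR v₀ hv₀ x hx (Ne.symm hxv), hs, hR x hx v₀ hv₀ hxv]
  have hWW : ∀ x ∈ W, ∀ y ∈ W, x ≠ y → δ y x = c := fun x hx y hy hxy => by
    rw [hR x hx y hy hxy, hWo y hy]
  have hbad : ∀ z ∈ Z, (W.filter fun x => δ x z ≠ c).card ≤ 3 := by
    intro z hz
    by_contra! hlt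
    obtain ⟨v, hv⟩ := Finset.card_pos.1 (by omega : 0 < (W.filter fun x => δ x z ≠ c).card)
    have h2 : 2 < ((W.filter fun x => δ x z ≠ c).erase v).card := by
      rw [Finset.card_erase_of_mem hv]; omega
    obtain ⟨d, hd, e, he, f, hf, hde, hdf, hef⟩ := Finset.two_lt_card.1 h2
    have key : ∀ x ∈ (W.filter fun x => δ x z ≠ c).erase v, x ≠ z ∧ x ≠ v ∧ δ x z ≠ δ x v := by
      intro x hx
      obtain ⟨hxv, hx⟩ := Finset.mem_erase.1 hx
      obtain ⟨hxW, hx⟩ := Finset.mem_filter.1 hx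
      refine ⟨?_, hxv, ?_⟩
      · rintro rfl
        exact (hmem.1 hxW).2 hz
      · rwa [hWW v (Finset.mem_filter.1 hv).1 x hxW (Ne.symm hxv)]
    have kd := key d hd
    have ke := key e he
    have kf := key f hf
    refine h3 ![d, e, f] (fun _ => z) (fun _ => v) (injective_cons_three hde hdf hef) ?_ ?_ ?_
    · intro l m
      fin_cases l
      exacts [kd.1, ke.1, kf.1]
    · intro l m
      fin_cases l
      exacts [kd.2.1, ke.2.1, kf.2.1]
    · intro l
      fin_cases l
      exacts [kd.2.2, ke.2.2, kf.2.2]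
  obtain ⟨x₀, hx₀, hx₀'⟩ : ∃ x₀ ∈ W, x₀ ∉ Z.biUnion fun z => W.filter fun x => δ x z ≠ c := by
    apply Finset.exists_mem_notMem_of_card_lt_card
    have := Finset.card_biUnion_le_card_mul Z (fun z => W.filter fun x => δ x z ≠ c) 3 hbad
    omega
  refine ⟨x₀, c, fun y hy => ?_⟩
  by_cases hyo : y = o
  · rw [hyo, hs, hWo x₀ hx₀]
  by_cases hyZ : y ∈ Z
  · by_contra hne
    exact hx₀' (Finset.mem_biUnion.2 ⟨y, hyZ, Finset.mem_filter.2 ⟨hx₀, by rwa [hs]⟩⟩)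
  · exact hWW x₀ hx₀ y (hmem.2 ⟨hyo, hyZ⟩) (Ne.symm hy)

section Vertices

variable {r n : ℕ} {A : Matrix (Fin r) (Fin n) ℤ}

theorem colsIndepQ_range {ι κ : Type} (M : Matrix (Fin r) ι ℤ) {f : κ → ι}
    (hf : Function.Injective f) :
    ColsIndepQ M (Set.range f) ↔ LinearIndependent ℚ fun k i => (M i (f k) : ℚ) := by
  unfold ColsIndepQ
  rw [← linearIndependent_equiv (Equiv.ofInjective f hf)]
  rfl

variable {φ : (Fin r ⊕ PairIdx r) → Fin n}

theorem linearIndependent_iff_of_clique (hφ : Function.Injective φ)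
    (hclique : ∀ S : Set (Fin r ⊕ PairIdx r), ColsIndepQ (IDmat r) S ↔ ColsIndepQ A (φ '' S))
    {κ : Type} {f : κ → Fin r ⊕ PairIdx r} (hf : Function.Injective f) :
    (LinearIndependent ℚ fun k i => (IDmat r i (f k) : ℚ)) ↔
      LinearIndependent ℚ fun k i => (A i (φ (f k)) : ℚ) := by
  rw [← colsIndepQ_range _ hf, hclique, ← Set.range_comp, colsIndepQ_range _ (hφ.comp hf)]
  rfl

theorem eq_zero_of_smul_add_smul_eq_zero
    (hnonpar : ∀ j j', j ≠ j' → ¬ IntParallel (fun i => A i j) (fun i => A i j'))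
    {j j' : Fin n} (hj : j ≠ j') {p q : ℚ} (h : ∀ i, p * (A i j : ℚ) + q * A i j' = 0) :
    p = 0 ∧ q = 0 := by
  have h1 := hnonpar j j' hj
  unfold IntParallel at h1
  rw [not_not] at h1
  exact LinearIndependent.pair_iff.1 h1 p q (funext fun i => by simpa using h i)

theorem exists_eq_add_of_clique
    (hnonpar : ∀ j j', j ≠ j' → ¬ IntParallel (fun i => A i j) (fun i => A i j'))
    (hφ : Function.Injective φ)
    (hclique : ∀ S : Set (Fin r ⊕ PairIdx r), ColsIndepQ (IDmat r) S ↔ ColsIndepQ A (φ '' S))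
    {d e f : Fin r ⊕ PairIdx r} (hde : d ≠ e) (hdf : d ≠ f) (hef : e ≠ f)
    (h : ∀ i, IDmat r i f = IDmat r i d - IDmat r i e) :
    ∃ p q : ℚ, p ≠ 0 ∧ q ≠ 0 ∧
      ∀ i, (A i (φ f) : ℚ) = p * A i (φ d) + q * A i (φ e) := by
  have hinj := injective_cons_three hde hdf hef
  have h1 : ¬ LinearIndependent ℚ fun k i => (IDmat r i (![d, e, f] k) : ℚ) := by
    rw [Fintype.not_linearIndependent_iff]
    refine ⟨![1, -1, -1], ?_, 0, by simp⟩
    ext i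
    simp [Fin.sum_univ_three, h]
    ring
  rw [linearIndependent_iff_of_clique hφ hclique hinj, Fintype.not_linearIndependent_iff] at h1
  obtain ⟨g, hg, hne⟩ := h1
  have hg' : ∀ i, g 0 * (A i (φ d) : ℚ) + g 1 * A i (φ e) + g 2 * A i (φ f) = 0 := by
    intro i
    have := congrFun hg i
    simpa [Fin.sum_univ_three] using this
  have z0 : g 0 ≠ 0 := by
    intro h0
    obtain ⟨h1, h2⟩ := eq_zero_of_smul_add_smul_eq_zero hnonpar (hφ.ne hef) (p := g 1) (q := g 2)
      fun i => by have := hg' i; rw [h0] at this; linarith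
    obtain ⟨l, hl⟩ := hne
    fin_cases l <;> simp_all
  have z1 : g 1 ≠ 0 := by
    intro h0
    exact z0 (eq_zero_of_smul_add_smul_eq_zero hnonpar (hφ.ne hdf) (p := g 0) (q := g 2)
      fun i => by have := hg' i; rw [h0] at this; linarith).1
  have z2 : g 2 ≠ 0 := by
    intro h0
    exact z0 (eq_zero_of_smul_add_smul_eq_zero hnonpar (hφ.ne hde) (p := g 0) (q := g 1)
      fun i => by have := hg' i; rw [h0] at this; linarith).1
  refine ⟨-g 0 / g 2, -g 1 / g 2, div_ne_zero (neg_ne_zero.2 z0) z2,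
    div_ne_zero (neg_ne_zero.2 z1) z2, fun i => ?_⟩
  have := hg' i
  field_simp
  linarith

theorem exists_vertices (hr : 1 ≤ r)
    (hnonpar : ∀ j j', j ≠ j' → ¬ IntParallel (fun i => A i j) (fun i => A i j'))
    (hφ : Function.Injective φ)
    (hclique : ∀ S : Set (Fin r ⊕ PairIdx r), ColsIndepQ (IDmat r) S ↔ ColsIndepQ A (φ '' S)) :
    ∃ b : Fin (r + 1) → Fin r → ℚ, (vertexMatrix b).det ≠ 0 ∧ ∀ x y, x ≠ y →
      ∃ j, ∃ t : ℚ, t ≠ 0 ∧ ∀ i, (A i j : ℚ) = t * (b x i - b y i) := by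
  have hli : LinearIndependent ℚ fun (l : Fin r) i => (A i (φ (Sum.inl l)) : ℚ) := by
    rw [← linearIndependent_iff_of_clique hφ hclique Sum.inl_injective]
    have := (Pi.basisFun ℚ (Fin r)).linearIndependent
    convert this using 1
    ext l i
    simp [IDmat, Pi.single_apply]
  obtain ⟨o, ho⟩ : ∃ o : Fin r, ∀ l, l ≠ o → o < l :=
    ⟨⟨0, hr⟩, fun l hl => Fin.lt_def.2 (Nat.pos_of_ne_zero fun e => hl (Fin.ext e))⟩
  have hρ : ∀ l : Fin r, ∃ ρ : ℚ, ρ ≠ 0 ∧ (l = o → ρ = 1) ∧ ∀ h : o < l, ∃ p : ℚ, p ≠ 0 ∧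
      ∀ i, (A i (φ (Sum.inr ⟨(o, l), h⟩)) : ℚ) =
        p * (A i (φ (Sum.inl o)) - ρ * A i (φ (Sum.inl l))) := by
    intro l
    by_cases hl : l = o
    · exact ⟨1, one_ne_zero, fun _ => rfl, fun h => (h.ne' hl).elim⟩
    · obtain ⟨p, q, hp, hq, h⟩ := exists_eq_add_of_clique hnonpar hφ hclique
        (d := Sum.inl o) (e := Sum.inl l) (f := Sum.inr ⟨(o, l), ho l hl⟩)
        (by simpa using Ne.symm hl) (by simp) (by simp) (fun i => by
          simp only [IDmat, Dmat, Matrix.of_apply, Sum.elim_inl, Sum.elim_inr]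
          by_cases h1 : i = o
          · subst h1; simp [Ne.symm hl]
          · simp [h1]; split_ifs <;> rfl)
      refine ⟨-q / p, div_ne_zero (neg_ne_zero.2 hq) hp, fun e => (hl e).elim, fun _ =>
        ⟨p, hp, fun i => ?_⟩⟩
      rw [h]
      field_simp
      ring
  choose ρ hρ0 hρ1 hρ using hρ
  obtain ⟨b, hb0, hb1⟩ : ∃ b : Fin (r + 1) → Fin r → ℚ, (∀ i, b 0 i = 0) ∧
      ∀ l i, b (Fin.succ l) i = ρ l * A i (φ (Sum.inl l)) :=
    ⟨Fin.cons (fun _ => 0) fun l i => ρ l * A i (φ (Sum.inl l)), fun _ => rfl, fun _ _ => rfl⟩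
  refine ⟨b, ?_, ?_⟩
  · rw [Matrix.det_succ_column_zero, Fin.sum_univ_succ]
    simp only [vertexMatrix_succ, vertexMatrix_zero, hb0, mul_zero, zero_mul,
      Finset.sum_const_zero, add_zero, Fin.val_zero, pow_zero, one_mul, Fin.succAbove_zero]
    have : (vertexMatrix b).submatrix Fin.succ Fin.succ =
        Matrix.of fun i l => ρ l * (Matrix.of fun i l => (A i (φ (Sum.inl l)) : ℚ)) i l := by
      ext i l
      simp [hb1]
    rw [this, Matrix.det_mul_row]
    refine mul_ne_zero (Finset.prod_ne_zero_iff.2 fun l _ => hρ0 l) ?_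
    have hu : IsUnit (Matrix.of fun i l => (A i (φ (Sum.inl l)) : ℚ)) :=
      Matrix.linearIndependent_cols_iff_isUnit.1 hli
    exact ((Matrix.isUnit_iff_isUnit_det _).1 hu).ne_zero
  · have key : ∀ x y, x < y →
        ∃ j, ∃ t : ℚ, t ≠ 0 ∧ ∀ i, (A i j : ℚ) = t * (b x i - b y i) := by
      intro x y hxy
      obtain ⟨l, rfl⟩ := Fin.exists_succ_eq.2 (Fin.ne_zero_of_lt hxy)
      cases x using Fin.cases with
      | zero =>
        refine ⟨φ (Sum.inl l), -(ρ l)⁻¹, neg_ne_zero.2 (inv_ne_zero (hρ0 l)), fun i => ?_⟩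
        have := hρ0 l
        rw [hb0, hb1]
        field_simp
        ring
      | succ k =>
        have hkl : k < l := Fin.succ_lt_succ_iff.1 hxy
        by_cases hk : k = o
        · subst hk
          obtain ⟨p, hp, h⟩ := hρ l hkl
          refine ⟨φ (Sum.inr ⟨(k, l), hkl⟩), p, hp, fun i => ?_⟩
          rw [h, hb1, hb1, hρ1 k rfl, one_mul]
        · have hok := ho k hk
          have hol := hok.trans hkl
          obtain ⟨p₁, hp₁, h₁⟩ := hρ k hok
          obtain ⟨p₂, hp₂, h₂⟩ := hρ l hol
          obtain ⟨p, q, hp, hq, h⟩ := exists_eq_add_of_clique hnonpar hφ hclique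
            (d := Sum.inl k) (e := Sum.inl l) (f := Sum.inr ⟨(k, l), hkl⟩)
            (by simpa using hkl.ne) (by simp) (by simp) (fun i => by
              simp only [IDmat, Dmat, Matrix.of_apply, Sum.elim_inl, Sum.elim_inr]
              by_cases h1 : i = k
              · subst h1; simp [hkl.ne]
              · simp [h1]; split_ifs <;> rfl)
          obtain ⟨P, Q, hP, hQ, h'⟩ := exists_eq_add_of_clique hnonpar hφ hclique
            (d := Sum.inr ⟨(o, l), hol⟩) (e := Sum.inr ⟨(o, k), hok⟩) (f := Sum.inr ⟨(k, l), hkl⟩)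
            (by simpa using hkl.ne') (by simpa using hok.ne) (by simpa using fun e => (hok.ne e).elim)
            (fun i => by
              simp only [IDmat, Dmat, Matrix.of_apply, Sum.elim_inr]
              by_cases h1 : i = o
              · subst h1; simp [hok.ne, hol.ne]
              · by_cases h2 : i = k
                · subst h2; simp [h1, hkl.ne]
                · simp [h1, h2])
          have hinj := injective_cons_three hok.ne hol.ne hkl.ne
          have hli3 := Fintype.linearIndependent_iff.1 (hli.comp _ hinj)
            ![P * p₂ + Q * p₁, -Q * p₁ * ρ k - p, -P * p₂ * ρ l - q] (by
              ext i
              have e1 := h i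
              rw [h', h₁, h₂] at e1
              simp [Fin.sum_univ_three]
              linarith) 0
          simp only [Matrix.cons_val_zero] at hli3
          refine ⟨φ (Sum.inr ⟨(k, l), hkl⟩), -Q * p₁, mul_ne_zero (neg_ne_zero.2 hQ) hp₁,
            fun i => ?_⟩
          rw [h', h₁, h₂, hb1, hb1]
          linear_combination (A i (φ (Sum.inl o)) - ρ l * A i (φ (Sum.inl l)) : ℚ) * hli3
    intro x y hxy
    rcases lt_or_gt_of_ne hxy with h | h
    · exact key x y h
    · obtain ⟨j, t, ht, h⟩ := key y x h
      exact ⟨j, -t, neg_ne_zero.2 ht, fun i => by rw [h]; ring⟩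

end Vertices

section IntegralVertices

variable {r n : ℕ} {A : Matrix (Fin r) (Fin n) ℤ}

theorem exists_int_vertices (hr : 17 ≤ r) (hnonzero : ∀ j, (fun i => A i j) ≠ 0)
    (hnonpar : ∀ j j', j ≠ j' → ¬ IntParallel (fun i => A i j) (fun i => A i j'))
    (hmod : DeltaModular A 3) {φ : (Fin r ⊕ PairIdx r) → Fin n} (hφ : Function.Injective φ)
    (hclique : ∀ S : Set (Fin r ⊕ PairIdx r), ColsIndepQ (IDmat r) S ↔ ColsIndepQ A (φ '' S)) :
    ∃ (B : Fin (r + 1) → Fin r → ℤ) (β : ℤ), 1 ≤ β ∧ β ≤ 3 ∧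
      |(vertexMatrix fun x i => (B x i : ℚ)).det| = β ∧ ∀ x y, x ≠ y →
        ∃ j, ∃ t : ℚ, t ≠ 0 ∧ ∀ i, (A i j : ℚ) = t * (B x i - B y i) := by
  have : Nonempty (Fin n) := ⟨φ (Sum.inl ⟨0, by omega⟩)⟩
  obtain ⟨b, hD, hb⟩ := exists_vertices (by omega) hnonpar hφ hclique
  choose! J T hT hJ using hb
  have hsymm : ∀ x y, |T x y| = |T y x| := by
    intro x y
    by_cases hxy : x = y
    · rw [hxy]
    have hJJ : J x y = J y x := by
      by_contra hne
      refine hT y x (Ne.symm hxy) (eq_zero_of_smul_add_smul_eq_zero hnonpar hne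
        (p := T y x) (q := T x y) fun i => ?_).1
      rw [hJ x y hxy, hJ y x (Ne.symm hxy)]
      ring
    obtain ⟨i, hi⟩ := Function.ne_iff.1 (hnonzero (J x y))
    have hi' : (A i (J x y) : ℚ) ≠ 0 := by exact_mod_cast hi
    have h1 := hJ x y hxy i
    have h2 := hJ y x (Ne.symm hxy) i
    rw [← hJJ, h1] at h2
    have hne : b x i - b y i ≠ 0 := fun h => hi' (by rw [h1, h, mul_zero])
    have : T x y = -T y x := mul_right_cancel₀ hne (by rw [h2]; ring)
    rw [this, abs_neg]
  obtain ⟨x₀, c, hc⟩ := exists_const_center (fun x y => |T x y|) hsymm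
    (fun _ _ _ hy hp hq hne => not_three_uneven hmod hD hJ hT hy hp hq hne) (by simp; omega)
  have hc0 : 0 < c := by
    obtain ⟨y, hy⟩ : ∃ y, y ≠ x₀ := by
      have : Nontrivial (Fin (r + 1)) := Fin.nontrivial_iff_two_le.2 (by omega)
      exact exists_ne x₀
    rw [← hc y hy]
    exact abs_pos.2 (hT y x₀ hy)
  have hB : ∀ y, ∃ v : Fin r → ℤ, (∀ i, (v i : ℚ) = c * (b y i - b x₀ i)) ∧
      ∃ j, ∃ e : ℤ, y ≠ x₀ → |e| = 1 ∧ ∀ i, v i = e * A i j := by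
    intro y
    by_cases hy : y = x₀
    · exact ⟨0, by simp [hy], J y y, 1, fun h => (h hy).elim⟩
    · rcases eq_or_eq_neg_of_abs_eq (hc y hy) with h | h
      · refine ⟨fun i => A i (J y x₀), fun i => ?_, J y x₀, 1, fun _ => ⟨by simp, by simp⟩⟩
        rw [hJ y x₀ hy, h]
      · refine ⟨fun i => -A i (J y x₀), fun i => ?_, J y x₀, -1, fun _ => ⟨by simp, by simp⟩⟩
        push_cast
        rw [hJ y x₀ hy, h]
        ring
  choose B hB j e hj using hB
  have hx₀ : ∀ i, B x₀ i = 0 := fun i => by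
    have := hB x₀ i
    rw [sub_self, mul_zero] at this
    exact_mod_cast this
  have hN : (Matrix.of fun i l => (B (x₀.succAbove l) i : ℚ)).det =
      (∏ l, (e (x₀.succAbove l) : ℚ)) *
        ((A.submatrix id fun l => j (x₀.succAbove l)).det : ℤ) := by
    rw [Int.cast_det, ← Matrix.det_mul_row]
    congr 1
    ext i l
    rw [Matrix.of_apply, (hj _ (Fin.succAbove_ne x₀ l)).2]
    simp
  have hNabs : |(Matrix.of fun i l => (B (x₀.succAbove l) i : ℚ)).det| =
      (|(A.submatrix id fun l => j (x₀.succAbove l)).det| : ℤ) := by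
    rw [hN, abs_mul, Finset.abs_prod, Finset.prod_eq_one, one_mul, Int.cast_abs]
    intro l _
    rw [← Int.cast_abs, (hj _ (Fin.succAbove_ne x₀ l)).1, Int.cast_one]
  have h1 := abs_det_vertexMatrix_mul_forest (fun x i => (B x i : ℚ)) (k := 0)
    (fun l => l.elim0) (fun l => l.elim0) (fun _ => none) (fun _ => x₀)
    (fun o => by rcases o with _ | l; exacts [rfl, l.elim0]) (fun _ => 1)
    (fun x i => (B x i : ℚ)) (fun l => l.elim0) (fun x _ i => by simp [hx₀])
  have h2 := abs_det_vertexMatrix_mul_forest b (k := 0)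
    (fun l => l.elim0) (fun l => l.elim0) (fun _ => none) (fun _ => x₀)
    (fun o => by rcases o with _ | l; exacts [rfl, l.elim0]) (fun _ => c)
    (fun x i => (B x i : ℚ)) (fun l => l.elim0) (fun x _ i => hB x i)
  rw [Matrix.det_fin_zero, mul_one] at h1 h2
  rw [Finset.prod_const_one, mul_one, hNabs] at h1
  rw [hNabs] at h2
  refine ⟨B, _, ?_, hmod.abs_det_le (by norm_num) _, h1, fun x y hxy => ?_⟩
  · have : (0 : ℚ) < (|(A.submatrix id fun l => j (x₀.succAbove l)).det| : ℤ) := by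
      rw [← h2]
      exact abs_pos.2 (mul_ne_zero hD (Finset.prod_ne_zero_iff.2 fun _ _ => hc0.ne'))
    have : 0 < |(A.submatrix id fun l => j (x₀.succAbove l)).det| := by exact_mod_cast this
    omega
  · refine ⟨J x y, T x y / c, div_ne_zero (hT x y hxy) hc0.ne', fun i => ?_⟩
    rw [hJ x y hxy, hB, hB]
    field_simp
    ring

end IntegralVertices

section Coordinates

variable {r n : ℕ} {B : Fin (r + 1) → Fin r → ℤ} {β : ℤ}

theorem exists_int_coords (hβ : |(vertexMatrix fun x i => (B x i : ℚ)).det| = β) (a : Fin r → ℤ) :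
    ∃ w : Fin (r + 1) → ℤ, ∑ x, w x = 0 ∧ ∀ i, ∑ x, w x * B x i = β * a i := by
  obtain ⟨M, hM⟩ : ∃ M : Matrix (Fin (r + 1)) (Fin (r + 1)) ℤ,
      M = Matrix.of fun i x => (Fin.cons 1 (B x) : Fin (r + 1) → ℤ) i := ⟨_, rfl⟩
  have hMd : (vertexMatrix fun x i => (B x i : ℚ)).det = (M.det : ℤ) := by
    rw [Int.cast_det]
    congr 1
    ext i x
    cases i using Fin.cases <;> simp [hM]
  rw [hMd, ← Int.cast_abs, Int.cast_inj] at hβ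
  obtain ⟨s, hs⟩ : ∃ s : ℤ, s * M.det = β := by
    rcases abs_choice M.det with h | h
    · exact ⟨1, by rw [← hβ, h, one_mul]⟩
    · exact ⟨-1, by rw [← hβ, h, neg_one_mul]⟩
  have key : M.mulVec (s • M.adjugate.mulVec (Fin.cons 0 a)) = β • (Fin.cons 0 a) := by
    rw [Matrix.mulVec_smul, Matrix.mulVec_mulVec, Matrix.mul_adjugate, Matrix.smul_mulVec,
      Matrix.one_mulVec, smul_smul, hs]
  refine ⟨s • M.adjugate.mulVec (Fin.cons 0 a), ?_, fun i => ?_⟩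
  · have := congrFun key 0
    rw [Matrix.mulVec, dotProduct] at this
    simpa [hM] using this
  · have := congrFun key i.succ
    rw [Matrix.mulVec, dotProduct] at this
    simpa [hM, mul_comm] using this

theorem eq_of_coords {b : Fin (r + 1) → Fin r → ℚ} (hb : (vertexMatrix b).det ≠ 0)
    {u v : Fin (r + 1) → ℚ} (hs : ∑ x, u x = ∑ x, v x)
    (h : ∀ i, ∑ x, u x * b x i = ∑ x, v x * b x i) : u = v := by
  have : (vertexMatrix b).mulVec u = (vertexMatrix b).mulVec v := by
    ext i
    cases i using Fin.cases with
    | zero => simpa [Matrix.mulVec, dotProduct] using hs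
    | succ i => simpa [Matrix.mulVec, dotProduct, mul_comm] using h i
  exact Matrix.mulVec_injective_of_isUnit
    ((Matrix.isUnit_iff_isUnit_det _).2 (isUnit_iff_ne_zero.2 hb)) this

theorem exists_cliqueForm (hβ0 : 0 < β) (hβ : |(vertexMatrix fun x i => (B x i : ℚ)).det| = β)
    (a : Fin n → Fin r → ℤ)
    (hnonpar : ∀ j j', j ≠ j' → ∀ p q : ℤ, (∀ i, p * a j i = q * a j' i) → p = 0 ∧ q = 0)
    (hedge : ∀ x y, x ≠ y → ∃ j, ∃ t : ℚ, t ≠ 0 ∧ |t| ≤ 1 ∧ ∀ i, (a j i : ℚ) = t * (B x i - B y i))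
    (hmod : ∀ g : Fin r → Fin n, |(Matrix.of fun i l => a (g l) i).det| ≤ 3) :
    ∃ w : Fin n → Fin (r + 1) → ℤ, CliqueForm β w := by
  choose w hw0 hw using fun j => exists_int_coords hβ (a j)
  have hβQ : (β : ℚ) ≠ 0 := by exact_mod_cast hβ0.ne'
  have hD : (vertexMatrix fun x i => (B x i : ℚ)).det ≠ 0 := by
    intro h
    rw [h, abs_zero] at hβ
    exact hβQ hβ.symm
  refine ⟨w, hw0, fun j j' hj p q h => hnonpar j j' hj p q fun i => ?_, fun x y hxy => ?_, ?_⟩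
  · refine mul_left_cancel₀ hβ0.ne' ?_
    rw [mul_left_comm, ← hw, mul_left_comm, ← hw, Finset.mul_sum, Finset.mul_sum]
    refine Finset.sum_congr rfl fun x _ => ?_
    have := congrFun h x
    simp only [Pi.smul_apply, smul_eq_mul] at this
    rw [← mul_assoc, this, mul_assoc]
  · obtain ⟨j, t, ht0, ht1, ht⟩ := hedge x y hxy
    have hwj : (fun v => (w j v : ℚ)) = (β * t) • (Pi.single x 1 - Pi.single y 1) := by
      refine eq_of_coords hD ?_ fun i => ?_
      · have := hw0 j
        simp only [Pi.smul_apply, Pi.sub_apply, smul_eq_mul]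
        rw [← Finset.mul_sum, Finset.sum_sub_distrib]
        simp only [Finset.sum_pi_single', Finset.mem_univ, if_true, sub_self, mul_zero]
        exact_mod_cast this
      · have : (∑ v, (w j v : ℚ) * B v i) = β * a j i := by exact_mod_cast hw j i
        rw [this, ht]
        simp [mul_assoc, sub_mul, ← Finset.mul_sum, Finset.sum_sub_distrib, Pi.single_apply]
    have hwx : (w j x : ℚ) = β * t := by
      have := congrFun hwj x
      simpa [hxy] using this
    refine ⟨j, w j x, ?_, ?_, ?_⟩
    · have : (w j x : ℚ) ≠ 0 := by rw [hwx]; exact mul_ne_zero hβQ ht0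
      exact_mod_cast this
    · have : |(w j x : ℚ)| ≤ β := by
        have hβp : (0 : ℚ) < β := by exact_mod_cast hβ0
        rw [hwx, abs_mul, abs_of_pos hβp]
        nlinarith
      exact_mod_cast this
    · ext v
      have := congrFun hwj v
      rw [← hwx] at this
      have h' : (w j v : ℚ) = (w j x * ((Pi.single x 1 - Pi.single y 1 : Fin (r + 1) → ℤ) v) : ℤ) := by
        rw [this]
        simp [Pi.single_apply]
      exact_mod_cast h'
  · intro k u ρ rep hrep
    obtain ⟨N, hNdef, hNmod⟩ : ∃ N : Fin (r + 1) → Fin r → ℤ,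
        ((∀ l i, N (rep (some l)) i = a (u l) i) ∧
          ∀ x, rep (ρ x) ≠ x → ∀ i, N x i = B x i - B (rep (ρ x)) i) ∧
        ((∀ x, rep (ρ x) ≠ x → IsUnitEdge β w x (rep (ρ x))) → ∀ x, x ≠ rep none →
          ∃ j, ∃ e : ℤ, |e| = 1 ∧ ∀ i, N x i = e * a j i) := by
      refine ⟨fun x => if rep (ρ x) = x then (ρ x).elim 0 (fun l => a (u l)) else
        B x - B (rep (ρ x)), ⟨fun l i => by simp [hrep], fun x hx i => by simp [hx]⟩,
        fun hE x hx => ?_⟩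
      by_cases h : rep (ρ x) = x
      · rcases ho : ρ x with _ | l
        · rw [ho] at h
          exact (hx h.symm).elim
        · rw [ho] at h
          exact ⟨u l, 1, by simp, by simp [ho, h]⟩
      · simp only [h, if_false]
        obtain ⟨j, hj⟩ := hE x h
        have hsum : ∀ i, ∑ v, (β • (Pi.single x 1 - Pi.single (rep (ρ x)) 1) :
            Fin (r + 1) → ℤ) v * B v i = β * (B x i - B (rep (ρ x)) i) := by
          intro i
          simp [mul_assoc, sub_mul, ← Finset.mul_sum, Finset.sum_sub_distrib, Pi.single_apply]
        rcases hj with hj | hj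
        · refine ⟨j, 1, by simp, fun i => mul_left_cancel₀ hβ0.ne' ?_⟩
          have := hw j i
          rw [hj, hsum] at this
          rw [one_mul, ← this, Pi.sub_apply]
        · refine ⟨j, -1, by simp, fun i => mul_left_cancel₀ hβ0.ne' ?_⟩
          have := hw j i
          simp only [hj, Pi.neg_apply, neg_mul, Finset.sum_neg_distrib, hsum] at this
          rw [Pi.sub_apply]
          linarith
    have h := abs_det_vertexMatrix_mul_forest (fun x i => (B x i : ℚ))
      (fun l x => (w (u l) x : ℚ) / β) (fun l => by
        rw [← Finset.sum_div]
        have : (∑ x, (w (u l) x : ℚ)) = 0 := by exact_mod_cast hw0 (u l)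
        rw [this, zero_div]) ρ rep hrep (fun _ => 1) (fun x i => (N x i : ℚ)) (fun l i => by
        have : (∑ v, (w (u l) v : ℚ) * B v i) = β * a (u l) i := by exact_mod_cast hw (u l) i
        simp only [hNdef.1, div_mul_eq_mul_div]
        rw [← Finset.sum_div, this]
        field_simp) (fun x hx i => by rw [hNdef.2 x hx]; push_cast; ring)
    have hW : (Matrix.of fun i l => ∑ x with ρ x = some l, (w (u i) x : ℚ) / β).det =
        ((Matrix.of fun i l => ∑ x with ρ x = some l, w (u i) x).det : ℤ) / β ^ k := by
      have : (Matrix.of fun i l => ∑ x with ρ x = some l, (w (u i) x : ℚ) / β) =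
          (β : ℚ)⁻¹ • ((Matrix.of fun i l => ∑ x with ρ x = some l, w (u i) x).map
            (Int.cast : ℤ → ℚ)) := by
        ext i l
        simp [div_eq_inv_mul, Finset.mul_sum]
      rw [this, Matrix.det_smul, Fintype.card_fin, Int.cast_det, inv_pow, div_eq_inv_mul]
    have hN : (Matrix.of fun i l => (N ((rep none).succAbove l) i : ℚ)).det =
        ((Matrix.of fun i l => N ((rep none).succAbove l) i).det : ℤ) := by
      rw [Int.cast_det]
      rfl
    rw [hW, hN, Finset.prod_const_one, one_mul, abs_mul, hβ, abs_div, abs_pow] at h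
    have hβabs : |(β : ℚ)| = β := abs_of_pos (by exact_mod_cast hβ0)
    rw [hβabs, mul_div_assoc', div_eq_iff (pow_ne_zero _ hβQ)] at h
    have h' : β * |(Matrix.of fun i l => ∑ x with ρ x = some l, w (u i) x).det| =
        |(Matrix.of fun i l => N ((rep none).succAbove l) i).det| * β ^ k := by
      exact_mod_cast h
    generalize hd : (Matrix.of fun i l => ∑ x with ρ x = some l, w (u i) x).det = d at h' ⊢
    have hle : (∀ x, rep (ρ x) ≠ x → IsUnitEdge β w x (rep (ρ x))) →
        |(Matrix.of fun i l => N ((rep none).succAbove l) i).det| ≤ 3 := by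
      intro hE
      choose g e he hg using fun l => hNmod hE _ (Fin.succAbove_ne (rep none) l)
      have : (Matrix.of fun i l => N ((rep none).succAbove l) i) =
          Matrix.of fun i l => e l * (Matrix.of fun i l => a (g l) i) i l := by
        ext i l
        simp [hg]
      rw [this, Matrix.det_mul_row, abs_mul, Finset.abs_prod, Finset.prod_eq_one fun l _ => he l,
        one_mul]
      exact hmod g
    generalize (Matrix.of fun i l => N ((rep none).succAbove l) i).det = m at h' hle
    rcases abs_choice d with hd | hd <;> rw [hd] at h'
    · exact ⟨|m|, by rw [h', mul_comm], fun hE => by rw [abs_abs]; exact hle hE⟩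
    · exact ⟨-|m|, by linarith, fun hE => by rw [abs_neg, abs_abs]; exact hle hE⟩

end Coordinates

theorem exists_normalized {r : ℕ} {B : Fin (r + 1) → Fin r → ℤ}
    (hD : (vertexMatrix fun x i => (B x i : ℚ)).det ≠ 0) (a : Fin r → ℤ) :
    ∃ (a' : Fin r → ℤ) (s : ℚ), 1 ≤ |s| ∧ (∀ i, (a i : ℚ) = s * a' i) ∧ ∀ x y (t : ℚ), x ≠ y →
      t ≠ 0 → (∀ i, (a i : ℚ) = t * (B x i - B y i)) →
        ∃ t' : ℚ, t' ≠ 0 ∧ |t'| ≤ 1 ∧ ∀ i, (a' i : ℚ) = t' * (B x i - B y i) := by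
  by_cases h : ∃ x y, ∃ s : ℚ, 1 ≤ |s| ∧ ∀ i, (a i : ℚ) = s * (B x i - B y i)
  · obtain ⟨x', y', s, hs, h⟩ := h
    have hs0 : s ≠ 0 := by
      rintro rfl
      norm_num at hs
    refine ⟨fun i => B x' i - B y' i, s, hs, by simpa using h, fun x y t hxy ht0 ht => ?_⟩
    have huv : (t • (Pi.single x 1 - Pi.single y 1) : Fin (r + 1) → ℚ) =
        s • (Pi.single x' 1 - Pi.single y' 1) := by
      refine eq_of_coords hD ?_ fun i => ?_
      · simp [← Finset.mul_sum, Finset.sum_sub_distrib]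
      · have := (ht i).symm.trans (h i)
        simpa [mul_assoc, sub_mul, ← Finset.mul_sum, Finset.sum_sub_distrib, Pi.single_apply]
          using this
    have hx : t = s * ((if x = x' then 1 else 0) - (if x = y' then 1 else 0)) := by
      have := congrFun huv x
      simpa [hxy, Pi.single_apply] using this
    refine ⟨t / s, div_ne_zero ht0 hs0, ?_, fun i => ?_⟩
    · rw [hx, mul_div_cancel_left₀ _ hs0]
      split_ifs <;> norm_num
    · have := (h i).symm.trans (ht i)
      push_cast
      field_simp
      linarith
  · push Not at h
    refine ⟨a, 1, by simp, by simp, fun x y t hxy ht0 ht => ⟨t, ht0, ?_, ht⟩⟩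
    by_contra! hlt
    obtain ⟨i, hi⟩ := h x y t hlt.le
    exact hi (ht i)

theorem exists_cliqueForm_of_clique {r n : ℕ} {A : Matrix (Fin r) (Fin n) ℤ} (hr : 17 ≤ r)
    (hnonzero : ∀ j, (fun i => A i j) ≠ 0)
    (hnonpar : ∀ j j', j ≠ j' → ¬ IntParallel (fun i => A i j) (fun i => A i j'))
    (hmod : DeltaModular A 3) {φ : (Fin r ⊕ PairIdx r) → Fin n} (hφ : Function.Injective φ)
    (hclique : ∀ S : Set (Fin r ⊕ PairIdx r), ColsIndepQ (IDmat r) S ↔ ColsIndepQ A (φ '' S)) :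
    ∃ (β : ℤ) (w : Fin n → Fin (r + 1) → ℤ), 1 ≤ β ∧ β ≤ 3 ∧ CliqueForm β w := by
  obtain ⟨B, β, hβ1, hβ3, hβ, hedge⟩ := exists_int_vertices hr hnonzero hnonpar hmod hφ hclique
  have hD : (vertexMatrix fun x i => (B x i : ℚ)).det ≠ 0 := by
    intro h
    rw [h, abs_zero] at hβ
    have : (0 : ℤ) = β := by exact_mod_cast hβ
    omega
  choose a s hs has ha using fun j => exists_normalized hD fun i => A i j
  have hs0 : ∀ j, s j ≠ 0 := by
    intro j h
    have := hs j
    rw [h] at this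
    norm_num at this
  refine ⟨β, (exists_cliqueForm (by omega) hβ a ?_ ?_ ?_).imp fun w hw => ⟨hβ1, hβ3, hw⟩⟩
  · intro j j' hj p q h
    obtain ⟨h1, h2⟩ := eq_zero_of_smul_add_smul_eq_zero hnonpar hj (p := p / s j) (q := -q / s j')
      fun i => by
        have e : (p * a j i : ℚ) = q * a j' i := by exact_mod_cast h i
        have := hs0 j
        have := hs0 j'
        rw [has, has]
        field_simp
        linarith
    rw [div_eq_zero_iff, or_iff_left (hs0 _)] at h1 h2
    exact ⟨by exact_mod_cast h1, by exact_mod_cast neg_eq_zero.1 h2⟩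
  · intro x y hxy
    obtain ⟨j, t, ht0, ht⟩ := hedge x y hxy
    exact ⟨j, ha j x y t hxy ht0 ht⟩
  · intro g
    have h1 : ((A.submatrix id g).det : ℚ) =
        (∏ l, s (g l)) * ((Matrix.of fun i l => a (g l) i).det : ℤ) := by
      rw [Int.cast_det, Int.cast_det, ← Matrix.det_mul_row]
      congr 1
      ext i l
      simpa using has (g l) i
    have h2 : |((A.submatrix id g).det : ℚ)| ≤ 3 := by
      exact_mod_cast hmod.abs_det_le (by norm_num) g
    have h3 : 1 ≤ ∏ l, |s (g l)| := by
      simpa using Finset.prod_le_prod (s := Finset.univ) (fun _ _ => zero_le_one)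
        fun l _ => hs (g l)
    rw [h1, abs_mul, Finset.abs_prod] at h2
    have h4 := (le_mul_of_one_le_left (abs_nonneg _) h3).trans h2
    exact_mod_cast h4

theorem spanning_clique_case (r n : ℕ) (hr : 9 * Nat.choose 94 2 + 2 ≤ r)
    (A : Matrix (Fin r) (Fin n) ℤ)
    (hrank : (A.map (fun z : ℤ => (z : ℚ))).rank = r)
    (hnonzero : ∀ j, (fun i => A i j) ≠ 0)
    (hnonpar : ∀ j j', j ≠ j' → ¬ IntParallel (fun i => A i j) (fun i => A i j'))
    (hmod : DeltaModular A 3)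
    (φ : (Fin r ⊕ PairIdx r) → Fin n) (hφ : Function.Injective φ)
    (hclique : ∀ S : Set (Fin r ⊕ PairIdx r),
      ColsIndepQ (IDmat r) S ↔ ColsIndepQ A (φ '' S)) :
    n ≤ (r + 1).choose 2 + 2 * (r - 1) := by
  have hr' : 39341 ≤ r := le_trans (by decide) hr
  obtain ⟨β, w, hβ1, hβ3, hw⟩ :=
    exists_cliqueForm_of_clique (by omega) hnonzero hnonpar hmod hφ hclique
  obtain rfl | hβ : β = 1 ∨ (β = 2 ∨ β = 3) := by omega
  · exact hw.card_le_of_one (by omega)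
  · exact hw.card_le_of_two_three hβ (by omega)
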